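/- Let f : ℝⁿ → ℝ be real analytic and nonnegative, and suppose N := f⁻¹(0) is nonempty and has empty interior (for instance, N is a submanifold of positive codimension). Then for every p ∈ N there exists a nonconstant gradient flow γ : [0,∞) → ℝⁿ of f with lim_{t→∞} γ(t) = p. -/

import Mathlib

open Filter

namespace GFL
open Topology Set

set_option linter.deprecated false
set_option linter.unusedSimpArgs false
set_option linter.unusedVariables false
set_option linter.unusedSectionVars false

section FC
variable {ι : Type*} [Fintype ι] [DecidableEq ι]
variable {B : Type*} [NormedAddCommGroup B] [NormedSpace ℝ B]

/-- operator substitution in a formal series -/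
noncomputable def opSeries (ι : Type*) [Fintype ι] [DecidableEq ι] (B : Type*) [NormedRing B]
    [NormedAlgebra ℝ B] (p : FormalMultilinearSeries ℝ (ι → ℝ) ℝ) :
    FormalMultilinearSeries ℝ (ι → B) B := fun k =>
  ∑ w : Fin k → ι, p k (fun j => Pi.single (w j) (1:ℝ)) •
    (ContinuousMultilinearMap.mkPiAlgebraFin ℝ k B).compContinuousLinearMap
      (fun j => ContinuousLinearMap.proj (w j))

lemma opSeries_norm_le {B : Type*} [NormedRing B] [NormedAlgebra ℝ B]
    (p : FormalMultilinearSeries ℝ (ι → ℝ) ℝ) (k : ℕ) :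
    ‖opSeries ι B p k‖ ≤ (Fintype.card ι : ℝ) ^ k * (‖p k‖ * max 1 ‖(1:B)‖) := by
  refine ContinuousMultilinearMap.opNorm_le_bound (by positivity) (fun X => ?_)
  have e : opSeries ι B p k X = ∑ w : Fin k → ι, p k (fun j => Pi.single (w j) (1:ℝ)) •
      (List.ofFn fun j => X j (w j)).prod := by
    simp only [opSeries, ContinuousMultilinearMap.sum_apply, ContinuousMultilinearMap.smul_apply,
      ContinuousMultilinearMap.compContinuousLinearMap_apply,
      ContinuousMultilinearMap.mkPiAlgebraFin_apply, ContinuousLinearMap.proj_apply]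
  rw [e]
  have : ∀ w ∈ (Finset.univ : Finset (Fin k → ι)), ‖p k (fun j => Pi.single (w j) (1:ℝ)) •
      (List.ofFn fun j => X j (w j)).prod‖ ≤ (‖p k‖ * max 1 ‖(1:B)‖) * ∏ j, ‖X j‖ := by
    intro w _
    rw [norm_smul, mul_assoc]
    have h1 : ‖p k (fun j => Pi.single (w j) (1:ℝ))‖ ≤ ‖p k‖ := by
      refine (ContinuousMultilinearMap.le_opNorm _ _).trans ?_
      have : ∏ i : Fin k, ‖(Pi.single (w i) (1:ℝ) : ι → ℝ)‖ = 1 := by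
        apply Finset.prod_eq_one
        intro i _
        rw [Pi.norm_single]; simp
      rw [this, mul_one]
    have h2 : ‖(List.ofFn fun j => X j (w j)).prod‖ ≤ max 1 ‖(1:B)‖ * ∏ j, ‖X j‖ := by
      have h3 := (ContinuousMultilinearMap.mkPiAlgebraFin ℝ k B).le_opNorm (fun j => X j (w j))
      rw [ContinuousMultilinearMap.mkPiAlgebraFin_apply] at h3
      refine h3.trans ?_
      have h4 : ‖ContinuousMultilinearMap.mkPiAlgebraFin ℝ k B‖ ≤ max 1 ‖(1:B)‖ := by
        rcases Nat.eq_zero_or_pos k with h | h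
        · subst h
          rw [ContinuousMultilinearMap.norm_mkPiAlgebraFin_zero]
          exact le_max_right _ _
        · exact (ContinuousMultilinearMap.norm_mkPiAlgebraFin_le_of_pos h).trans (le_max_left _ _)
      have h5 : ∏ j, ‖X j (w j)‖ ≤ ∏ j, ‖X j‖ :=
        Finset.prod_le_prod (fun _ _ => norm_nonneg _) (fun j _ => norm_le_pi_norm (X j) (w j))
      gcongr
    gcongr
  refine le_trans (norm_sum_le_of_le Finset.univ this) ?_
  simp [mul_assoc]

lemma opSeries_radius_pos {B : Type*} [NormedRing B] [NormedAlgebra ℝ B] (p : FormalMultilinearSeries ℝ (ι → ℝ) ℝ) (hp : 0 < p.radius) :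
    0 < (opSeries ι B p).radius := by
  obtain ⟨C, hC, r, hr, h⟩ : ∃ C > 0, ∃ r : ℝ, 0 < r ∧ ∀ n, ‖p n‖ ≤ C * r ^ n := by
    obtain ⟨C, r, hC, hr, h⟩ := p.le_mul_pow_of_radius_pos hp
    exact ⟨C, hC, r, hr, h⟩
  set N : ℝ := (Fintype.card ι : ℝ) + 1
  have hN : 0 < N := by positivity
  set ρ : NNReal := ⟨(N * r)⁻¹, by positivity⟩
  have hρ : 0 < ρ := by
    have : (0:ℝ) < (N * r)⁻¹ := by positivity
    exact this
  refine lt_of_lt_of_le (ENNReal.coe_pos.2 hρ) ((opSeries ι B p).le_radius_of_bound (C * max 1 ‖(1:B)‖) (fun n => ?_))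
  calc ‖opSeries ι B p n‖ * (ρ:ℝ) ^ n ≤ ((Fintype.card ι : ℝ) ^ n * (C * r ^ n * max 1 ‖(1:B)‖)) * (ρ:ℝ) ^ n := by
        gcongr
        exact (opSeries_norm_le p n).trans (by gcongr; exact h n)
    _ ≤ (N ^ n * (C * r ^ n * max 1 ‖(1:B)‖)) * (ρ:ℝ) ^ n := by
        gcongr; simp [N]
    _ = C * max 1 ‖(1:B)‖ := by
        have : (ρ : ℝ) = (N * r)⁻¹ := rfl
        rw [this, inv_pow, mul_pow]
        field_simp

lemma opSeries_char (p : FormalMultilinearSeries ℝ (ι → ℝ) ℝ) (k : ℕ) (χ : B →L[ℝ] ℝ)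
    (X : ι → (B →L[ℝ] B)) (z : ι → ℝ) (h : ∀ i, χ.comp (X i) = z i • χ) :
    χ.comp (opSeries ι (B →L[ℝ] B) p k (fun _ => X)) = (p k fun _ => z) • χ := by
  have key : ∀ (l : List ι), χ.comp ((l.map X).prod) = (l.map z).prod • χ := by
    intro l
    induction l with
    | nil => simp; rfl
    | cons a l ih =>
      simp only [List.map_cons, List.prod_cons]
      ext v
      have h1 := DFunLike.congr_fun (h a) ((l.map X).prod v)
      have h2 := DFunLike.congr_fun ih v
      simp only [ContinuousLinearMap.comp_apply, ContinuousLinearMap.smul_apply, smul_eq_mul] at *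
      change χ (X a ((l.map X).prod v)) = _
      rw [h1, h2]; ring
  have hz : (p k fun _ => z) = ∑ w : Fin k → ι, (∏ j, z (w j)) * p k (fun j => Pi.single (w j) (1:ℝ)) := by
    have : (fun _ : Fin k => z) = fun _ => ∑ i, z i • (Pi.single i (1:ℝ) : ι → ℝ) := by
      funext _; funext i
      simp [Finset.sum_apply, Pi.single_apply]
    rw [this, ContinuousMultilinearMap.map_sum]
    refine Finset.sum_congr rfl (fun w _ => ?_)
    rw [ContinuousMultilinearMap.map_smul_univ, smul_eq_mul]
  rw [hz]
  ext v
  simp only [opSeries, ContinuousMultilinearMap.sum_apply, ContinuousMultilinearMap.smul_apply,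
    ContinuousLinearMap.comp_apply, ContinuousLinearMap.smul_apply, smul_eq_mul, map_sum,
    ContinuousLinearMap.sum_apply, map_smul,
    ContinuousMultilinearMap.compContinuousLinearMap_apply,
    ContinuousMultilinearMap.mkPiAlgebraFin_apply, ContinuousLinearMap.proj_apply, Finset.sum_mul]
  refine Finset.sum_congr rfl (fun w _ => ?_)
  have := DFunLike.congr_fun (key (List.ofFn w)) v
  simp only [List.map_ofFn, ContinuousLinearMap.comp_apply, ContinuousLinearMap.smul_apply,
    smul_eq_mul, List.prod_ofFn (f := z ∘ w)] at this
  have e : (List.ofFn (fun j => X (w j))) = List.ofFn (X ∘ w) := rfl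
  rw [e, this]
  simp only [Function.comp]
  ring

theorem functional_calculus [CompleteSpace B] (g : (ι → ℝ) → ℝ) (hg : AnalyticAt ℝ g 0) :
    ∃ (G : (ι → (B →L[ℝ] B)) → (B →L[ℝ] B)) (r : ℝ), 0 < r ∧
      (∀ X, ‖X‖ < r → AnalyticAt ℝ G X) ∧
      ∀ (X : ι → (B →L[ℝ] B)) (z : ι → ℝ) (χ : B →L[ℝ] ℝ), ‖X‖ < r → ‖z‖ < r →
        (∀ i, χ.comp (X i) = z i • χ) → χ.comp (G X) = g z • χ := by
  obtain ⟨p, R, hp⟩ := hg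
  have h1 : 0 < (opSeries ι (B →L[ℝ] B) p).radius :=
    opSeries_radius_pos p (lt_of_lt_of_le hp.r_pos hp.r_le)
  have hP := (opSeries ι (B →L[ℝ] B) p).hasFPowerSeriesOnBall h1
  obtain ⟨r, hr0, hr⟩ : ∃ r : NNReal, 0 < r ∧ (r : ENNReal) < min R (opSeries ι (B →L[ℝ] B) p).radius := by
    obtain ⟨r, h, h'⟩ := ENNReal.lt_iff_exists_nnreal_btwn.1 (lt_min hp.r_pos h1)
    exact ⟨r, by exact_mod_cast h, h'⟩
  refine ⟨(opSeries ι (B →L[ℝ] B) p).sum, r, by exact_mod_cast hr0, fun X hX => ?_, fun X z χ hX hz h => ?_⟩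
  · apply hP.analyticAt_of_mem
    rw [Metric.mem_eball, edist_zero_right]
    refine lt_trans ?_ (hr.trans_le (min_le_right _ _))
    rw [← ofReal_norm, ENNReal.ofReal_lt_coe_iff (norm_nonneg _)]
    exact hX
  · have hX' : X ∈ Metric.eball (0 : ι → (B →L[ℝ] B)) (opSeries ι (B →L[ℝ] B) p).radius := by
      rw [Metric.mem_eball, edist_zero_right]
      refine lt_trans ?_ (hr.trans_le (min_le_right _ _))
      rw [← ofReal_norm, ENNReal.ofReal_lt_coe_iff (norm_nonneg _)]
      exact hX
    have hz' : z ∈ Metric.eball (0 : ι → ℝ) R := by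
      rw [Metric.mem_eball, edist_zero_right]
      refine lt_trans ?_ (hr.trans_le (min_le_left _ _))
      rw [← ofReal_norm, ENNReal.ofReal_lt_coe_iff (norm_nonneg _)]
      exact hz
    have s1 := hP.hasSum hX'
    have s2 := hp.hasSum hz'
    simp only [zero_add] at s1 s2
    have s3 := s1.mapL (ContinuousLinearMap.compL ℝ B B ℝ χ)
    have s4 := s2.smul_const χ
    refine s3.unique ?_
    convert s4 using 2 with k
    exact opSeries_char p k χ X z h

end FC
end GFL

namespace GFL
open Topology Set
set_option linter.deprecated false
set_option linter.unusedSimpArgs false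
set_option linter.unusedVariables false
set_option linter.unusedSectionVars false

lemma analyticAt_clm_apply {E X Y : Type*} [NormedAddCommGroup E] [NormedSpace ℝ E]
    [NormedAddCommGroup X] [NormedSpace ℝ X] [NormedAddCommGroup Y] [NormedSpace ℝ Y]
    {F : E → (X →L[ℝ] Y)} {v : E → X} {x : E} (hF : AnalyticAt ℝ F x) (hv : AnalyticAt ℝ v x) :
    AnalyticAt ℝ (fun x => F x (v x)) x :=
  (ContinuousLinearMap.analyticAt_bilinear (ContinuousLinearMap.id ℝ (X →L[ℝ] Y))
    (F x, v x)).comp_of_eq (hF.prod hv) rfl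

section Abs
variable {B : Type*} [NormedAddCommGroup B] [NormedSpace ℝ B] [CompleteSpace B]
  (R S : B →L[ℝ] B) (d : B →L[ℝ] ℝ) (e : B)

/-- generating functional -/
noncomputable def chi (S : B →L[ℝ] B) (d : B →L[ℝ] ℝ) (w : ℝ) : B →L[ℝ] ℝ :=
  d.comp (Ring.inverse (1 - w • S))

lemma unit_of_norm_lt (X : B →L[ℝ] B) (h : ‖X‖ < 1) : IsUnit (1 - X) :=
  ⟨Units.oneSub X h, rfl⟩

lemma isUnit_one_sub (hS : ‖S‖ ≤ 1) {w : ℝ} (hw : |w| < 1) : IsUnit (1 - w • S) := by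
  apply unit_of_norm_lt
  rw [norm_smul, Real.norm_eq_abs]
  nlinarith [abs_nonneg w, norm_nonneg S]

lemma chi_rec (hS : ‖S‖ ≤ 1) {w : ℝ} (hw : |w| < 1) (z : B) :
    chi S d w z = d z + w * chi S d w (S z) := by
  have h1 : Ring.inverse (1 - w • S) * (1 - w • S) = 1 :=
    Ring.inverse_mul_cancel _ (isUnit_one_sub S hS hw)
  have h2 := DFunLike.congr_fun h1 z
  have h3 : (Ring.inverse (1 - w • S)) (z - w • S z) = z := h2
  rw [map_sub, map_smul] at h3
  have h4 : (Ring.inverse (1 - w • S)) z = z + w • (Ring.inverse (1 - w • S)) (S z) :=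
    sub_eq_iff_eq_add.1 h3
  simp only [chi, ContinuousLinearMap.comp_apply]
  conv_lhs => rw [h4]
  simp

lemma chi_analytic (hS : ‖S‖ ≤ 1) {w : ℝ} (hw : |w| < 1) : AnalyticAt ℝ (chi S d) w := by
  obtain ⟨u, hu⟩ := isUnit_one_sub S hS hw
  have h1 : AnalyticAt ℝ (Ring.inverse : (B →L[ℝ] B) → (B →L[ℝ] B)) (1 - w • S) := by
    rw [← hu]; exact analyticAt_inverse u
  have h2 : AnalyticAt ℝ (fun w : ℝ => (1 - w • S : B →L[ℝ] B)) w :=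
    analyticAt_const.sub (analyticAt_id.smul analyticAt_const)
  have h3 : AnalyticAt ℝ (fun w : ℝ => Ring.inverse (1 - w • S : B →L[ℝ] B)) w := h1.comp_of_eq h2 rfl
  exact (ContinuousLinearMap.analyticAt (ContinuousLinearMap.compL ℝ B B ℝ d) _).comp h3

lemma chi_sep (hS : ‖S‖ ≤ 1) (z : B) (h : ∀ᶠ w in 𝓝[≠] (0:ℝ), chi S d w z = 0) (i : ℕ) :
    d ((S ^ i) z) = 0 := by
  have h0 : ∀ z : B, (∀ᶠ w in 𝓝[≠] (0:ℝ), chi S d w z = 0) → d z = 0 := by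
    intro z hz
    have hc : ContinuousAt (fun w => chi S d w z) 0 :=
      ((ContinuousLinearMap.apply ℝ ℝ z).continuous.continuousAt).comp
        (chi_analytic S d hS (by simp)).continuousAt
    have h1 : Tendsto (fun w => chi S d w z) (𝓝[≠] 0) (𝓝 (chi S d 0 z)) :=
      hc.tendsto.mono_left nhdsWithin_le_nhds
    have h2 : Tendsto (fun w => chi S d w z) (𝓝[≠] 0) (𝓝 0) :=
      tendsto_const_nhds.congr' (by filter_upwards [hz] with w hw; exact hw.symm)
    have h3 := tendsto_nhds_unique h1 h2
    rw [chi_rec S d hS (by simp)] at h3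
    simpa using h3
  induction i generalizing z with
  | zero => simpa using h0 z h
  | succ i ih =>
    rw [pow_succ]
    refine ih (S z) ?_
    have h1 : ∀ᶠ w in 𝓝[≠] (0:ℝ), |w| < 1 := by
      apply eventually_nhdsWithin_of_eventually_nhds
      exact (continuous_abs.tendsto (0:ℝ)).eventually_lt_const (by simp)
    filter_upwards [h, h1, self_mem_nhdsWithin] with w h2 h3 h4
    rw [chi_rec S d hS h3, h0 z h, zero_add] at h2
    exact (mul_eq_zero.1 h2).resolve_left h4

lemma chi_expand (hS : ‖S‖ ≤ 1) {w : ℝ} (hw : |w| < 1) (z : B) (m : ℕ) :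
    chi S d w z = (∑ i : Fin m, d ((S ^ (i:ℕ)) z) * w ^ (i:ℕ)) + w ^ m * chi S d w ((S ^ m) z) := by
  induction m with
  | zero => simp
  | succ m ih =>
    rw [ih, Fin.sum_univ_castSucc, chi_rec S d hS hw ((S ^ m) z), pow_succ' S m]
    simp only [Fin.val_castSucc, Fin.val_last]
    change _ = _ + w ^ (m+1) * chi S d w (S ((S ^ m) z))
    ring

lemma chi_R (hS : ‖S‖ ≤ 1) (hSR : ∀ z, S (R z) = z) (hdR : ∀ z, d (R z) = 0) {w : ℝ} (hw : |w| < 1) :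
    (chi S d w).comp R = w • chi S d w := by
  ext z
  simp only [ContinuousLinearMap.comp_apply]
  rw [chi_rec S d hS hw, hSR, hdR]; simp

lemma chi_R_pow (hS : ‖S‖ ≤ 1) (hSR : ∀ z, S (R z) = z) (hdR : ∀ z, d (R z) = 0) {w : ℝ} (hw : |w| < 1)
    (m : ℕ) (z : B) : chi S d w ((R ^ m) z) = w ^ m * chi S d w z := by
  induction m generalizing z with
  | zero => simp
  | succ m ih =>
    rw [pow_succ]
    have := DFunLike.congr_fun (chi_R R S d hS hSR hdR hw) z
    change chi S d w ((R ^ m) (R z)) = _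
    rw [ih]
    simp only [ContinuousLinearMap.comp_apply, ContinuousLinearMap.smul_apply, smul_eq_mul] at this
    rw [this]; ring

end Abs

/-- backward shift -/
noncomputable def shS : (BoundedContinuousFunction ℕ ℝ) →L[ℝ] (BoundedContinuousFunction ℕ ℝ) :=
  LinearMap.mkContinuous
    { toFun := fun z => BoundedContinuousFunction.ofNormedAddCommGroupDiscrete (fun n => z (n+1)) ‖z‖
        (fun n => z.norm_coe_le_norm _)
      map_add' := fun _ _ => by ext; rfl
      map_smul' := fun _ _ => by ext; rfl } 1
    (fun z => by
      rw [one_mul]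
      exact (BoundedContinuousFunction.norm_le (norm_nonneg _)).2 (fun n => z.norm_coe_le_norm _))

/-- forward shift -/
noncomputable def shR : (BoundedContinuousFunction ℕ ℝ) →L[ℝ] (BoundedContinuousFunction ℕ ℝ) :=
  LinearMap.mkContinuous
    { toFun := fun z => BoundedContinuousFunction.ofNormedAddCommGroupDiscrete
        (fun n => Nat.casesOn n 0 (fun k => z k)) ‖z‖
        (fun n => by cases n with
          | zero => simp
          | succ n => exact z.norm_coe_le_norm _)
      map_add' := fun _ _ => by ext n; cases n <;> simp
      map_smul' := fun _ _ => by ext n; cases n <;> simp } 1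
    (fun z => by
      rw [one_mul]
      refine (BoundedContinuousFunction.norm_le (norm_nonneg _)).2 (fun n => ?_)
      cases n with
          | zero => simp
          | succ n => exact z.norm_coe_le_norm _)

lemma shS_apply (z : BoundedContinuousFunction ℕ ℝ) (n : ℕ) : shS z n = z (n+1) := rfl
lemma shR_zero (z : BoundedContinuousFunction ℕ ℝ) : shR z 0 = 0 := rfl
lemma shR_succ (z : BoundedContinuousFunction ℕ ℝ) (n : ℕ) : shR z (n+1) = z n := rfl

lemma exists_shift : ∃ (R S : (BoundedContinuousFunction ℕ ℝ) →L[ℝ] (BoundedContinuousFunction ℕ ℝ))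
    (d : (BoundedContinuousFunction ℕ ℝ) →L[ℝ] ℝ) (e : BoundedContinuousFunction ℕ ℝ),
    ‖R‖ ≤ 1 ∧ ‖S‖ ≤ 1 ∧ (∀ z, S (R z) = z) ∧ (∀ z, d (R z) = 0) ∧ d e = 1 ∧ S e = 0 ∧
    (∀ z, (∀ i : ℕ, d ((S ^ i) z) = 0) → z = 0) := by
  refine ⟨shR, shS, BoundedContinuousFunction.evalCLM ℝ 0,
    BoundedContinuousFunction.ofNormedAddCommGroupDiscrete (fun n => if n = 0 then 1 else 0) 1
      (fun n => by split_ifs <;> simp), LinearMap.mkContinuous_norm_le _ zero_le_one _,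
      LinearMap.mkContinuous_norm_le _ zero_le_one _, ?_, ?_, ?_, ?_, ?_⟩
  · intro z; ext n; rfl
  · intro z; rfl
  · simp [BoundedContinuousFunction.evalCLM]
  · ext n; simp [shS_apply]
  · intro z hz
    have h : ∀ (i : ℕ) (z : BoundedContinuousFunction ℕ ℝ) (n : ℕ), (shS ^ i) z n = z (n + i) := by
      intro i
      induction i with
      | zero => intro z n; rfl
      | succ i ih =>
        intro z n
        rw [pow_succ]
        change (shS ^ i) (shS z) n = _
        rw [ih, shS_apply]; congr 1
    ext n
    have := hz n
    change (shS ^ n) z 0 = 0 at this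
    rw [h, zero_add] at this
    exact this

theorem weierstrass_abs {B : Type*} [NormedAddCommGroup B] [NormedSpace ℝ B] [CompleteSpace B]
    (R S : B →L[ℝ] B) (d : B →L[ℝ] ℝ) (e : B) (hR : ‖R‖ ≤ 1) (hS : ‖S‖ ≤ 1)
    (hSR : ∀ z, S (R z) = z) (hdR : ∀ z, d (R z) = 0) (hde : d e = 1) (hSe : S e = 0)
    (hsep : ∀ z, (∀ i : ℕ, d ((S ^ i) z) = 0) → z = 0) {ι : Type*} [Fintype ι] (g h : (ι → ℝ) × ℝ → ℝ) (hg : AnalyticAt ℝ g 0)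
    (hh : AnalyticAt ℝ h 0) (m : ℕ) (k : ℝ → ℝ) (hk : AnalyticAt ℝ k 0) (hk0 : k 0 ≠ 0)
    (hgk : ∀ᶠ y in 𝓝 (0:ℝ), g (0, y) = y ^ m * k y) :
    ∃ (q : (ι → ℝ) × ℝ → ℝ) (r : Fin m → (ι → ℝ) → ℝ), AnalyticAt ℝ q 0 ∧
      (∀ i, AnalyticAt ℝ (r i) 0) ∧
      ∀ᶠ z in 𝓝 (0 : (ι → ℝ) × ℝ), h z = q z * g z + ∑ i, r i z.1 * z.2 ^ (i:ℕ) := by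
  classical
  -- coordinates
  let P : (Option ι → ℝ) → (ι → ℝ) × ℝ := fun z => (fun i => z (some i), z none)
  have hP : ∀ z, AnalyticAt ℝ P z := by
    intro z
    refine AnalyticAt.prod ?_ ?_
    · rw [analyticAt_pi_iff]
      intro i
      exact (ContinuousLinearMap.proj (R := ℝ) (φ := fun _ : Option ι => ℝ) (some i)).analyticAt _
    · exact (ContinuousLinearMap.proj (R := ℝ) (φ := fun _ : Option ι => ℝ) none).analyticAt _
  have hP0 : P 0 = 0 := rfl
  obtain ⟨Gf, r1, hr1, hGa, hGc⟩ := functional_calculus (B := B) (g ∘ P) (hg.comp_of_eq (hP 0) hP0)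
  obtain ⟨Hf, r2, hr2, hHa, hHc⟩ := functional_calculus (B := B) (h ∘ P) (hh.comp_of_eq (hP 0) hP0)
  have hka : AnalyticAt ℝ (fun z : Unit → ℝ => k (z ())) 0 :=
    hk.comp_of_eq ((ContinuousLinearMap.proj (R := ℝ) (φ := fun _ : Unit => ℝ) ()).analyticAt _) rfl
  obtain ⟨Kf, r3, hr3, hKa, hKc⟩ := functional_calculus (B := B) _ hka
  -- separation for operators
  have sep : ∀ X Y : B →L[ℝ] B, (∀ᶠ w in 𝓝[≠] (0:ℝ), ∀ z, chi S d w (X z) = chi S d w (Y z)) →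
      X = Y := by
    intro X Y hXY
    ext1 z
    rw [← sub_eq_zero]
    refine hsep _ (chi_sep S d hS _ ?_)
    filter_upwards [hXY] with w hw
    rw [map_sub, hw, sub_self]
  have small : ∀ ε > 0, ∀ᶠ w in 𝓝[≠] (0:ℝ), |w| < ε := by
    intro ε hε
    apply eventually_nhdsWithin_of_eventually_nhds
    exact (continuous_abs.tendsto (0:ℝ)).eventually_lt_const (by simpa using hε)
  have hK0 : Kf 0 = k 0 • 1 := by
    refine sep _ _ ?_
    refine Eventually.of_forall (fun w z => ?_)
    have := hKc 0 0 (chi S d w) (by simpa using hr3) (by simpa using hr3) (by intro i; simp)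
    have := DFunLike.congr_fun this z
    simp only [ContinuousLinearMap.comp_apply] at this
    rw [this]; simp
  -- choose rho
  obtain ⟨ρ, hρ0, hρ1, hρ2, hρ3, hρK, hρg⟩ : ∃ ρ : ℝ, 0 < ρ ∧ ρ < r1 ∧ ρ < r2 ∧ ρ < r3 ∧
      ‖(k 0)⁻¹ • Kf (fun _ => ρ • R) - 1‖ < 1 ∧ ∀ y : ℝ, |y| < ρ → g (0, y) = y ^ m * k y := by
    have c1 : Tendsto (fun ρ : ℝ => ‖(k 0)⁻¹ • Kf (fun _ => ρ • R) - 1‖) (𝓝 0) (𝓝 0) := by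
      have a1 : ContinuousAt Kf ((fun ρ : ℝ => (fun _ : Unit => ρ • R)) 0) := by
        apply (hKa _ _).continuousAt
        simpa [Pi.zero_def] using hr3
      have a2 : ContinuousAt (fun ρ : ℝ => (fun _ : Unit => ρ • R)) 0 := by
        apply Continuous.continuousAt
        fun_prop
      have a3 : Tendsto (fun ρ : ℝ => ‖(k 0)⁻¹ • Kf (fun _ => ρ • R) - 1‖) (𝓝 0)
          (𝓝 ‖(k 0)⁻¹ • Kf (fun _ => (0:ℝ) • R) - 1‖) :=
        ((((a1.comp a2).const_smul (k 0)⁻¹).sub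
          (continuousAt_const (y := (1 : B →L[ℝ] B)))).norm).tendsto
      have h0 : (fun _ : Unit => (0:ℝ) • R) = 0 := by ext; simp
      rw [h0, hK0, smul_smul, inv_mul_cancel₀ hk0] at a3
      simpa using a3
    have c2 := c1.eventually_lt_const one_pos
    obtain ⟨ε, hε, hgε⟩ := Metric.eventually_nhds_iff.1 hgk
    obtain ⟨ε2, hε2, hc2⟩ := Metric.eventually_nhds_iff.1 c2
    refine ⟨min (min (min r1 r2) (min r3 ε)) ε2 / 2, by positivity, ?_, ?_, ?_, ?_, ?_⟩
    · have : min (min (min r1 r2) (min r3 ε)) ε2 ≤ r1 := by simp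
      linarith
    · have : min (min (min r1 r2) (min r3 ε)) ε2 ≤ r2 := by simp
      linarith
    · have : min (min (min r1 r2) (min r3 ε)) ε2 ≤ r3 := by simp
      linarith
    · apply hc2
      have : min (min (min r1 r2) (min r3 ε)) ε2 ≤ ε2 := by simp
      have h0 : 0 < min (min (min r1 r2) (min r3 ε)) ε2 := by positivity
      rw [Real.dist_eq, sub_zero, abs_of_pos (by positivity)]; linarith
    · intro y hy
      apply hgε
      have : min (min (min r1 r2) (min r3 ε)) ε2 ≤ ε := by simp
      have h0 : 0 < min (min (min r1 r2) (min r3 ε)) ε2 := by positivity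
      rw [Real.dist_eq, sub_zero]; linarith
  -- the tuple of operators
  let X : (ι → ℝ) → (Option ι → (B →L[ℝ] B)) := fun x o => o.elim (ρ • R) (fun i => x i • 1)
  have hXn : ∀ x, ‖X x‖ ≤ max ρ ‖x‖ := by
    intro x
    refine (pi_norm_le_iff_of_nonneg (by positivity)).2 (fun o => ?_)
    cases o with
    | none =>
      change ‖ρ • R‖ ≤ _
      refine le_trans ?_ (le_max_left _ _)
      rw [norm_smul, Real.norm_eq_abs, abs_of_pos hρ0]
      nlinarith
    | some i =>
      change ‖x i • (1 : B →L[ℝ] B)‖ ≤ _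
      refine le_trans ?_ (le_max_right _ _)
      rw [norm_smul]
      calc ‖x i‖ * ‖(1 : B →L[ℝ] B)‖ ≤ ‖x‖ * 1 := by
            gcongr
            · exact norm_le_pi_norm x i
            · exact ContinuousLinearMap.norm_id_le
        _ = _ := mul_one _
  have hXa : ∀ x, AnalyticAt ℝ X x := by
    intro x
    rw [analyticAt_pi_iff]
    intro o
    cases o with
    | none => exact analyticAt_const
    | some i =>
      exact ((ContinuousLinearMap.proj (R := ℝ) (φ := fun _ : ι => ℝ) i).analyticAt _).smul
        analyticAt_const
  have char : ∀ (x : ι → ℝ) (w : ℝ), |w| < 1 → ∀ o, (chi S d w).comp (X x o) =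
      (o.elim (ρ * w) x : ℝ) • chi S d w := by
    intro x w hw o
    cases o with
    | none =>
      change (chi S d w).comp (ρ • R) = (ρ * w) • _
      rw [ContinuousLinearMap.comp_smul, chi_R R S d hS hSR hdR hw, smul_smul]
    | some i =>
      change (chi S d w).comp (x i • 1) = x i • _
      rw [ContinuousLinearMap.comp_smul]
      rfl
  have hzn : ∀ (x : ι → ℝ) (w : ℝ), |w| < 1 → ‖(fun o : Option ι => (o.elim (ρ * w) x : ℝ))‖ ≤
      max ρ ‖x‖ := by
    intro x w hw
    refine (pi_norm_le_iff_of_nonneg (by positivity)).2 (fun o => ?_)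
    cases o with
    | none =>
      refine le_trans ?_ (le_max_left _ _)
      simp only [Option.elim_none, Real.norm_eq_abs, abs_mul, abs_of_pos hρ0]
      nlinarith [abs_nonneg w]
    | some i => exact (norm_le_pi_norm x i).trans (le_max_right _ _)
  have charG : ∀ (x : ι → ℝ) (w : ℝ), ‖x‖ < r1 → |w| < 1 → ∀ v, chi S d w (Gf (X x) v) =
      g (x, ρ * w) * chi S d w v := by
    intro x w hx hw v
    have := hGc (X x) (fun o => o.elim (ρ * w) x) (chi S d w) ((hXn x).trans_lt (max_lt hρ1 hx))
      ((hzn x w hw).trans_lt (max_lt hρ1 hx)) (char x w hw)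
    exact DFunLike.congr_fun this v
  have charH : ∀ (x : ι → ℝ) (w : ℝ), ‖x‖ < r2 → |w| < 1 → ∀ v, chi S d w (Hf (X x) v) =
      h (x, ρ * w) * chi S d w v := by
    intro x w hx hw v
    have := hHc (X x) (fun o => o.elim (ρ * w) x) (chi S d w) ((hXn x).trans_lt (max_lt hρ2 hx))
      ((hzn x w hw).trans_lt (max_lt hρ2 hx)) (char x w hw)
    exact DFunLike.congr_fun this v
  have charK : ∀ (w : ℝ), |w| < 1 → ∀ v, chi S d w (Kf (fun _ => ρ • R) v) =
      k (ρ * w) * chi S d w v := by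
    intro w hw v
    have n1 : ‖(fun _ : Unit => ρ • R)‖ < r3 := by
      refine lt_of_le_of_lt ?_ hρ3
      refine (pi_norm_le_iff_of_nonneg hρ0.le).2 (fun o => ?_)
      rw [norm_smul, Real.norm_eq_abs, abs_of_pos hρ0]
      nlinarith
    have n2 : ‖(fun _ : Unit => ρ * w)‖ < r3 := by
      refine lt_of_le_of_lt ?_ hρ3
      refine (pi_norm_le_iff_of_nonneg hρ0.le).2 (fun o => ?_)
      rw [Real.norm_eq_abs, abs_mul, abs_of_pos hρ0]
      nlinarith
    have := hKc (fun _ => ρ • R) (fun _ => ρ * w) (chi S d w) n1 n2 (fun _ => by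
      rw [ContinuousLinearMap.comp_smul, chi_R R S d hS hSR hdR hw, smul_smul])
    exact DFunLike.congr_fun this v
  have hG0 : Gf (X 0) = ρ ^ m • (R ^ m * Kf (fun _ => ρ • R)) := by
    refine sep _ _ ?_
    filter_upwards [small 1 one_pos] with w hw z
    rw [charG 0 w (by simpa using hr1) hw]
    simp only [ContinuousLinearMap.smul_apply, map_smul, smul_eq_mul]
    change _ = ρ ^ m * chi S d w ((R ^ m) (Kf (fun _ => ρ • R) z))
    rw [chi_R_pow R S d hS hSR hdR hw, charK w hw, hρg (ρ * w)]
    · ring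
    · rw [abs_mul, abs_of_pos hρ0]; nlinarith [abs_nonneg w]
  set c : ℝ := (k 0)⁻¹ * (ρ ^ m)⁻¹ with hc
  let T : (ι → ℝ) → (B →L[ℝ] B) := fun x => 1 + (c • Gf (X x) - R ^ m) * S ^ m
  have hGX : ∀ x, ‖x‖ < r1 → AnalyticAt ℝ (fun x => Gf (X x)) x := fun x hx =>
    (hGa (X x) ((hXn x).trans_lt (max_lt hρ1 hx))).comp_of_eq (hXa x) rfl
  have hHX : ∀ x, ‖x‖ < r2 → AnalyticAt ℝ (fun x => Hf (X x)) x := fun x hx =>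
    (hHa (X x) ((hXn x).trans_lt (max_lt hρ2 hx))).comp_of_eq (hXa x) rfl
  have hTa : AnalyticAt ℝ T 0 := by
    refine analyticAt_const.add (AnalyticAt.mul (AnalyticAt.sub ?_ analyticAt_const) analyticAt_const)
    exact (analyticAt_const (v := c)).smul (hGX 0 (by simpa using hr1))
  have powle : ∀ (Y : B →L[ℝ] B), ‖Y‖ ≤ 1 → ∀ j : ℕ, ‖Y ^ j‖ ≤ 1 := by
    intro Y hY j
    induction j with
    | zero => exact ContinuousLinearMap.norm_id_le
    | succ j ih =>
      rw [pow_succ]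
      exact (norm_mul_le _ _).trans (by nlinarith [norm_nonneg Y, norm_nonneg (Y ^ j)])
  have hT0 : IsUnit (T 0) := by
    have e1 : T 0 = 1 - (-(R ^ m * ((k 0)⁻¹ • Kf (fun _ => ρ • R) - 1) * S ^ m)) := by
      simp only [T]
      rw [hG0, smul_smul, hc, mul_assoc, inv_mul_cancel₀ (by positivity), mul_one, sub_neg_eq_add,
        mul_sub, mul_one, mul_smul_comm]
    rw [e1]
    apply unit_of_norm_lt
    rw [norm_neg]
    calc _ ≤ ‖R ^ m‖ * ‖(k 0)⁻¹ • Kf (fun _ => ρ • R) - 1‖ * ‖S ^ m‖ := by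
          refine (norm_mul_le _ _).trans ?_
          gcongr
          exact norm_mul_le _ _
      _ ≤ 1 * ‖(k 0)⁻¹ • Kf (fun _ => ρ • R) - 1‖ * 1 := by
          gcongr
          · exact powle R hR m
          · exact powle S hS m
      _ < 1 := by simpa using hρK
  have hTinv : AnalyticAt ℝ (fun x => Ring.inverse (T x)) 0 := by
    obtain ⟨u, hu⟩ := hT0
    exact (analyticAt_inverse (𝕜 := ℝ) u).comp_of_eq hTa hu.symm
  have hTu : ∀ᶠ x in 𝓝 (0 : ι → ℝ), IsUnit (T x) :=
    hTa.continuousAt.eventually (Units.isOpen.mem_nhds hT0)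
  let Z : (ι → ℝ) → B := fun x => (Ring.inverse (T x)) (Hf (X x) e)
  have hZa : AnalyticAt ℝ Z 0 :=
    analyticAt_clm_apply hTinv (analyticAt_clm_apply (hHX 0 (by simpa using hr2)) analyticAt_const)
  refine ⟨fun z => c * chi S d (ρ⁻¹ * z.2) ((S ^ m) (Z z.1)),
    fun i x => d ((S ^ (i:ℕ)) (Z x)) * (ρ⁻¹) ^ (i:ℕ), ?_, ?_, ?_⟩
  · have a1 : AnalyticAt ℝ (fun z : (ι → ℝ) × ℝ => chi S d (ρ⁻¹ * z.2)) 0 :=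
      (chi_analytic S d hS (w := 0) (by simp)).comp_of_eq
        (analyticAt_const.mul analyticAt_snd) (by simp)
    have a2 : AnalyticAt ℝ (fun z : (ι → ℝ) × ℝ => (S ^ m) (Z z.1)) 0 :=
      (ContinuousLinearMap.analyticAt (S ^ m) _).comp_of_eq (hZa.comp_of_eq analyticAt_fst rfl) rfl
    exact analyticAt_const.mul (analyticAt_clm_apply a1 a2)
  · intro i
    refine AnalyticAt.mul ?_ analyticAt_const
    exact (ContinuousLinearMap.analyticAt (d.comp (S ^ (i:ℕ))) _).comp_of_eq hZa rfl
  · have e1 : ∀ᶠ z in 𝓝 (0 : (ι → ℝ) × ℝ), IsUnit (T z.1) :=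
      (continuous_fst.tendsto (0 : (ι → ℝ) × ℝ)).eventually hTu
    have e2 : ∀ᶠ z in 𝓝 (0 : (ι → ℝ) × ℝ), ‖z.1‖ < min r1 r2 := by
      refine Tendsto.eventually_lt_const (v := 0) (by positivity) ?_
      exact (continuous_fst.norm.tendsto' _ _ (by simp))
    have e3 : ∀ᶠ z in 𝓝 (0 : (ι → ℝ) × ℝ), |ρ⁻¹ * z.2| < 1 := by
      refine Tendsto.eventually_lt_const (v := 0) one_pos ?_
      exact ((continuous_const.mul continuous_snd).abs.tendsto' _ _ (by simp))
    filter_upwards [e1, e2, e3] with z hz1 hz2 hz3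
    obtain ⟨x, y⟩ := z
    simp only at hz1 hz2 hz3 ⊢
    set w := ρ⁻¹ * y with hw
    have hy : ρ * w = y := by rw [hw]; field_simp
    have hTZ : T x (Z x) = Hf (X x) e := by
      have := DFunLike.congr_fun (Ring.mul_inverse_cancel _ hz1) (Hf (X x) e)
      exact this
    have hTZ2 : T x (Z x) = Z x + (c • Gf (X x) ((S ^ m) (Z x)) - (R ^ m) ((S ^ m) (Z x))) := rfl
    have := congrArg (chi S d w) (hTZ2.symm.trans hTZ)
    rw [map_add, map_sub, map_smul, charG x w (hz2.trans_le (min_le_left _ _)) hz3,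
      charH x w (hz2.trans_le (min_le_right _ _)) hz3, chi_R_pow R S d hS hSR hdR hz3, hy] at this
    have he : chi S d w e = 1 := by
      rw [chi_rec S d hS hz3, hde, hSe]; simp
    rw [he, mul_one, chi_expand S d hS hz3 (Z x) m] at this
    rw [← this, hw]
    simp only [mul_pow, smul_eq_mul]
    have : ∑ i : Fin m, d ((S ^ (i:ℕ)) (Z x)) * (ρ⁻¹ ^ (i:ℕ) * y ^ (i:ℕ)) =
      ∑ i : Fin m, d ((S ^ (i:ℕ)) (Z x)) * ρ⁻¹ ^ (i:ℕ) * y ^ (i:ℕ) :=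
      Finset.sum_congr rfl (fun i _ => by ring)
    rw [this]
    ring

theorem weierstrass {ι : Type*} [Fintype ι] (g h : (ι → ℝ) × ℝ → ℝ) (hg : AnalyticAt ℝ g 0)
    (hh : AnalyticAt ℝ h 0) (m : ℕ) (k : ℝ → ℝ) (hk : AnalyticAt ℝ k 0) (hk0 : k 0 ≠ 0)
    (hgk : ∀ᶠ y in 𝓝 (0:ℝ), g (0, y) = y ^ m * k y) :
    ∃ (q : (ι → ℝ) × ℝ → ℝ) (r : Fin m → (ι → ℝ) → ℝ), AnalyticAt ℝ q 0 ∧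
      (∀ i, AnalyticAt ℝ (r i) 0) ∧
      ∀ᶠ z in 𝓝 (0 : (ι → ℝ) × ℝ), h z = q z * g z + ∑ i, r i z.1 * z.2 ^ (i:ℕ) := by
  obtain ⟨R, S, d, e, hR, hS, hSR, hdR, hde, hSe, hsep⟩ := exists_shift
  exact weierstrass_abs R S d e hR hS hSR hdR hde hSe hsep g h hg hh m k hk hk0 hgk

end GFL

namespace GFL
open Topology Set
set_option linter.deprecated false
set_option linter.unusedSimpArgs false
set_option linter.unusedVariables false
set_option linter.unusedSectionVars false

/-- extension of a derivation (as a map to dual numbers) to an algebraic element -/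
theorem ext_dual {K : Type*} [Field K] [CharZero K] (A : Subring K) (φ : A →+* DualNumber K)
    (hφ : ∀ b : A, (φ b).fst = (b : K)) (a : K)
    (halg : ∃ P : Polynomial A, P ≠ 0 ∧ P.eval₂ A.subtype a = 0) :
    ∃ u : K, ∀ P : Polynomial A, P.eval₂ A.subtype a = 0 →
      P.eval₂ φ (TrivSqZeroExt.inl a + TrivSqZeroExt.inr u) = 0 := by
  classical
  have hinj : Function.Injective A.subtype := Subtype.val_injective
  have hex : ∃ n : ℕ, ∃ P : Polynomial A, P ≠ 0 ∧ P.eval₂ A.subtype a = 0 ∧ P.natDegree = n := by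
    obtain ⟨P, h1, h2⟩ := halg
    exact ⟨_, P, h1, h2, rfl⟩
  obtain ⟨Q, hQ0, hQa, hQn⟩ := Nat.find_spec hex
  have hmin : ∀ P : Polynomial A, P.eval₂ A.subtype a = 0 → P.natDegree < Q.natDegree → P = 0 := by
    intro P hP hlt
    by_contra h
    rw [hQn] at hlt
    exact Nat.find_min hex hlt ⟨P, h, hP, rfl⟩
  have hQdeg : 0 < Q.natDegree := by
    rw [Nat.pos_iff_ne_zero]
    intro h
    rw [Polynomial.eq_C_of_natDegree_eq_zero h, Polynomial.eval₂_C] at hQa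
    have : Q.coeff 0 = 0 := hinj (by simpa using hQa)
    apply hQ0
    rw [Polynomial.eq_C_of_natDegree_eq_zero h, this, Polynomial.C_0]
  have hQ' : Q.derivative.eval₂ A.subtype a ≠ 0 := by
    intro h
    have := hmin _ h (Polynomial.natDegree_derivative_lt hQdeg.ne')
    have h2 := Polynomial.natDegree_eq_zero_of_derivative_eq_zero this
    omega
  have hcomp : ∀ P : Polynomial A, ((P.map φ).eval (TrivSqZeroExt.inl a)).fst =
      P.eval₂ A.subtype a := by
    intro P
    rw [Polynomial.eval_map]
    have : (TrivSqZeroExt.fstHom K K K).toRingHom (P.eval₂ φ (TrivSqZeroExt.inl a)) =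
        P.eval₂ ((TrivSqZeroExt.fstHom K K K).toRingHom.comp φ) a := by
      rw [Polynomial.hom_eval₂]; rfl
    have h2 : (TrivSqZeroExt.fstHom K K K).toRingHom.comp φ = A.subtype := by
      ext b; exact hφ b
    rw [h2] at this
    exact this
  set s := ((Q.map φ).eval (TrivSqZeroExt.inl a)).snd with hs
  set u := - s / Q.derivative.eval₂ A.subtype a with hu
  have hQu : Q.eval₂ φ (TrivSqZeroExt.inl a + TrivSqZeroExt.inr u) = 0 := by
    rw [← Polynomial.eval_map]
    rw [Polynomial.eval_add_of_sq_eq_zero (Q.map φ) (TrivSqZeroExt.inl a) (TrivSqZeroExt.inr u)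
      (by rw [sq, TrivSqZeroExt.inr_mul_inr]), Polynomial.derivative_map]
    ext
    · rw [TrivSqZeroExt.fst_add, hcomp, hQa]
      simp
    · rw [TrivSqZeroExt.snd_add, ← hs]
      simp only [TrivSqZeroExt.snd_mul, hcomp, TrivSqZeroExt.snd_inr, TrivSqZeroExt.fst_inr]
      rw [hu]
      simp
      field_simp
      ring
  refine ⟨u, ?_⟩
  have unit : ∀ b : A, b ≠ 0 → IsUnit (φ b) := by
    intro b hb
    rw [TrivSqZeroExt.isUnit_iff_isUnit_fst, hφ]
    exact isUnit_iff_ne_zero.2 (fun h => hb (Subtype.ext h))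
  intro P
  induction hn : P.natDegree using Nat.strong_induction_on generalizing P with
  | _ n ih =>
    intro hP
    by_cases hlt : P.natDegree < Q.natDegree
    · rw [hmin P hP hlt]; simp
    push Not at hlt
    by_cases h0 : P.natDegree = 0
    · omega
    have hd := Polynomial.natDegree_cancelLeads_lt_of_natDegree_le_natDegree (p := Q) (q := P) hlt
      (Nat.pos_of_ne_zero h0)
    have h1 : (Q.cancelLeads P).eval₂ A.subtype a = 0 := by
      simp [Polynomial.cancelLeads, Polynomial.eval₂_mul, Polynomial.eval₂_sub, hP, hQa]
    have h2 := ih _ (hn ▸ hd) _ rfl h1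
    simp only [Polynomial.cancelLeads, Polynomial.eval₂_sub, Polynomial.eval₂_mul,
      Polynomial.eval₂_C, hQu, mul_zero, sub_zero, Polynomial.eval₂_pow, Polynomial.eval₂_X] at h2
    rw [Nat.sub_eq_zero_of_le hlt, pow_zero, mul_one] at h2
    exact (unit _ (Polynomial.leadingCoeff_ne_zero.2 hQ0)).mul_right_eq_zero.1 h2

end GFL

namespace GFL
open Topology Set
set_option linter.deprecated false
set_option linter.unusedSimpArgs false
set_option linter.unusedVariables false
set_option linter.unusedSectionVars false

/-- the ultrapower of the reals -/
abbrev Ust (U : Ultrafilter ℕ) := Filter.Germ (U : Filter ℕ) ℝ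

section Ev
variable {E : Type*} [NormedAddCommGroup E] [NormedSpace ℝ E]
variable {E' : Type*} [NormedAddCommGroup E'] [NormedSpace ℝ E']
variable (U : Ultrafilter ℕ)

/-- germ of a sequence -/
def gm (s : ℕ → ℝ) : Ust U := ((s : ℕ → ℝ) : Filter.Germ (U : Filter ℕ) ℝ)

lemma gm_eq_zero {s : ℕ → ℝ} : gm U s = 0 ↔ ∀ᶠ k in (U : Filter ℕ), s k = 0 := Filter.Germ.coe_eq
lemma gm_eq {s t : ℕ → ℝ} : gm U s = gm U t ↔ ∀ᶠ k in (U : Filter ℕ), s k = t k := Filter.Germ.coe_eq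
lemma gm_surj (a : Ust U) : ∃ s, gm U s = a := Quot.exists_rep a
lemma gm_mul (s t : ℕ → ℝ) : gm U (fun k => s k * t k) = gm U s * gm U t := rfl
lemma gm_add (s t : ℕ → ℝ) : gm U (fun k => s k + t k) = gm U s + gm U t := rfl
lemma gm_pow (s : ℕ → ℝ) (m : ℕ) : gm U (fun k => s k ^ m) = gm U s ^ m := rfl

/-- value at the generic point -/
def ev (x : ℕ → E) (g : E → ℝ) : Ust U := gm U (fun k => g (x k))

/-- derivative at the generic point -/
noncomputable def ev1 (x u : ℕ → E) (g : E → ℝ) : Ust U := gm U (fun k => fderiv ℝ g (x k) (u k))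

/-- value and derivative as dual number -/
noncomputable def dl (x u : ℕ → E) (g : E → ℝ) : DualNumber (Ust U) :=
  TrivSqZeroExt.inl (ev U x g) + TrivSqZeroExt.inr (ev1 U x u g)

@[simp] lemma dl_fst (x u : ℕ → E) (g : E → ℝ) : (dl U x u g).fst = ev U x g := by simp [dl]
@[simp] lemma dl_snd (x u : ℕ → E) (g : E → ℝ) : (dl U x u g).snd = ev1 U x u g := by simp [dl]

/-- ring of values -/
def AA (x : ℕ → E) : Subring (Ust U) where
  carrier := {b | ∃ g : E → ℝ, AnalyticAt ℝ g 0 ∧ ev U x g = b}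
  mul_mem' := by
    rintro _ _ ⟨g, hg, rfl⟩ ⟨h, hh, rfl⟩
    exact ⟨fun z => g z * h z, hg.mul hh, rfl⟩
  one_mem' := ⟨fun _ => 1, analyticAt_const, rfl⟩
  add_mem' := by
    rintro _ _ ⟨g, hg, rfl⟩ ⟨h, hh, rfl⟩
    exact ⟨fun z => g z + h z, hg.add hh, rfl⟩
  zero_mem' := ⟨fun _ => 0, analyticAt_const, rfl⟩
  neg_mem' := by
    rintro _ ⟨g, hg, rfl⟩
    exact ⟨fun z => - g z, hg.neg, rfl⟩

lemma ev_mem (x : ℕ → E) {g : E → ℝ} (hg : AnalyticAt ℝ g 0) : ev U x g ∈ AA U x := ⟨g, hg, rfl⟩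

/-- tangent sequences -/
def Tan (x u : ℕ → E) : Prop := ∀ g : E → ℝ, AnalyticAt ℝ g 0 → ev U x g = 0 → ev1 U x u g = 0

variable {U} {x u : ℕ → E}

lemma ev_congr (hx : Tendsto x U (𝓝 0))
    {g h : E → ℝ} (hgh : g =ᶠ[𝓝 0] h) : ev U x g = ev U x h :=
  (gm_eq U).2 (hx.eventually hgh)

lemma dl_congr (hx : Tendsto x U (𝓝 0))
    {g h : E → ℝ} (hgh : g =ᶠ[𝓝 0] h) : dl U x u g = dl U x u h := by
  have h1 : ev1 U x u g = ev1 U x u h := by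
    refine (gm_eq U).2 ?_
    filter_upwards [hx.eventually hgh.eventuallyEq_nhds] with k hk
    rw [hk.fderiv_eq]
  rw [dl, dl, ev_congr hx hgh, h1]

lemma dl_add (hx : Tendsto x U (𝓝 0))
    {g h : E → ℝ} (hg : AnalyticAt ℝ g 0) (hh : AnalyticAt ℝ h 0) :
    dl U x u (fun z => g z + h z) = dl U x u g + dl U x u h := by
  ext
  · simp; rfl
  · simp only [TrivSqZeroExt.snd_add, dl_snd]
    refine (gm_eq U).2 ?_
    filter_upwards [hx.eventually hg.eventually_analyticAt, hx.eventually hh.eventually_analyticAt]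
      with k h1 h2
    rw [fderiv_fun_add h1.differentiableAt h2.differentiableAt]; rfl

lemma dl_mul (hx : Tendsto x U (𝓝 0))
    {g h : E → ℝ} (hg : AnalyticAt ℝ g 0) (hh : AnalyticAt ℝ h 0) :
    dl U x u (fun z => g z * h z) = dl U x u g * dl U x u h := by
  ext
  · simp; rfl
  · simp only [TrivSqZeroExt.snd_mul, dl_snd, dl_fst]
    refine (gm_eq U).2 ?_
    filter_upwards [hx.eventually hg.eventually_analyticAt, hx.eventually hh.eventually_analyticAt]
      with k h1 h2
    rw [fderiv_fun_mul h1.differentiableAt h2.differentiableAt]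
    simp
    ring

lemma dl_pow (hx : Tendsto x U (𝓝 0))
    {g : E → ℝ} (hg : AnalyticAt ℝ g 0) (m : ℕ) :
    dl U x u (fun z => g z ^ m) = dl U x u g ^ m := by
  induction m with
  | zero =>
    ext
    · simp; rfl
    · simp only [pow_zero, TrivSqZeroExt.snd_one, dl_snd]
      refine (gm_eq U).2 ?_
      exact Eventually.of_forall (fun k => by simp)
  | succ m ih =>
    simp only [pow_succ]
    rw [dl_mul hx (g := fun z => g z ^ m) (hg.pow m) hg, ih]

lemma dl_neg (hx : Tendsto x U (𝓝 0))
    {g : E → ℝ} (hg : AnalyticAt ℝ g 0) : dl U x u (fun z => - g z) = - dl U x u g := by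
  ext
  · simp; rfl
  · simp only [TrivSqZeroExt.snd_neg, dl_snd]
    refine (gm_eq U).2 (Eventually.of_forall fun k => ?_)
    rw [fderiv_fun_neg]; rfl

lemma dl_sub (hx : Tendsto x U (𝓝 0))
    {g h : E → ℝ} (hg : AnalyticAt ℝ g 0) (hh : AnalyticAt ℝ h 0) :
    dl U x u (fun z => g z - h z) = dl U x u g - dl U x u h := by
  simp only [sub_eq_add_neg]
  rw [dl_add hx (h := fun z => - h z) hg hh.neg, ← dl_neg hx hh]

lemma dl_sum (hx : Tendsto x U (𝓝 0))
    {ι : Type*} (s : Finset ι) {g : ι → E → ℝ} (hg : ∀ i, AnalyticAt ℝ (g i) 0) :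
    dl U x u (fun z => ∑ i ∈ s, g i z) = ∑ i ∈ s, dl U x u (g i) := by
  classical
  induction s using Finset.induction_on with
  | empty =>
    simp only [Finset.sum_empty]
    ext
    · simp; rfl
    · simp only [TrivSqZeroExt.snd_zero, dl_snd]
      exact (gm_eq U).2 (Eventually.of_forall fun k => by simp)
  | insert i s hi ih =>
    simp only [Finset.sum_insert hi]
    rw [dl_add hx (hg i) (Finset.analyticAt_fun_sum _ (fun j _ => hg j)), ih]

lemma dl_comp (hx : Tendsto x U (𝓝 0))
    {g : E' → ℝ} (L : E →L[ℝ] E') (hg : AnalyticAt ℝ g 0) :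
    dl U x u (fun z => g (L z)) = dl U (fun k => L (x k)) (fun k => L (u k)) g := by
  ext
  · simp; rfl
  · simp only [dl_snd]
    refine (gm_eq U).2 ?_
    have hL : Tendsto (fun k => L (x k)) U (𝓝 0) := by
      have := (L.continuous.tendsto 0).comp hx
      simpa [Function.comp_def] using this
    filter_upwards [hL.eventually hg.eventually_analyticAt] with k h1
    have := fderiv_comp (x k) h1.differentiableAt L.differentiableAt
    change fderiv ℝ (g ∘ L) (x k) (u k) = _
    rw [this]; simp

lemma ev_ne_zero (hx : Tendsto x U (𝓝 0))
    {g : E → ℝ} (hg : AnalyticAt ℝ g 0) (h0 : g 0 ≠ 0) : ev U x g ≠ 0 := by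
  intro h
  have h1 := hx.eventually (hg.continuousAt.eventually_ne h0)
  obtain ⟨k, h2, h3⟩ := (h1.and ((gm_eq_zero U).1 h)).exists
  exact h2 h3

lemma isUnit_dl {g : E → ℝ} (h : ev U x g ≠ 0) : IsUnit (dl U x u g) := by
  rw [TrivSqZeroExt.isUnit_iff_isUnit_fst, dl_fst]
  exact isUnit_iff_ne_zero.2 h

/-- the ring hom to dual numbers given by a tangent sequence -/
lemma exists_hom (hx : Tendsto x U (𝓝 0))
    (hu : Tan U x u) : ∃ φ : AA U x →+* DualNumber (Ust U),
    ∀ (g : E → ℝ) (hg : AnalyticAt ℝ g 0), φ ⟨ev U x g, ev_mem U x hg⟩ = dl U x u g := by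
  classical
  choose G hG hGe using fun b : AA U x => b.2
  have key : ∀ g h : E → ℝ, AnalyticAt ℝ g 0 → AnalyticAt ℝ h 0 → ev U x g = ev U x h →
      dl U x u g = dl U x u h := by
    intro g h hg hh e
    have h1 : ev U x (fun z => g z - h z) = 0 := by
      change ev U x g - ev U x h = 0
      rw [e, sub_self]
    have h2 := hu (fun z => g z - h z) (hg.sub hh) h1
    have h3 : dl U x u (fun z => g z - h z) = 0 := by
      ext
      · simpa using h1
      · simpa using h2
    rw [dl_sub hx hg hh] at h3
    exact sub_eq_zero.1 h3
  have one : dl U x u (fun _ => 1) = 1 := by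
    have := dl_pow (u := u) hx (g := fun _ => 0) analyticAt_const 0
    simpa using this
  refine ⟨{ toFun := fun b => dl U x u (G b)
            map_one' := ?_
            map_mul' := ?_
            map_zero' := ?_
            map_add' := ?_ }, ?_⟩
  · rw [← one]
    exact key _ _ (hG _) analyticAt_const (hGe _)
  · intro a b
    rw [← dl_mul hx (hG a) (hG b)]
    refine key _ _ (hG _) ((hG a).mul (hG b)) ?_
    rw [hGe]
    change (a : Ust U) * b = ev U x (G a) * ev U x (G b)
    rw [hGe, hGe]
  · have z : dl U x u (fun _ => 0) = 0 := by
      have := dl_sum (u := u) hx (∅ : Finset ℕ) (g := fun _ _ => 0) (fun _ => analyticAt_const)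
      simpa using this
    rw [← z]
    exact key _ _ (hG _) analyticAt_const (hGe _)
  · intro a b
    rw [← dl_add hx (hG a) (hG b)]
    refine key _ _ (hG _) ((hG a).add (hG b)) ?_
    rw [hGe]
    change (a : Ust U) + b = ev U x (G a) + ev U x (G b)
    rw [hGe, hGe]
  · intro g hg
    exact key _ _ (hG _) hg (hGe _)

end Ev
end GFL

namespace GFL
open Topology Set
set_option linter.deprecated false
set_option linter.unusedSimpArgs false
set_option linter.unusedVariables false
set_option linter.unusedSectionVars false

lemma low_coeff (m : ℕ) (c : Fin m → ℝ) (s : ℝ → ℝ) (hs : ContinuousAt s 0)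
    (h : ∀ᶠ y in 𝓝[≠] (0:ℝ), ∑ i, c i * y ^ (i:ℕ) = y ^ m * s y) : s 0 = 0 := by
  induction m with
  | zero =>
    have h1 : Tendsto s (𝓝[≠] 0) (𝓝 (s 0)) := hs.tendsto.mono_left nhdsWithin_le_nhds
    have h2 : Tendsto s (𝓝[≠] 0) (𝓝 0) :=
      tendsto_const_nhds.congr' (by filter_upwards [h] with y hy; simpa using hy)
    exact tendsto_nhds_unique h1 h2
  | succ m ih =>
    have hc0 : c 0 = 0 := by
      have h1 : Tendsto (fun y : ℝ => ∑ i, c i * y ^ (i:ℕ)) (𝓝[≠] 0) (𝓝 (c 0)) := by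
        have : Continuous (fun y : ℝ => ∑ i, c i * y ^ (i:ℕ)) := by fun_prop
        refine ((this.tendsto' 0 _ ?_)).mono_left nhdsWithin_le_nhds
        rw [Fin.sum_univ_succ]; simp
      have h2 : Tendsto (fun y : ℝ => y ^ (m+1) * s y) (𝓝[≠] 0) (𝓝 0) := by
        have : ContinuousAt (fun y : ℝ => y ^ (m+1) * s y) 0 :=
          (continuous_pow (m+1)).continuousAt.mul hs
        have := this.tendsto
        simp only [ne_eq, Nat.add_eq_zero_iff, one_ne_zero, and_false, not_false_eq_true, zero_pow, zero_mul] at this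
        exact this.mono_left nhdsWithin_le_nhds
      exact tendsto_nhds_unique h1 (h2.congr' (by filter_upwards [h] with y hy; exact hy.symm))
    refine ih (fun i => c i.succ) ?_
    filter_upwards [h, self_mem_nhdsWithin] with y hy hy0
    rw [Fin.sum_univ_succ, hc0] at hy
    simp only [zero_mul, zero_add, Fin.val_succ, pow_succ] at hy
    have hy0' : y ≠ 0 := hy0
    apply mul_left_cancel₀ hy0'
    rw [Finset.mul_sum]
    calc _ = ∑ x : Fin m, c x.succ * (y ^ (x:ℕ) * y) := Finset.sum_congr rfl (fun i _ => by ring)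
      _ = _ := by rw [hy]; ring

section Step
variable {ι : Type*} [Fintype ι] {U : Ultrafilter ℕ}

theorem step (x : ℕ → (ι → ℝ) × ℝ) (hx : Tendsto x U (𝓝 0)) (g : (ι → ℝ) × ℝ → ℝ)
    (hg : AnalyticAt ℝ g 0) (m : ℕ) (k : ℝ → ℝ) (hk : AnalyticAt ℝ k 0) (hk0 : k 0 ≠ 0)
    (hgk : ∀ᶠ y in 𝓝 (0:ℝ), g (0, y) = y ^ m * k y) (hgx : ev U x g = 0) :
    (∀ h : (ι → ℝ) × ℝ → ℝ, AnalyticAt ℝ h 0 → ∃ c : Fin m → Ust U,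
      (∀ i, c i ∈ AA U (fun k => (x k).1)) ∧ ev U x h = ∑ i, c i * (ev U x (fun z => z.2)) ^ (i:ℕ)) ∧
    (∀ u' : ℕ → (ι → ℝ), Tan U (fun k => (x k).1) u' → ∃ u : ℕ → ℝ, Tan U x (fun k => (u' k, u k))) := by
  have hx1 : Tendsto (fun k => (x k).1) U (𝓝 0) :=
    (continuous_fst.tendsto (0 : (ι → ℝ) × ℝ)).comp hx
  have hsnd : AnalyticAt ℝ (fun z : (ι → ℝ) × ℝ => z.2) 0 := analyticAt_snd
  have hfst : ∀ r : (ι → ℝ) → ℝ, AnalyticAt ℝ r 0 →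
      AnalyticAt ℝ (fun z : (ι → ℝ) × ℝ => r z.1) 0 := fun r hr => hr.comp_of_eq analyticAt_fst rfl
  refine ⟨fun h hh => ?_, fun u' hu' => ?_⟩
  · obtain ⟨q, r, hq, hr, he⟩ := weierstrass g h hg hh m k hk hk0 hgk
    refine ⟨fun i => ev U (fun k => (x k).1) (r i), fun i => ev_mem U _ (hr i), ?_⟩
    rw [ev_congr hx he]
    refine (gm_eq U (t := fun j => ∑ i, r i (x j).1 * (x j).2 ^ (i:ℕ))).2 ?_ |>.trans ?_
    · filter_upwards [(gm_eq_zero U).1 hgx] with j hj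
      rw [hj]; ring
    · have : ∀ (s : Finset (Fin m)), gm U (fun j => ∑ i ∈ s, r i (x j).1 * (x j).2 ^ (i:ℕ)) =
          ∑ i ∈ s, ev U (fun k => (x k).1) (r i) * (ev U x (fun z => z.2)) ^ (i:ℕ) := by
        intro s
        classical
        induction s using Finset.induction_on with
        | empty => simp; rfl
        | insert i s hi ih =>
          simp only [Finset.sum_insert hi]
          rw [← ih]; rfl
      exact this Finset.univ
  · obtain ⟨φ, hφ⟩ := exists_hom hx1 hu'
    set a := ev U x (fun z => z.2) with ha
    -- polynomial attached to r
    have poly : ∀ r : Fin m → (ι → ℝ) → ℝ, (∀ i, AnalyticAt ℝ (r i) 0) →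
        ∃ P : Polynomial (AA U (fun k => (x k).1)), P.degree < m ∧
          (∀ u : ℕ → ℝ, P.eval₂ φ (TrivSqZeroExt.inl a + TrivSqZeroExt.inr (gm U u)) =
            dl U x (fun k => (u' k, u k)) (fun z => ∑ i, r i z.1 * z.2 ^ (i:ℕ))) ∧
          P.eval₂ (AA U (fun k => (x k).1)).subtype a = ev U x (fun z => ∑ i, r i z.1 * z.2 ^ (i:ℕ)) := by
      intro r hr
      let P : Polynomial (AA U (fun k => (x k).1)) :=
        ∑ i : Fin m, Polynomial.C ⟨ev U _ (r i), ev_mem U _ (hr i)⟩ * Polynomial.X ^ (i:ℕ)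
      have e1 : ∀ u : ℕ → ℝ, P.eval₂ φ (TrivSqZeroExt.inl a + TrivSqZeroExt.inr (gm U u)) =
            dl U x (fun k => (u' k, u k)) (fun z => ∑ i, r i z.1 * z.2 ^ (i:ℕ)) := by
        intro u
        rw [dl_sum hx Finset.univ (g := fun i z => r i z.1 * z.2 ^ (i:ℕ))
          (fun i => (hfst _ (hr i)).mul (hsnd.pow _))]
        simp only [P, Polynomial.eval₂_finset_sum, Polynomial.eval₂_mul, Polynomial.eval₂_C,
          Polynomial.eval₂_pow, Polynomial.eval₂_X]
        refine Finset.sum_congr rfl (fun i _ => ?_)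
        rw [dl_mul hx (g := fun z => r i z.1) (h := fun z => z.2 ^ (i:ℕ)) (hfst _ (hr i)) (hsnd.pow _),
          dl_pow hx hsnd, hφ _ (hr i)]
        congr 1
        · exact (dl_comp (u := fun k => (u' k, u k)) hx (ContinuousLinearMap.fst ℝ (ι → ℝ) ℝ) (hr i)).symm
        · congr 1
          rw [dl, ha]
          congr 2
          refine (gm_eq U).2 (Eventually.of_forall fun k => ?_)
          have := (ContinuousLinearMap.snd ℝ (ι → ℝ) ℝ).fderiv (x := x k)
          change u k = fderiv ℝ (ContinuousLinearMap.snd ℝ (ι → ℝ) ℝ) (x k) (u' k, u k)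
          rw [this]; rfl
      refine ⟨P, ?_, e1, ?_⟩
      · exact Polynomial.degree_sum_fin_lt _
      · have h1 := congrArg (TrivSqZeroExt.fstHom (Ust U) (Ust U) (Ust U)).toRingHom (e1 0)
        rw [Polynomial.hom_eval₂] at h1
        have h2 : (TrivSqZeroExt.fstHom (Ust U) (Ust U) (Ust U)).toRingHom.comp φ =
            (AA U (fun k => (x k).1)).subtype := by
          ext b
          obtain ⟨b, g, hg, rfl⟩ := b
          change (φ _).fst = _
          rw [hφ g hg, dl_fst]; rfl
        rw [h2] at h1
        have h3 : (TrivSqZeroExt.fstHom (Ust U) (Ust U) (Ust U)).toRingHom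
            (TrivSqZeroExt.inl a + TrivSqZeroExt.inr (gm U 0)) = a := by
          change TrivSqZeroExt.fst _ = a
          simp
        rw [h3] at h1
        rw [h1]
        exact dl_fst _ _ _ _
    -- Weierstrass polynomial
    obtain ⟨q0, r0, hq0, hr0, he0⟩ := weierstrass g (fun z => z.2 ^ m) hg (hsnd.pow m) m k hk hk0 hgk
    have hq00 : q0 0 ≠ 0 := by
      have hl := low_coeff m (fun i => r0 i 0) (fun y => 1 - q0 (0, y) * k y) (by
        have : ContinuousAt (fun y : ℝ => q0 ((0 : ι → ℝ), y)) 0 :=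
          ContinuousAt.comp_of_eq hq0.continuousAt (by fun_prop) rfl
        exact continuousAt_const.sub (this.mul hk.continuousAt)) (by
        have t : Tendsto (fun y : ℝ => ((0 : ι → ℝ), y)) (𝓝 0) (𝓝 0) :=
          Continuous.tendsto' (by fun_prop) _ _ rfl
        apply eventually_nhdsWithin_of_eventually_nhds
        filter_upwards [t.eventually he0, hgk] with y h1 h2
        rw [h2] at h1
        linear_combination -h1)
      intro h0
      have : q0 ((0 : ι → ℝ), (0:ℝ)) = 0 := h0
      rw [this] at hl
      norm_num at hl
    obtain ⟨P0, hP0d, hP0, hP0a⟩ := poly r0 hr0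
    have hr0a : AnalyticAt ℝ (fun z : (ι → ℝ) × ℝ => ∑ i, r0 i z.1 * z.2 ^ (i:ℕ)) 0 :=
      Finset.analyticAt_fun_sum _ (fun i _ => (hfst _ (hr0 i)).mul (hsnd.pow _))
    have hWa : (Polynomial.X ^ m - P0).eval₂ (AA U (fun k => (x k).1)).subtype a = 0 := by
      rw [Polynomial.eval₂_sub, Polynomial.eval₂_pow, Polynomial.eval₂_X, hP0a]
      have h1 : a ^ m = ev U x (fun z => z.2 ^ m) := rfl
      rw [h1, ev_congr hx he0]
      change gm U _ - gm U _ = 0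
      refine (gm_eq_zero U).2 ?_
      filter_upwards [(gm_eq_zero U).1 hgx] with j hj
      simp [hj]
    have hW0 : (Polynomial.X ^ m - P0) ≠ 0 := (Polynomial.monic_X_pow_sub hP0d).ne_zero
    obtain ⟨w, hw⟩ := ext_dual (AA U (fun k => (x k).1)) φ (by
      rintro ⟨b, g, hg, rfl⟩
      rw [hφ g hg, dl_fst]) a ⟨_, hW0, hWa⟩
    obtain ⟨u, rfl⟩ := gm_surj U w
    refine ⟨u, ?_⟩
    set uu : ℕ → (ι → ℝ) × ℝ := fun k => (u' k, u k) with huu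
    have hda : TrivSqZeroExt.inl a + TrivSqZeroExt.inr (gm U u) = dl U x uu (fun z => z.2) := by
      rw [dl, ha]
      congr 2
      refine (gm_eq U).2 (Eventually.of_forall fun k => ?_)
      have := (ContinuousLinearMap.snd ℝ (ι → ℝ) ℝ).fderiv (x := x k)
      change u k = fderiv ℝ (ContinuousLinearMap.snd ℝ (ι → ℝ) ℝ) (x k) (u' k, u k)
      rw [this]; rfl
    have hdg : dl U x uu g = 0 := by
      have h1 := hw _ hWa
      rw [Polynomial.eval₂_sub, Polynomial.eval₂_pow, Polynomial.eval₂_X, hP0 u, hda,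
        ← dl_pow hx hsnd, dl_congr hx he0, dl_add hx (g := fun z => q0 z * g z) (hq0.mul hg) hr0a,
        add_sub_cancel_right, dl_mul hx hq0 hg] at h1
      exact (isUnit_dl (ev_ne_zero hx hq0 hq00)).mul_right_eq_zero.1 h1
    intro h hh hhx
    obtain ⟨q, r, hq, hr, he⟩ := weierstrass g h hg hh m k hk hk0 hgk
    obtain ⟨P, hPd, hP, hPa⟩ := poly r hr
    have hra : AnalyticAt ℝ (fun z : (ι → ℝ) × ℝ => ∑ i, r i z.1 * z.2 ^ (i:ℕ)) 0 :=
      Finset.analyticAt_fun_sum _ (fun i _ => (hfst _ (hr i)).mul (hsnd.pow _))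
    have h1 : P.eval₂ (AA U (fun k => (x k).1)).subtype a = 0 := by
      rw [hPa, ← hhx, ev_congr hx he]
      refine (gm_eq U).2 ?_
      filter_upwards [(gm_eq_zero U).1 hgx] with j hj
      simp [hj]
    have h2 := hw _ h1
    rw [hP u] at h2
    have h3 : dl U x uu h = 0 := by
      rw [dl_congr hx he, dl_add hx (g := fun z => q z * g z) (hq.mul hg) hra, dl_mul hx hq hg, hdg,
        mul_zero, zero_add, h2]
    rw [← dl_snd, h3]; rfl

end Step
end GFL

namespace GFL
open Topology Set
set_option linter.deprecated false
set_option linter.unusedSimpArgs false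
set_option linter.unusedVariables false
set_option linter.unusedSectionVars false

lemma exists_direction {E : Type*} [NormedAddCommGroup E] [NormedSpace ℝ E] (g : E → ℝ)
    (hg : AnalyticAt ℝ g 0) (h0 : ¬ g =ᶠ[𝓝 0] 0) :
    ∃ v : E, ¬ ∀ᶠ s in 𝓝 (0:ℝ), g (s • v) = 0 := by
  by_contra hcon
  push Not at hcon
  apply h0
  obtain ⟨r, hr, hb⟩ := Metric.eventually_nhds_iff_ball.1 hg.eventually_analyticAt
  filter_upwards [Metric.ball_mem_nhds (0:E) hr] with v hv
  let L : ℝ →L[ℝ] E := ContinuousLinearMap.toSpanSingleton ℝ v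
  let S : Set ℝ := L ⁻¹' Metric.ball (0:E) r
  have hS : IsPreconnected S :=
    ((convex_ball (0:E) r).linear_preimage L.toLinearMap).isPreconnected
  have h1 : AnalyticOnNhd ℝ (fun s => g (L s)) S := fun s hs =>
    (hb (L s) hs).comp_of_eq (L.analyticAt s) rfl
  have := h1.eqOn_zero_of_preconnected_of_eventuallyEq_zero hS (z₀ := 0) (by simp [S, hr])
    (by filter_upwards [hcon v] with s hs; simpa [L] using hs)
  have h2 := this (x := 1) (by simpa [S, L] using hv)
  simpa [L] using h2

variable {U : Ultrafilter ℕ}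

/-- independence of a sequence -/
def Indep (U : Ultrafilter ℕ) {E : Type*} [NormedAddCommGroup E] [NormedSpace ℝ E] (x : ℕ → E) : Prop :=
  ∀ g : E → ℝ, AnalyticAt ℝ g 0 → ev U x g = 0 → g =ᶠ[𝓝 0] 0

lemma tan_transport {E E' : Type*} [NormedAddCommGroup E] [NormedSpace ℝ E]
    [NormedAddCommGroup E'] [NormedSpace ℝ E'] (Φ : E ≃L[ℝ] E') {x : ℕ → E}
    (hx : Tendsto x U (𝓝 0)) {w : ℕ → E'} (hw : Tan U (fun k => Φ (x k)) w) :
    Tan U x (fun k => Φ.symm (w k)) := by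
  intro g hg hg0
  have hg' : AnalyticAt ℝ (fun z => g (Φ.symm z)) 0 :=
    AnalyticAt.comp_of_eq (y := 0) hg ((Φ.symm : E' →L[ℝ] E).analyticAt 0) (by simp)
  have h1 := hw (fun z => g (Φ.symm z)) hg' (by simpa [ev] using hg0)
  have h2 := dl_comp (u := fun k => Φ.symm (w k)) hx (Φ : E →L[ℝ] E') hg'
  have h3 := congrArg TrivSqZeroExt.snd h2
  simp only [dl_snd] at h3
  simpa [h1] using h3

lemma AA_equiv {E E' : Type*} [NormedAddCommGroup E] [NormedSpace ℝ E]
    [NormedAddCommGroup E'] [NormedSpace ℝ E'] (Φ : E ≃L[ℝ] E') {x : ℕ → E} {b : Ust U}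
    (hb : b ∈ AA U x) : b ∈ AA U (fun k => Φ (x k)) := by
  obtain ⟨g, hg, rfl⟩ := hb
  refine ⟨fun z => g (Φ.symm z),
    AnalyticAt.comp_of_eq (y := 0) hg ((Φ.symm : E' →L[ℝ] E).analyticAt 0) (by simp), ?_⟩
  simp [ev]

lemma AA_map {E E' : Type*} [NormedAddCommGroup E] [NormedSpace ℝ E]
    [NormedAddCommGroup E'] [NormedSpace ℝ E'] (L : E →L[ℝ] E') {x : ℕ → E} {b : Ust U}
    (hb : b ∈ AA U (fun k => L (x k))) : b ∈ AA U x := by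
  obtain ⟨g, hg, rfl⟩ := hb
  exact ⟨fun z => g (L z), AnalyticAt.comp_of_eq (y := 0) hg (L.analyticAt 0) (by simp), rfl⟩

lemma exists_coord {E : Type*} [NormedAddCommGroup E] [NormedSpace ℝ E] [FiniteDimensional ℝ E]
    (v : E) (hv : v ≠ 0) : ∃ (n : ℕ) (Φ : E ≃L[ℝ] (Fin n → ℝ) × ℝ), 
      Module.finrank ℝ E = n + 1 ∧ Φ v = (0, 1) := by
  obtain ⟨l, hl⟩ := SeparatingDual.exists_eq_one (R := ℝ) hv
  let f2 : ℝ →L[ℝ] E := ContinuousLinearMap.toSpanSingleton ℝ v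
  have h12 : Function.RightInverse f2 l := fun s => by simp [f2, hl]
  let e := ContinuousLinearEquiv.equivOfRightInverse l f2 h12
  let n := Module.finrank ℝ l.ker
  let e2 : l.ker ≃L[ℝ] (Fin n → ℝ) := ContinuousLinearEquiv.ofFinrankEq (by simp [n])
  let Φ := e.trans ((ContinuousLinearEquiv.prodComm ℝ ℝ l.ker).trans (e2.prodCongr (ContinuousLinearEquiv.refl ℝ ℝ)))
  refine ⟨n, Φ, ?_, ?_⟩
  · rw [Φ.toLinearEquiv.finrank_eq]; simp
  · have : v = Φ.symm (0, 1) := by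
      simp [Φ, e, f2]
    rw [this, Φ.apply_symm_apply]

theorem thmD (N : ℕ) : ∀ (E : Type) [NormedAddCommGroup E] [NormedSpace ℝ E] [FiniteDimensional ℝ E]
    (hE : Module.finrank ℝ E = N) (x : ℕ → E) (hx : Tendsto x U (𝓝 0)),
    ∃ (d : ℕ) (π : E →L[ℝ] (Fin d → ℝ)), Indep U (fun k => π (x k)) ∧
      (∃ (J : Type) (_ : Fintype J) (e : J → Ust U), (∀ j, e j ∈ AA U x) ∧ ∀ b ∈ AA U x,
        ∃ c : J → Ust U, (∀ j, c j ∈ AA U (fun k => π (x k))) ∧ b = ∑ j, c j * e j) ∧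
      (∀ u' : ℕ → (Fin d → ℝ), ∃ u : ℕ → E, Tan U x u ∧ ∀ k, π (u k) = u' k) := by
  induction N using Nat.strong_induction_on with
  | _ N ih =>
  intro E _ _ _ hE x hx
  by_cases hind : Indep U x
  · let Φ : E ≃L[ℝ] (Fin N → ℝ) := ContinuousLinearEquiv.ofFinrankEq (by simp [hE])
    have hI : Indep U (fun k => Φ (x k)) := by
      intro g hg hg0
      have h1 := hind (fun z => g (Φ z)) (AnalyticAt.comp_of_eq (y := 0) hg ((Φ : E →L[ℝ] (Fin N → ℝ)).analyticAt 0) (by simp)) hg0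
      have ht : Tendsto (fun z => Φ.symm z) (𝓝 0) (𝓝 0) := Φ.symm.continuous.tendsto' _ _ (by simp)
      filter_upwards [ht.eventually h1] with z hz
      simpa using hz
    have hΦx : Tendsto (fun k => Φ (x k)) U (𝓝 0) :=
      (Φ.continuous.tendsto' 0 0 (by simp)).comp hx
    refine ⟨N, Φ, hI, ⟨Unit, inferInstance, fun _ => 1, fun _ => one_mem _, fun b hb =>
      ⟨fun _ => b, fun _ => AA_equiv Φ hb, by simp⟩⟩, fun u' => ⟨fun k => Φ.symm (u' k), ?_, by simp⟩⟩
    apply tan_transport Φ hx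
    intro g hg hg0
    have h1 := dl_congr (u := u') hΦx (hI g hg hg0)
    have := congrArg TrivSqZeroExt.snd h1
    simp only [dl_snd] at this
    rw [this]
    exact (gm_eq_zero U).2 (Eventually.of_forall fun k => by simp)
  · simp only [Indep] at hind
    push Not at hind
    obtain ⟨g, hg, hg0, hgn⟩ := hind
    obtain ⟨v, hv⟩ := exists_direction g hg hgn
    have hv0 : v ≠ 0 := by
      rintro rfl
      apply hgn
      exfalso
      apply hv
      have : g 0 = 0 := by
        by_contra h
        exact ev_ne_zero hx hg h hg0
      simp [this]
    obtain ⟨n, Φ, hn, hΦv⟩ := exists_coord v hv0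
    have hΦx : Tendsto (fun k => Φ (x k)) U (𝓝 0) :=
      (Φ.continuous.tendsto' 0 0 (by simp)).comp hx
    have hΦx1 : Tendsto (fun k => (Φ (x k)).1) U (𝓝 0) :=
      (continuous_fst.tendsto' (0 : (Fin n → ℝ) × ℝ) 0 rfl).comp hΦx
    have hg' : AnalyticAt ℝ (fun z => g (Φ.symm z)) 0 :=
      AnalyticAt.comp_of_eq (y := 0) hg ((Φ.symm : ((Fin n → ℝ) × ℝ) →L[ℝ] E).analyticAt 0) (by simp)
    have hline : ∀ y : ℝ, g (Φ.symm (0, y)) = g (y • v) := by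
      intro y
      congr 1
      rw [Φ.symm_apply_eq, map_smul, hΦv]; simp
    have hga : AnalyticAt ℝ (fun y : ℝ => g (y • v)) 0 := 
      AnalyticAt.comp_of_eq (y := 0) hg ((ContinuousLinearMap.toSpanSingleton ℝ v).analyticAt 0) (by simp)
    obtain ⟨m, k, hk, hk0, hmk⟩ := (hga.exists_eventuallyEq_pow_smul_nonzero_iff).2 hv
    obtain ⟨s1, s2⟩ := step (fun k => Φ (x k)) hΦx (fun z => g (Φ.symm z)) hg' m k hk hk0
      (by filter_upwards [hmk] with y hy; rw [hline, hy]; simp) (by simpa [ev] using hg0)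
    obtain ⟨d, π', hI, ⟨J, _, e, he, hJ⟩, hl⟩ := ih n (by omega) (Fin n → ℝ) (by simp)
      (fun k => (Φ (x k)).1) hΦx1
    refine ⟨d, π'.comp ((ContinuousLinearMap.fst ℝ (Fin n → ℝ) ℝ).comp (Φ : E →L[ℝ] (Fin n → ℝ) × ℝ)), hI, 
      ⟨Fin m × J, inferInstance, fun ij => e ij.2 * (ev U (fun k => Φ (x k)) (fun z => z.2)) ^ (ij.1:ℕ), ?_, ?_⟩, ?_⟩
    · intro ij
      have h1 : e ij.2 ∈ AA U x := AA_map ((ContinuousLinearMap.fst ℝ (Fin n → ℝ) ℝ).comp (Φ : E →L[ℝ] (Fin n → ℝ) × ℝ)) (he ij.2)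
      have h2 : ev U (fun k => Φ (x k)) (fun z => z.2) ∈ AA U x :=
        AA_map (Φ : E →L[ℝ] (Fin n → ℝ) × ℝ) (ev_mem U _ analyticAt_snd)
      exact mul_mem h1 (pow_mem h2 _)
    · intro b hb
      obtain ⟨h, hh, rfl⟩ := AA_equiv Φ hb
      obtain ⟨c, hc, hce⟩ := s1 h hh
      choose c' hc' hce' using fun i => hJ (c i) (hc i)
      refine ⟨fun ij => c' ij.1 ij.2, fun ij => hc' _ _, ?_⟩
      rw [hce, Fintype.sum_prod_type]
      refine Finset.sum_congr rfl fun i _ => ?_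
      rw [hce' i, Finset.sum_mul]
      exact Finset.sum_congr rfl fun j _ => by ring
    · intro u'
      obtain ⟨w, hw, hwu⟩ := hl u'
      obtain ⟨z, hz⟩ := s2 w hw
      exact ⟨_, tan_transport Φ hx hz, fun k => by simpa using hwu k⟩
end GFL

namespace GFL
open Topology Set
set_option linter.deprecated false
set_option linter.unusedSimpArgs false
set_option linter.unusedVariables false
set_option linter.unusedSectionVars false

variable {U : Ultrafilter ℕ}

section
variable {E : Type*} [NormedAddCommGroup E] [NormedSpace ℝ E]

lemma ev_sum (x : ℕ → E) {ι : Type*} (s : Finset ι) (g : ι → E → ℝ) :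
    ev U x (fun z => ∑ i ∈ s, g i z) = ∑ i ∈ s, ev U x (g i) := by
  classical
  induction s using Finset.induction_on with
  | empty => simp only [Finset.sum_empty]; rfl
  | insert i s hi ih =>
    simp only [Finset.sum_insert hi]
    rw [← ih]; rfl

/-- AA x as a subalgebra over the ring of a linear image -/
def SA (U : Ultrafilter ℕ) {d : ℕ} (π : E →L[ℝ] (Fin d → ℝ)) (x : ℕ → E) :
    Subalgebra (AA U (fun k => π (x k))) (Ust U) where
  toSubsemiring := (AA U x).toSubsemiring
  algebraMap_mem' := fun r => AA_map π r.2

lemma SA_fg {d : ℕ} (π : E →L[ℝ] (Fin d → ℝ)) (x : ℕ → E)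
    (hfin : ∃ (J : Type) (_ : Fintype J) (e : J → Ust U), (∀ j, e j ∈ AA U x) ∧ ∀ b ∈ AA U x,
        ∃ c : J → Ust U, (∀ j, c j ∈ AA U (fun k => π (x k))) ∧ b = ∑ j, c j * e j) :
    (Subalgebra.toSubmodule (SA U π x)).FG := by
  obtain ⟨J, _, e, he, hb⟩ := hfin
  have : Subalgebra.toSubmodule (SA U π x) = Submodule.span _ (Set.range e) := by
    apply le_antisymm
    · intro b hbm
      obtain ⟨c, hc, rfl⟩ := hb b hbm
      refine Submodule.sum_mem _ fun j _ => ?_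
      exact Submodule.smul_mem _ (⟨c j, hc j⟩ : AA U (fun k => π (x k))) (Submodule.subset_span ⟨j, rfl⟩)
    · rw [Submodule.span_le]
      rintro _ ⟨j, rfl⟩
      exact he j
  rw [this]
  exact Submodule.fg_span (Set.finite_range e)

lemma isIntegral_of_fin {d : ℕ} (π : E →L[ℝ] (Fin d → ℝ)) (x : ℕ → E)
    (hfin : ∃ (J : Type) (_ : Fintype J) (e : J → Ust U), (∀ j, e j ∈ AA U x) ∧ ∀ b ∈ AA U x,
        ∃ c : J → Ust U, (∀ j, c j ∈ AA U (fun k => π (x k))) ∧ b = ∑ j, c j * e j)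
    {b : Ust U} (hb : b ∈ AA U x) : IsIntegral (AA U (fun k => π (x k))) b :=
  IsIntegral.of_mem_of_fg (SA U π x) (SA_fg π x hfin) b hb

lemma analyticAt_dir {g : E → ℝ} [CompleteSpace E] (hg : AnalyticAt ℝ g 0) (v : E) :
    AnalyticAt ℝ (fun z => fderiv ℝ g z v) 0 :=
  analyticAt_clm_apply hg.fderiv analyticAt_const

/-- a function with proportional gradients is proportional -/
lemma proportional {d : ℕ} (p q : (Fin d → ℝ) → ℝ) (hp : AnalyticAt ℝ p 0) (hq : AnalyticAt ℝ q 0)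
    (hq0 : ¬ q =ᶠ[𝓝 0] 0)
    (h : ∀ j, (fun z => q z * fderiv ℝ p z (Pi.single j 1) - p z * fderiv ℝ q z (Pi.single j 1)) =ᶠ[𝓝 0] 0) :
    ∃ c : ℝ, p =ᶠ[𝓝 0] fun z => c * q z := by
  have h' : ∀ᶠ z in 𝓝 (0 : Fin d → ℝ), ∀ v, q z * fderiv ℝ p z v = p z * fderiv ℝ q z v := by
    filter_upwards [eventually_all.2 h] with z hz v
    have : v = ∑ j, v j • (Pi.single j 1 : Fin d → ℝ) := by
      ext i; simp [Finset.sum_apply, Pi.single_apply]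
    rw [this]
    simp only [map_sum, map_smul, Finset.mul_sum, smul_eq_mul]
    refine Finset.sum_congr rfl fun j _ => ?_
    have := hz j
    simp only [Pi.zero_apply] at this
    linear_combination (v j) * this
  obtain ⟨r, hr, hb⟩ := Metric.eventually_nhds_iff_ball.1
    (h'.and (hp.eventually_analyticAt.and hq.eventually_analyticAt))
  have : ∃ z ∈ Metric.ball (0 : Fin d → ℝ) r, q z ≠ 0 := by
    by_contra hcon
    push Not at hcon
    exact hq0 (by filter_upwards [Metric.ball_mem_nhds _ hr] with z hz; exact hcon z hz)
  obtain ⟨z0, hz0, hqz0⟩ := this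
  have hev : ∀ᶠ z in 𝓝 z0, q z ≠ 0 ∧ z ∈ Metric.ball (0 : Fin d → ℝ) r :=
    ((hb z0 hz0).2.2.continuousAt.eventually_ne hqz0).and (Metric.isOpen_ball.mem_nhds hz0)
  obtain ⟨ρ, hρ, hbρ⟩ := Metric.eventually_nhds_iff_ball.1 hev
  refine ⟨p z0 / q z0, ?_⟩
  have hconst : ∀ z ∈ Metric.ball z0 ρ, p z / q z = p z0 / q z0 := by
    intro z hz
    have hd : ∀ w ∈ Metric.ball z0 ρ, HasFDerivAt (fun z => p z / q z) (0 : (Fin d → ℝ) →L[ℝ] ℝ) w := by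
      intro w hw
      have h1 := hbρ w hw
      have h2 := hb w h1.2
      have h3 := h2.2.1.differentiableAt.hasFDerivAt.mul
        ((hasDerivAt_inv h1.1).comp_hasFDerivAt w h2.2.2.differentiableAt.hasFDerivAt)
      refine h3.congr_fderiv ?_
      ext v
      have := h2.1 v
      have hq1 := h1.1
      simp only [ContinuousLinearMap.add_apply, ContinuousLinearMap.smul_apply, smul_eq_mul,
        ContinuousLinearMap.zero_apply, Function.comp]
      field_simp
      linear_combination this
    refine (convex_ball z0 ρ).is_const_of_fderivWithin_eq_zero (𝕜 := ℝ) (f := fun z => p z / q z) ?_ ?_ hz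
      (Metric.mem_ball_self hρ)
    · intro w hw
      exact (hd w hw).differentiableAt.differentiableWithinAt
    · intro w hw
      rw [fderivWithin_of_isOpen Metric.isOpen_ball hw, (hd w hw).fderiv]
  have hA : AnalyticOnNhd ℝ (fun z => p z - p z0 / q z0 * q z) (Metric.ball 0 r) := fun w hw =>
    (hb w hw).2.1.sub (analyticAt_const.mul (hb w hw).2.2)
  have := hA.eqOn_zero_of_preconnected_of_eventuallyEq_zero (convex_ball _ _).isPreconnected hz0 (by
    filter_upwards [Metric.ball_mem_nhds z0 hρ] with w hw
    have h1 := hbρ w hw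
    rw [← hconst w hw]
    simp only [Pi.zero_apply]
    field_simp [h1.1]
    ring)
  filter_upwards [Metric.ball_mem_nhds _ hr] with z hz
  have := this hz
  simp only [Pi.zero_apply] at this
  linarith
end

section
variable {E : Type} [NormedAddCommGroup E] [NormedSpace ℝ E] [FiniteDimensional ℝ E]

theorem const_lemma {d : ℕ} (π : E →L[ℝ] (Fin d → ℝ)) (x : ℕ → E) (hx : Tendsto x U (𝓝 0))
    (hI : Indep U (fun k => π (x k)))
    (hfin : ∃ (J : Type) (_ : Fintype J) (e : J → Ust U), (∀ j, e j ∈ AA U x) ∧ ∀ b ∈ AA U x,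
        ∃ c : J → Ust U, (∀ j, c j ∈ AA U (fun k => π (x k))) ∧ b = ∑ j, c j * e j)
    (f : E → ℝ) (hf : AnalyticAt ℝ f 0) (hf0 : f 0 = 0)
    (hu : ∀ j : Fin d, ∃ u : ℕ → E, Tan U x u ∧ (∀ k, π (u k) = Pi.single j 1) ∧ ev1 U x u f = 0) :
    ev U x f = 0 := by
  classical
  have hπx : Tendsto (fun k => π (x k)) U (𝓝 0) :=
    (π.continuous.tendsto' 0 0 (by simp)).comp hx
  have hπ : ∀ r : (Fin d → ℝ) → ℝ, AnalyticAt ℝ r 0 → AnalyticAt ℝ (fun z => r (π z)) 0 :=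
    fun r hr => AnalyticAt.comp_of_eq (y := 0) hr (π.analyticAt 0) (by simp)
  set b := ev U x f with hb
  let Rel : ℕ → Prop := fun m => ∃ r : ℕ → (Fin d → ℝ) → ℝ, (∀ i, AnalyticAt ℝ (r i) 0) ∧
    (¬ r m =ᶠ[𝓝 0] 0) ∧ ∑ i ∈ Finset.range (m+1), ev U (fun k => π (x k)) (r i) * b ^ i = 0
  have hex : ∃ m, Rel m := by
    obtain ⟨P, hPm, hP⟩ := isIntegral_of_fin π x hfin (ev_mem U x hf)
    choose r hr hre using fun i => (P.coeff i).2
    refine ⟨P.natDegree, r, hr, ?_, ?_⟩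
    · intro h
      have h1 := hre P.natDegree
      rw [ev_congr hπx h, hPm.coeff_natDegree] at h1
      have : (0 : Ust U) = 1 := h1
      exact zero_ne_one this
    · rw [Polynomial.eval₂_eq_sum_range] at hP
      rw [← hP]
      exact Finset.sum_congr rfl fun i _ => by rw [hre]; rfl
  obtain ⟨r, hr, hrm, hrel⟩ := Nat.find_spec hex
  set m := Nat.find hex with hm
  have hmin : ∀ l ≤ m, ∀ s : ℕ → (Fin d → ℝ) → ℝ, (∀ i, AnalyticAt ℝ (s i) 0) →
      ∑ i ∈ Finset.range l, ev U (fun k => π (x k)) (s i) * b ^ i = 0 → ∀ i < l, s i =ᶠ[𝓝 0] 0 := by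
    intro l
    induction l with
    | zero => intro _ _ _ _ i hi; omega
    | succ l ih =>
      intro hl s hs hsum
      have htop : s l =ᶠ[𝓝 0] 0 := by
        by_contra h
        exact Nat.find_min hex (m := l) (by omega) ⟨s, hs, h, hsum⟩
      intro i hi
      rcases Nat.lt_succ_iff_lt_or_eq.1 hi with h | h
      · refine ih (by omega) s hs ?_ i h
        rw [Finset.sum_range_succ, ev_congr hπx htop] at hsum
        have : ev U (fun k => π (x k)) (0 : (Fin d → ℝ) → ℝ) = 0 := rfl
        rwa [this, zero_mul, add_zero] at hsum
      · rw [h]; exact htop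
  -- differentiate
  have hder : ∀ (j : Fin d), ∑ i ∈ Finset.range (m+1),
      ev U (fun k => π (x k)) (fun z => fderiv ℝ (r i) z (Pi.single j 1)) * b ^ i = 0 := by
    intro j
    obtain ⟨u, hT, hπu, hfu⟩ := hu j
    have h1 := hT (fun z => ∑ i ∈ Finset.range (m+1), r i (π z) * f z ^ i)
      (Finset.analyticAt_fun_sum _ fun i _ => (hπ _ (hr i)).mul (hf.pow i)) (by
        rw [ev_sum]; exact hrel)
    rw [← dl_snd, dl_sum hx (g := fun i z => r i (π z) * f z ^ i) _
      (fun i => (hπ _ (hr i)).mul (hf.pow i))] at h1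
    rw [← h1, TrivSqZeroExt.snd_sum]
    refine Finset.sum_congr rfl fun i _ => ?_
    rw [dl_mul hx (h := fun z => f z ^ i) (hπ _ (hr i)) (hf.pow i), dl_pow hx hf, dl_comp hx π (hr i)]
    have h2 : dl U x u f = TrivSqZeroExt.inl b := by rw [dl, hfu]; simp [hb]
    have h4 : (TrivSqZeroExt.inl b : DualNumber (Ust U)) ^ i = TrivSqZeroExt.inl (b ^ i) := TrivSqZeroExt.inl_pow ..
    rw [h2, h4, TrivSqZeroExt.snd_mul]
    simp only [TrivSqZeroExt.snd_inl, smul_zero, zero_add, TrivSqZeroExt.fst_inl, dl_snd,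
      MulOpposite.smul_eq_mul_unop, MulOpposite.unop_op, ev1, hπu]
    rfl
  have hprop : ∀ i ∈ Finset.range (m+1), ∃ c : ℝ, r i =ᶠ[𝓝 0] fun z => c * r m z := by
    intro i hi
    rw [Finset.mem_range] at hi
    rcases Nat.lt_succ_iff_lt_or_eq.1 hi with hi | hi
    · refine proportional _ _ (hr i) (hr m) hrm fun j => ?_
      refine hmin m le_rfl (fun i z => r m z * fderiv ℝ (r i) z (Pi.single j 1) -
        r i z * fderiv ℝ (r m) z (Pi.single j 1)) (fun i => ((hr m).mul (analyticAt_dir (hr i) _)).sub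
          ((hr i).mul (analyticAt_dir (hr m) _))) ?_ i hi
      have h1 := hder j
      rw [Finset.sum_range_succ] at h1 hrel
      set e := ev U (fun k => π (x k)) with he
      have : ∀ i, e (fun z => r m z * fderiv ℝ (r i) z (Pi.single j 1) -
        r i z * fderiv ℝ (r m) z (Pi.single j 1)) * b ^ i = e (r m) * (e (fun z => fderiv ℝ (r i) z (Pi.single j 1)) * b ^ i) -
          e (fun z => fderiv ℝ (r m) z (Pi.single j 1)) * (e (r i) * b ^ i) := by
        intro i
        have : e (fun z => r m z * fderiv ℝ (r i) z (Pi.single j 1) -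
          r i z * fderiv ℝ (r m) z (Pi.single j 1)) = e (r m) * e (fun z => fderiv ℝ (r i) z (Pi.single j 1)) - e (r i) * e (fun z => fderiv ℝ (r m) z (Pi.single j 1)) := rfl
        rw [this]; ring
      simp only [this]
      rw [Finset.sum_sub_distrib, ← Finset.mul_sum, ← Finset.mul_sum]
      linear_combination e (r m) * h1 - e (fun z => fderiv ℝ (r m) z (Pi.single j 1)) * hrel
    · subst hi
      exact ⟨1, by simp⟩
  choose! c hc using hprop
  -- real polynomial
  have hermne : ev U (fun k => π (x k)) (r m) ≠ 0 := fun h => hrm (hI _ (hr m) h)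
  let P : Polynomial ℝ := Polynomial.X ^ m + ∑ i : Fin m, Polynomial.C (c i) * Polynomial.X ^ (i:ℕ)
  have hPm : P.Monic := Polynomial.monic_X_pow_add (Polynomial.degree_sum_fin_lt _)
  have hP0 : ev U x (fun z => P.eval (f z)) = 0 := by
    have h1 : ev U x (fun z => P.eval (f z)) * ev U (fun k => π (x k)) (r m) =
        ∑ i ∈ Finset.range (m+1), ev U (fun k => π (x k)) (r i) * b ^ i := by
      rw [Finset.sum_range_succ, Finset.sum_congr rfl (g := fun i => ev U (fun k => π (x k)) (fun z => c i * r m z) * b ^ i)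
        (fun i hi => by rw [ev_congr hπx (hc i (Finset.mem_range.2 (by have := Finset.mem_range.1 hi; omega)))])]
      have h2 : ∑ i ∈ Finset.range m, ev U (fun k => π (x k)) (fun z => c i * r m z) * b ^ i =
        ev U x (fun z => ∑ i ∈ Finset.range m, (c i * r m (π z)) * f z ^ i) := by
        rw [ev_sum]; rfl
      rw [h2]
      refine (gm_eq U).2 (Eventually.of_forall fun k => ?_)
      simp only [P, Polynomial.eval_add, Polynomial.eval_pow, Polynomial.eval_X,
        Polynomial.eval_finset_sum, Polynomial.eval_mul, Polynomial.eval_C]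
      rw [Finset.sum_range fun i => c i * r m (π (x k)) * f (x k) ^ i, add_mul, Finset.sum_mul, add_comm]
      congr 1
      · exact Finset.sum_congr rfl fun i _ => by ring
      · exact mul_comm _ _
    rw [hrel] at h1
    exact (mul_eq_zero.1 h1).resolve_right hermne
  obtain ⟨Q, hQ, hnd⟩ := Polynomial.exists_eq_pow_rootMultiplicity_mul_and_not_dvd P hPm.ne_zero 0
  have hQ0 : Q.eval 0 ≠ 0 := fun h => hnd (Polynomial.dvd_iff_isRoot.2 h)
  have hQa : AnalyticAt ℝ (fun z => Q.eval (f z)) 0 := by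
    have : AnalyticAt ℝ (fun y : ℝ => Q.eval y) (f 0) := by
      exact AnalyticOnNhd.eval_polynomial (𝕜 := ℝ) Q _ trivial
    exact this.comp_of_eq hf rfl
  have hne := ev_ne_zero hx hQa (by rw [hf0]; exact hQ0)
  have h3 : ev U x (fun z => P.eval (f z)) = b ^ (Polynomial.rootMultiplicity 0 P) * ev U x (fun z => Q.eval (f z)) := by
    refine (gm_eq U).2 (Eventually.of_forall fun k => ?_)
    simp only
    conv_lhs => rw [hQ]
    simp
  rw [h3] at hP0
  exact eq_zero_of_pow_eq_zero (n := Polynomial.rootMultiplicity 0 P) ((mul_eq_zero.1 hP0).resolve_right hne) 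
end
end GFL

namespace GFL
open Topology Set
set_option linter.deprecated false
set_option linter.unusedSimpArgs false
set_option linter.unusedVariables false
set_option linter.unusedSectionVars false

variable {U : Ultrafilter ℕ}

/-- roots of the parameter -/
noncomputable def tau (s : ℕ → ℝ) (e : ℕ) : ℕ → ℝ := fun k => (s k) ^ ((1:ℝ) / e)

section
variable {s : ℕ → ℝ}

lemma tau_tendsto (hs : Tendsto s U (𝓝 0)) (hpos : ∀ᶠ k in (U : Filter ℕ), 0 < s k)
    {e : ℕ} (he : 0 < e) : Tendsto (tau s e) U (𝓝 0) := by
  have : (0:ℝ) < 1 / e := by positivity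
  have h := (Real.continuousAt_rpow_const 0 ((1:ℝ)/e) (Or.inr this.le)).tendsto.comp hs
  rw [Real.zero_rpow this.ne'] at h
  exact h

lemma tau_pos (hs : Tendsto s U (𝓝 0)) (hpos : ∀ᶠ k in (U : Filter ℕ), 0 < s k)
    {e : ℕ} (he : 0 < e) : ∀ᶠ k in (U : Filter ℕ), 0 < tau s e k := by
  filter_upwards [hpos] with k hk
  exact Real.rpow_pos_of_pos hk _

lemma tau_pow (hs : Tendsto s U (𝓝 0)) (hpos : ∀ᶠ k in (U : Filter ℕ), 0 < s k)
    {e e' : ℕ} (he : 0 < e) (he' : 0 < e') :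
    ∀ᶠ k in (U : Filter ℕ), tau s (e * e') k ^ e' = tau s e k := by
  filter_upwards [hpos] with k hk
  rw [tau, tau, ← Real.rpow_natCast, ← Real.rpow_mul hk.le]
  congr 1
  push_cast
  field_simp

lemma ev_tau (hs : Tendsto s U (𝓝 0)) (hpos : ∀ᶠ k in (U : Filter ℕ), 0 < s k)
    {e e' : ℕ} (he : 0 < e) (he' : 0 < e') (g : ℝ → ℝ) :
    ev U (tau s e) g = ev U (tau s (e * e')) (fun z => g (z ^ e')) := by
  refine (gm_eq U).2 ?_
  filter_upwards [tau_pow hs hpos he he'] with k hk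
  rw [hk]

lemma analyticAt_comp_pow {g : ℝ → ℝ} (hg : AnalyticAt ℝ g 0) {e' : ℕ} (he' : 0 < e') :
    AnalyticAt ℝ (fun z => g (z ^ e')) 0 :=
  AnalyticAt.comp_of_eq (y := 0) hg (analyticAt_id.pow e') (by simp [he'.ne'])

lemma AA_tau (hs : Tendsto s U (𝓝 0)) (hpos : ∀ᶠ k in (U : Filter ℕ), 0 < s k)
    {e e' : ℕ} (he : 0 < e) (he' : 0 < e') {b : Ust U} (hb : b ∈ AA U (tau s e)) :
    b ∈ AA U (tau s (e * e')) := by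
  obtain ⟨g, hg, rfl⟩ := hb
  rw [ev_tau hs hpos he he']
  exact ev_mem U _ (analyticAt_comp_pow hg he')

end

/-- real polynomial with vanishing next coefficient is not a pure power -/
lemma mult_lt (p : Polynomial ℝ) (m : ℕ) (hp : p.Monic) (hm : p.natDegree = m) (hm0 : 0 < m)
    (hc : p.coeff (m-1) = 0) (i : ℕ) (hi : i < m) (hci : p.coeff i ≠ 0) (z0 : ℝ) :
    p.rootMultiplicity z0 < m := by
  by_contra h
  push Not at h
  have hdvd : (Polynomial.X - Polynomial.C z0) ^ m ∣ p :=
    (pow_dvd_pow _ h).trans (Polynomial.pow_rootMultiplicity_dvd p z0)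
  have heq : p = (Polynomial.X - Polynomial.C z0) ^ m := by
    refine (Polynomial.eq_of_monic_of_dvd_of_natDegree_le ((Polynomial.monic_X_sub_C z0).pow m) hp hdvd ?_)
    rw [(Polynomial.monic_X_sub_C z0).natDegree_pow, hm]; simp
  rw [heq, sub_eq_add_neg, ← Polynomial.C_neg, Polynomial.coeff_X_add_C_pow] at hc hci
  obtain ⟨n, rfl⟩ : ∃ n, m = n + 1 := ⟨m - 1, by omega⟩
  have hz : z0 = 0 := by
    simp at hc
    rcases hc with h | h
    · exact h
    · exfalso
      have : (0:ℝ) ≤ n := Nat.cast_nonneg n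
      linarith
  apply hci
  rw [hz]
  simp
  left
  omega

/-- bounded ultralimit of roots of monic polynomials with bounded coefficients -/
lemma root_lim (m : ℕ) (z : ℕ → ℝ) (a : ℕ → ℕ → ℝ) (a0 : ℕ → ℝ)
    (ha : ∀ i, Tendsto (a i) U (𝓝 (a0 i)))
    (hz : ∀ᶠ k in (U : Filter ℕ), z k ^ m + ∑ i ∈ Finset.range m, a i k * z k ^ i = 0) :
    ∃ z0, Tendsto z U (𝓝 z0) := by
  let M : ℝ := ∑ i ∈ Finset.range m, (|a0 i| + 1)
  have hM : 0 ≤ M := Finset.sum_nonneg fun i _ => by positivity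
  have hb : ∀ᶠ k in (U : Filter ℕ), ∀ i ∈ Finset.range m, |a i k| ≤ |a0 i| + 1 := by
    rw [Filter.eventually_all_finset]
    intro i _
    exact ((ha i).abs.eventually (gt_mem_nhds (lt_add_one _))).mono fun k hk => hk.le
  have hbd : ∀ᶠ k in (U : Filter ℕ), z k ∈ Set.Icc (-(M+1)) (M+1) := by
    filter_upwards [hz, hb] with k h1 h2
    rw [Set.mem_Icc, ← abs_le]
    by_contra hcon
    push Not at hcon
    have hz1 : 1 < |z k| := by linarith
    rcases Nat.eq_zero_or_pos m with h0 | h0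
    · subst h0; simp at h1
    obtain ⟨n, rfl⟩ : ∃ n, m = n + 1 := ⟨m - 1, by omega⟩
    have h3 : |z k| ^ (n+1) ≤ M * |z k| ^ n := by
      rw [← abs_pow, eq_neg_of_add_eq_zero_left h1, abs_neg]
      refine (Finset.abs_sum_le_sum_abs _ _).trans ?_
      rw [Finset.sum_mul]
      refine Finset.sum_le_sum fun i hi => ?_
      rw [abs_mul, abs_pow]
      have hi' := Finset.mem_range.1 hi
      exact mul_le_mul (h2 i hi) (pow_le_pow_right₀ hz1.le (by omega)) (by positivity) (by positivity)
    rw [pow_succ'] at h3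
    have := le_of_mul_le_mul_right h3 (by positivity)
    linarith
  obtain ⟨z0, _, hz0⟩ := (isCompact_Icc (a := -(M+1)) (b := M+1)).ultrafilter_le_nhds (U.map z)
    (le_principal_iff.2 hbd)
  exact ⟨z0, hz0⟩
end GFL

namespace GFL
open Topology Set
set_option linter.deprecated false
set_option linter.unusedSimpArgs false
set_option linter.unusedVariables false
set_option linter.unusedSectionVars false

variable {U : Ultrafilter ℕ}

lemma scaling (m : ℕ) (r : ℕ → ℝ → ℝ) (hr : ∀ i, AnalyticAt ℝ (r i) 0)
    (hne : ∃ i < m, ¬ r i =ᶠ[𝓝 0] 0) :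
    ∃ (E : ℕ) (ν : ℕ) (s : ℕ → ℝ → ℝ), 0 < E ∧ (∀ i, AnalyticAt ℝ (s i) 0) ∧
      (∀ i < m, ∀ᶠ z in 𝓝 (0:ℝ), r i (z ^ E) = z ^ (ν * (m - i)) * s i z) ∧
      (∀ i, r i =ᶠ[𝓝 0] 0 → s i 0 = 0) ∧ ∃ i < m, s i 0 ≠ 0 := by
  classical
  have h1 : ∀ i, ∃ (n : ℕ) (u : ℝ → ℝ), ¬ r i =ᶠ[𝓝 0] 0 → (AnalyticAt ℝ u 0 ∧ u 0 ≠ 0 ∧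
      ∀ᶠ z in 𝓝 (0:ℝ), r i z = z ^ n * u z) := by
    intro i
    by_cases h : r i =ᶠ[𝓝 0] 0
    · exact ⟨0, 0, fun h' => absurd h h'⟩
    · obtain ⟨n, u, hu, hu0, he⟩ := (hr i).exists_eventuallyEq_pow_smul_nonzero_iff.2 h
      exact ⟨n, u, fun _ => ⟨hu, hu0, by simpa using he⟩⟩
  choose n u hu using h1
  let S := (Finset.range m).filter (fun i => ¬ r i =ᶠ[𝓝 0] 0)
  have hS : S.Nonempty := by
    obtain ⟨i, hi, h⟩ := hne
    exact ⟨i, by simp only [S, Finset.mem_filter, Finset.mem_range]; exact ⟨hi, h⟩⟩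
  obtain ⟨i0, hi0, hmin⟩ := S.exists_min_image (fun i => (n i : ℚ) / (m - i : ℕ)) hS
  simp only [S, Finset.mem_filter, Finset.mem_range] at hi0 hmin
  have hcross : ∀ i < m, ¬ r i =ᶠ[𝓝 0] 0 → n i0 * (m - i) ≤ n i * (m - i0) := by
    intro i hi h
    have := hmin i ⟨hi, h⟩
    rw [div_le_div_iff₀ (by exact_mod_cast (by omega)) (by exact_mod_cast (by omega))] at this
    exact_mod_cast this
  have hE : 0 < m - i0 := by omega
  refine ⟨m - i0, n i0, fun i => if r i =ᶠ[𝓝 0] 0 then 0 else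
    fun z => z ^ (n i * (m - i0) - n i0 * (m - i)) * u i (z ^ (m - i0)), hE, ?_, ?_, ?_, i0, hi0.1, ?_⟩
  · intro i
    by_cases h : r i =ᶠ[𝓝 0] 0
    · simp only [h, if_true]; exact analyticAt_const
    · simp only [h, if_false]
      exact (analyticAt_id.pow _).mul (analyticAt_comp_pow (hu i h).1 hE)
  · intro i hi
    have ht : Tendsto (fun z : ℝ => z ^ (m - i0)) (𝓝 0) (𝓝 0) :=
      Continuous.tendsto' (by fun_prop) _ _ (by simp [hE.ne'])
    by_cases h : r i =ᶠ[𝓝 0] 0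
    · filter_upwards [ht.eventually h] with z hz
      simpa [h] using hz
    · filter_upwards [ht.eventually (hu i h).2.2] with z hz
      simp only [h, if_false]
      rw [hz, ← mul_assoc, ← pow_add, ← pow_mul]
      congr 2
      have := hcross i hi h
      rw [mul_comm (m - i0) (n i)]
      omega
  · intro i h
    simp [h]
  · simp only [hi0.2, if_false]
    simpa [hE.ne'] using (hu i0 hi0.2).2.1

section
variable {s : ℕ → ℝ}

/-- the core reduction step, function level -/
lemma puiseux_core (hs : Tendsto s U (𝓝 0)) (hpos : ∀ᶠ k in (U : Filter ℕ), 0 < s k)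
    (m : ℕ) (hm0 : 0 < m) (e : ℕ) (he : 0 < e) (y : Ust U) (r : ℕ → ℝ → ℝ)
    (hr : ∀ i, AnalyticAt ℝ (r i) 0) (hrm : r (m-1) =ᶠ[𝓝 0] 0)
    (hy : y ^ m + ∑ i ∈ Finset.range m, ev U (tau s e) (r i) * y ^ i = 0)
    (ih : ∀ m' < m, ∀ (y : Ust U) (e : ℕ), 0 < e → ∀ (P : Polynomial (AA U (tau s e))),
      P.Monic → P.natDegree = m' → P.eval₂ (AA U (tau s e)).subtype y = 0 →
        ∃ e', 0 < e' ∧ y ∈ AA U (tau s e')) :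
    ∃ e', 0 < e' ∧ y ∈ AA U (tau s e') := by
  by_cases hne : ∃ i < m, ¬ r i =ᶠ[𝓝 0] 0
  swap
  · push Not at hne
    have : y ^ m = 0 := by
      rw [← hy, Finset.sum_eq_zero, add_zero]
      intro i hi
      rw [ev_congr (tau_tendsto hs hpos he) (hne i (Finset.mem_range.1 hi))]
      change (0 : Ust U) * _ = 0
      rw [zero_mul]
    exact ⟨e, he, by rw [eq_zero_of_pow_eq_zero this]; exact zero_mem _⟩
  obtain ⟨E, ν, S, hE, hS, hSr, hSz, i1, hi1, hSi1⟩ := scaling m r hr hne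
  have heE : 0 < e * E := Nat.mul_pos he hE
  set σ := tau s (e * E) with hσ
  have hσt : Tendsto σ U (𝓝 0) := tau_tendsto hs hpos heE
  have hσp : ∀ᶠ k in (U : Filter ℕ), 0 < σ k := tau_pos hs hpos heE
  set σg := ev U σ (fun z => z) with hσg
  have hσ0 : σg ≠ 0 := by
    intro h
    obtain ⟨k, h1, h2⟩ := (((gm_eq_zero U).1 h).and hσp).exists
    simp only at h1
    linarith
  set z : Ust U := y / σg ^ ν with hz
  have hyz : y = σg ^ ν * z := by rw [hz]; field_simp
  have hrz : z ^ m + ∑ i ∈ Finset.range m, ev U σ (S i) * z ^ i = 0 := by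
    have h1 : ∀ i ∈ Finset.range m, ev U (tau s e) (r i) * y ^ i = (σg ^ ν) ^ m * (ev U σ (S i) * z ^ i) := by
      intro i hi
      have hi' := Finset.mem_range.1 hi
      have h2 : ev U σ (fun z => z ^ (ν * (m - i)) * S i z) = σg ^ (ν * (m - i)) * ev U σ (S i) := rfl
      rw [ev_tau hs hpos he hE, ← hσ, ev_congr hσt (hSr i hi'), h2, hyz, mul_pow, ← pow_mul, ← pow_mul]
      have : ν * m = ν * (m - i) + ν * i := by rw [← mul_add]; congr 1; omega
      rw [this, pow_add]; ring
    rw [Finset.sum_congr rfl h1, ← Finset.mul_sum] at hy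
    have h3 : (σg ^ ν) ^ m * (z ^ m + ∑ i ∈ Finset.range m, ev U σ (S i) * z ^ i) = 0 := by
      rw [mul_add, ← mul_pow, ← hyz]; exact hy
    exact (mul_eq_zero.1 h3).resolve_left (pow_ne_zero _ (pow_ne_zero _ hσ0))
  obtain ⟨zs, hzs⟩ := gm_surj U z
  have hrzs : ∀ᶠ k in (U : Filter ℕ), zs k ^ m + ∑ i ∈ Finset.range m, S i (σ k) * zs k ^ i = 0 := by
    have h1 : gm U (fun k => zs k ^ m + ∑ i ∈ Finset.range m, S i (σ k) * zs k ^ i) = 0 := by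
      rw [← hrz, ← hzs]
      have h2 : ∀ t : Finset ℕ, gm U (fun k => ∑ i ∈ t, S i (σ k) * zs k ^ i) = 
          ∑ i ∈ t, ev U σ (S i) * gm U zs ^ i := by
        intro t
        classical
        induction t using Finset.induction_on with
        | empty => simp; rfl
        | insert i t hi ih =>
          simp only [Finset.sum_insert hi]
          rw [← ih]; rfl
      rw [← h2]; rfl
    exact (gm_eq_zero U).1 h1
  obtain ⟨z0, hz0⟩ := root_lim m zs (fun i k => S i (σ k)) (fun i => S i 0)
    (fun i => (hS i).continuousAt.tendsto.comp hσt) hrzs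
  -- the real polynomial
  let p : Polynomial ℝ := Polynomial.X ^ m + ∑ i : Fin m, Polynomial.C (S i 0) * Polynomial.X ^ (i:ℕ)
  have hdeg : (∑ i : Fin m, Polynomial.C (S i 0) * Polynomial.X ^ (i:ℕ)).degree < (m : WithBot ℕ) :=
    Polynomial.degree_sum_fin_lt _
  have hpm : p.Monic := Polynomial.monic_X_pow_add hdeg
  have hpd : p.natDegree = m := by
    have h1 : p.degree = m := by
      rw [Polynomial.degree_add_eq_left_of_degree_lt] <;> simp only [Polynomial.degree_X_pow]
      exact hdeg
    exact Polynomial.natDegree_eq_of_degree_eq_some h1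
  have hpc : ∀ i < m, p.coeff i = S i 0 := by
    intro i hi
    simp only [p, Polynomial.coeff_add, Polynomial.coeff_X_pow, Polynomial.finset_sum_coeff,
      Polynomial.coeff_C_mul]
    rw [if_neg (by omega), zero_add, Finset.sum_eq_single ⟨i, hi⟩]
    · simp
    · intro j _ hj
      rw [if_neg, mul_zero]
      intro h
      apply hj
      ext; exact h.symm
    · simp
  have hpe : ∀ w, p.eval w = w ^ m + ∑ i ∈ Finset.range m, S i 0 * w ^ i := by
    intro w
    rw [Finset.sum_range]
    simp [p, Polynomial.eval_finset_sum]
  have hmult := mult_lt p m hpm hpd hm0 (by rw [hpc _ (by omega)]; exact hSz _ hrm) i1 hi1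
    (by rw [hpc _ hi1]; exact hSi1) z0
  set m' := p.rootMultiplicity z0 with hm'
  obtain ⟨Q, hQ, hnd⟩ := Polynomial.exists_eq_pow_rootMultiplicity_mul_and_not_dvd p hpm.ne_zero z0
  rw [← hm'] at hQ
  have hQ0 : Q.eval z0 ≠ 0 := fun h => hnd (Polynomial.dvd_iff_isRoot.2 h)
  -- the two variable function
  let G : (Fin 1 → ℝ) × ℝ → ℝ := fun w => (w.2 + z0) ^ m + ∑ i ∈ Finset.range m, S i (w.1 0) * (w.2 + z0) ^ i
  have hw2 : AnalyticAt ℝ (fun w : (Fin 1 → ℝ) × ℝ => w.2 + z0) 0 := analyticAt_snd.add analyticAt_const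
  have hw1 : AnalyticAt ℝ (fun w : (Fin 1 → ℝ) × ℝ => w.1 0) 0 :=
    ((ContinuousLinearMap.proj (R := ℝ) (φ := fun _ : Fin 1 => ℝ) 0).comp
      (ContinuousLinearMap.fst ℝ (Fin 1 → ℝ) ℝ)).analyticAt 0
  have hG : AnalyticAt ℝ G 0 := by
    refine (hw2.pow m).add (Finset.analyticAt_fun_sum _ fun i _ => ?_)
    exact (AnalyticAt.comp_of_eq (y := 0) (hS i) hw1 (by simp)).mul (hw2.pow i)
  let k : ℝ → ℝ := fun w => Q.eval (w + z0)
  have hk : AnalyticAt ℝ k 0 := by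
    have h1 : AnalyticAt ℝ (fun y : ℝ => Q.eval y) (0 + z0) := AnalyticOnNhd.eval_polynomial (𝕜 := ℝ) Q _ trivial
    exact AnalyticAt.comp_of_eq (f := fun w : ℝ => w + z0) h1 (analyticAt_id.add analyticAt_const) rfl
  obtain ⟨q, R, hq, hR, hw⟩ := weierstrass G (fun w => w.2 ^ m') hG (analyticAt_snd.pow m') m' k hk
    (by simpa [k] using hQ0) (Eventually.of_forall fun w => by
      have := hpe (w + z0)
      rw [hQ] at this
      simp only [Polynomial.eval_mul, Polynomial.eval_pow, Polynomial.eval_sub, Polynomial.eval_X,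
        Polynomial.eval_C, add_sub_cancel_right] at this
      simp only [G, k, Pi.zero_apply]
      exact this.symm)
  have hX : Tendsto (fun j => ((fun _ => σ j : Fin 1 → ℝ), zs j - z0)) U (𝓝 0) := by
    have h1 : Tendsto (fun j => (fun _ => σ j : Fin 1 → ℝ)) U (𝓝 0) := tendsto_pi_nhds.2 fun _ => hσt
    have h2 : Tendsto (fun j => zs j - z0) U (𝓝 0) := by simpa using hz0.sub_const z0
    exact h1.prodMk_nhds h2
  have hRA : ∀ i : Fin m', AnalyticAt ℝ (fun t : ℝ => R i (fun _ => t)) 0 := by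
    intro i
    have h1 : AnalyticAt ℝ (fun t : ℝ => (fun _ => t : Fin 1 → ℝ)) 0 :=
      (ContinuousLinearMap.pi (fun _ : Fin 1 => ContinuousLinearMap.id ℝ ℝ)).analyticAt 0
    exact AnalyticAt.comp_of_eq (y := 0) (hR i) h1 rfl
  let P' : Polynomial (AA U σ) :=
    ∑ i : Fin m', Polynomial.C ⟨ev U σ (fun t : ℝ => R i (fun _ => t)), ev_mem U _ (hRA i)⟩ * Polynomial.X ^ (i:ℕ)
  have hP'd : P'.degree < m' := Polynomial.degree_sum_fin_lt _
  have hnt : Nontrivial (AA U σ) := inferInstance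
  have hPd : (Polynomial.X ^ m' - P').natDegree = m' := by
    have h1 : (Polynomial.X ^ m' - P').degree = (m' : WithBot ℕ) := by
      rw [Polynomial.degree_sub_eq_left_of_degree_lt] <;> simp only [Polynomial.degree_X_pow]
      exact hP'd
    exact Polynomial.natDegree_eq_of_degree_eq_some h1
  obtain ⟨e', he', hmem⟩ := ih m' hmult (z - gm U (fun _ => z0)) (e * E) heE (Polynomial.X ^ m' - P')
    (Polynomial.monic_X_pow_sub hP'd) hPd (by
      rw [← hzs]
      have h1 : (P'.eval₂ (AA U σ).subtype (gm U zs - gm U fun _ => z0)) =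
          gm U (fun j => ∑ i : Fin m', R i (fun _ => σ j) * (zs j - z0) ^ (i:ℕ)) := by
        simp only [P', Polynomial.eval₂_finset_sum, Polynomial.eval₂_mul, Polynomial.eval₂_C,
          Polynomial.eval₂_pow, Polynomial.eval₂_X]
        have h2 : ∀ t : Finset (Fin m'), gm U (fun k => ∑ i ∈ t, R i (fun _ => σ k) * (zs k - z0) ^ (i:ℕ)) = 
            ∑ i ∈ t, ev U σ (fun t : ℝ => R i (fun _ => t)) * (gm U zs - gm U fun _ => z0) ^ (i:ℕ) := by
          intro t
          classical
          induction t using Finset.induction_on with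
          | empty => simp; rfl
          | insert i t hi ih =>
            simp only [Finset.sum_insert hi]
            rw [← ih]; rfl
        rw [h2]; rfl
      rw [Polynomial.eval₂_sub, Polynomial.eval₂_pow, Polynomial.eval₂_X, h1]
      change gm U _ - gm U _ = 0
      refine (gm_eq_zero U).2 ?_
      filter_upwards [hX.eventually hw, hrzs] with j h2 h3
      have h4 : G ((fun _ => σ j), zs j - z0) = 0 := by simpa [G] using h3
      rw [h4, mul_zero, zero_add] at h2
      exact sub_eq_zero.2 h2)
  refine ⟨e * E * e', Nat.mul_pos heE he', ?_⟩
  have hz0m : gm U (fun _ => z0) ∈ AA U (tau s (e * E * e')) := ⟨fun _ => z0, analyticAt_const, rfl⟩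
  have hzm : z ∈ AA U (tau s (e * E * e')) := by
    have h1 : z - gm U (fun _ => z0) ∈ AA U (tau s (e * E * e')) := by
      rw [mul_comm]; exact AA_tau hs hpos he' heE hmem
    have := add_mem h1 hz0m
    simpa using this
  have hσm : σg ∈ AA U (tau s (e * E * e')) := AA_tau hs hpos heE he' (ev_mem U _ analyticAt_id)
  rw [hyz]
  exact mul_mem (pow_mem hσm _) hzm

theorem puiseux (hs : Tendsto s U (𝓝 0)) (hpos : ∀ᶠ k in (U : Filter ℕ), 0 < s k)
    (m : ℕ) : ∀ (y : Ust U) (e : ℕ), 0 < e → ∀ (P : Polynomial (AA U (tau s e))),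
      P.Monic → P.natDegree = m → P.eval₂ (AA U (tau s e)).subtype y = 0 →
        ∃ e', 0 < e' ∧ y ∈ AA U (tau s e') := by
  induction m using Nat.strong_induction_on with
  | _ m ih =>
  intro y e he P hP hPm hPy
  rcases Nat.eq_zero_or_pos m with h0 | h0
  · rw [hP.natDegree_eq_zero.1 (hPm.trans h0)] at hPy
    simp at hPy
  -- Tschirnhaus
  obtain ⟨g, hg, hge⟩ := (P.coeff (m-1)).2
  let a : AA U (tau s e) := ⟨ev U (tau s e) (fun z => - g z / m), ev_mem U _ (by
    exact hg.neg.div_const)⟩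
  have hma : P.coeff (m-1) + (m : AA U (tau s e)) * a = 0 := by
    apply Subtype.ext
    push_cast
    rw [← hge]
    change gm U _ + gm U (fun _ => (m:ℝ)) * gm U _ = 0
    rw [← gm_mul, ← gm_add]
    refine (gm_eq_zero U).2 (Eventually.of_forall fun k => ?_)
    field_simp
    ring
  set T := Polynomial.taylor a P with hT
  have hTm : T.Monic := by
    rw [Polynomial.Monic, hT, Polynomial.leadingCoeff_taylor]; exact hP
  have hTd : T.natDegree = m := by rw [hT, Polynomial.natDegree_taylor, hPm]
  have hTc : T.coeff (m-1) = 0 := by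
    rw [hT, Polynomial.taylor_coeff, Polynomial.eval_eq_sum_range' (n := 2)
      (lt_of_le_of_lt (Polynomial.natDegree_hasseDeriv_le P (m-1)) (by omega))]
    have hlead : P.coeff m = 1 := by rw [← hPm]; exact hP
    have h1 : 1 + (m - 1) = m := by omega
    have h2 : m.choose (m - 1) = m := by
      rw [Nat.choose_symm (by omega : 1 ≤ m), Nat.choose_one_right]
    simp only [Finset.sum_range_succ, Finset.sum_range_zero, Polynomial.hasseDeriv_coeff, zero_add,
      h1, h2, hlead, pow_zero, pow_one, mul_one, Nat.choose_self, Nat.cast_one, one_mul]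
    exact hma
  have hTy : T.eval₂ (AA U (tau s e)).subtype (y - a) = 0 := by
    rw [hT, Polynomial.taylor_apply, Polynomial.eval₂_comp, Polynomial.eval₂_add, Polynomial.eval₂_X,
      Polynomial.eval₂_C]
    simpa using hPy
  choose r hr hre using fun i => (T.coeff i).2
  let r' : ℕ → ℝ → ℝ := fun i => if i = m - 1 then 0 else r i
  have hr' : ∀ i, AnalyticAt ℝ (r' i) 0 := by
    intro i
    by_cases h : i = m - 1
    · simp only [r', h, if_true]; exact analyticAt_const
    · simp only [r', h, if_false]; exact hr i
  have hcore : ∃ e', 0 < e' ∧ y - a ∈ AA U (tau s e') := by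
    refine puiseux_core hs hpos m h0 e he (y - a) r' hr' ?_ ?_ ih
    · simp only [r', if_true]; rfl
    · rw [Polynomial.eval₂_eq_sum_range, hTd, Finset.sum_range_succ] at hTy
      have hlead : T.coeff m = 1 := by rw [← hTd]; exact hTm
      rw [hlead, map_one, one_mul, add_comm] at hTy
      rw [← hTy]
      congr 1
      refine Finset.sum_congr rfl fun i _ => ?_
      congr 1
      by_cases h : i = m - 1
      · simp only [r', h, if_true]
        rw [hTc]; rfl
      · simp only [r', h, if_false]
        exact hre i
  obtain ⟨e', he', hmem⟩ := hcore
  refine ⟨e * e', Nat.mul_pos he he', ?_⟩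
  have h1 : y - a ∈ AA U (tau s (e * e')) := by
    rw [mul_comm]; exact AA_tau hs hpos he' he hmem
  have := add_mem h1 (AA_tau hs hpos he he' a.2)
  simpa using this
end
end GFL

namespace GFL
open Topology Set
set_option linter.deprecated false
set_option linter.unusedSimpArgs false
set_option linter.unusedVariables false
set_option linter.unusedSectionVars false

variable {U : Ultrafilter ℕ}
section
variable {E : Type} [NormedAddCommGroup E] [NormedSpace ℝ E] [FiniteDimensional ℝ E]

lemma AA_tau_of_one {y : ℕ → (Fin 1 → ℝ)} (hy : Tendsto y U (𝓝 0)) (hI : Indep U y) :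
    ∃ s : ℕ → ℝ, Tendsto s U (𝓝 0) ∧ (∀ᶠ k in (U : Filter ℕ), 0 < s k) ∧ AA U y ≤ AA U (tau s 1) := by
  refine ⟨fun k => |y k 0|, ?_, ?_, ?_⟩
  · have h1 : Tendsto (fun k => y k 0) U (𝓝 0) := (tendsto_pi_nhds.1 hy) 0
    simpa using h1.abs
  · have : ∀ᶠ k in (U : Filter ℕ), ¬ y k 0 = 0 := by
      rw [Ultrafilter.eventually_not]
      intro h
      have h1 := hI (fun z => z 0) ((ContinuousLinearMap.proj (R := ℝ) (φ := fun _ : Fin 1 => ℝ) 0).analyticAt 0)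
        ((gm_eq_zero U).2 h)
      have ht : Tendsto (fun t : ℝ => (fun _ => t : Fin 1 → ℝ)) (𝓝[≠] 0) (𝓝 0) :=
        (Continuous.tendsto' (by fun_prop) _ _ rfl).mono_left nhdsWithin_le_nhds
      obtain ⟨t, h2, h3⟩ := ((ht.eventually h1).and self_mem_nhdsWithin).exists
      exact h3 h2
    filter_upwards [this] with k hk
    exact abs_pos.2 hk
  · rintro _ ⟨g, hg, rfl⟩
    have key : ∀ ε : ℝ, (∀ᶠ k in (U : Filter ℕ), y k 0 = ε * |y k 0|) → ev U y g ∈ AA U (tau (fun k => |y k 0|) 1) := by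
      intro ε hε
      refine ⟨fun t => g (fun _ => ε * t), ?_, ?_⟩
      · have h1 : AnalyticAt ℝ (fun t : ℝ => (fun _ => ε * t : Fin 1 → ℝ)) 0 :=
          (ContinuousLinearMap.pi (fun _ : Fin 1 => ε • ContinuousLinearMap.id ℝ ℝ)).analyticAt 0
        exact AnalyticAt.comp_of_eq (y := 0) hg h1 (by ext; simp)
      · refine (gm_eq U).2 ?_
        filter_upwards [hε] with k hk
        congr 1
        ext i
        simp only [tau]
        rw [Subsingleton.elim i 0]
        simp only [Nat.cast_one, div_one, Real.rpow_one]
        exact hk.symm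
    rcases Ultrafilter.em U (fun k => 0 ≤ y k 0) with h | h
    · exact key 1 (h.mono fun k hk => by rw [abs_of_nonneg hk, one_mul])
    · exact key (-1) (h.mono fun k hk => by rw [abs_of_neg (not_le.1 hk)]; ring)

lemma AA_common {s : ℕ → ℝ} (hs : Tendsto s U (𝓝 0)) (hpos : ∀ᶠ k in (U : Filter ℕ), 0 < s k)
    {N : ℕ} (b : Fin N → Ust U) (hb : ∀ i, ∃ e, 0 < e ∧ b i ∈ AA U (tau s e)) :
    ∃ e, 0 < e ∧ ∀ i, b i ∈ AA U (tau s e) := by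
  choose e he hm using hb
  refine ⟨∏ i, e i, Finset.prod_pos fun i _ => he i, fun i => ?_⟩
  rw [← Finset.mul_prod_erase _ _ (Finset.mem_univ i)]
  exact AA_tau hs hpos (he i) (Finset.prod_pos fun i _ => he i) (hm i)

theorem curve (π : E →L[ℝ] (Fin 1 → ℝ)) (x : ℕ → E) (hx : Tendsto x U (𝓝 0))
    (hI : Indep U (fun k => π (x k)))
    (hfin : ∃ (J : Type) (_ : Fintype J) (e : J → Ust U), (∀ j, e j ∈ AA U x) ∧ ∀ b ∈ AA U x,
        ∃ c : J → Ust U, (∀ j, c j ∈ AA U (fun k => π (x k))) ∧ b = ∑ j, c j * e j) :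
    ∃ (τ : ℕ → ℝ) (X : ℝ → E), Tendsto τ U (𝓝 0) ∧ (∀ᶠ k in (U : Filter ℕ), 0 < τ k) ∧
      AnalyticAt ℝ X 0 ∧ X 0 = 0 ∧ ∀ᶠ k in (U : Filter ℕ), x k = X (τ k) := by
  have hπx : Tendsto (fun k => π (x k)) U (𝓝 0) :=
    (π.continuous.tendsto' 0 0 (by simp)).comp hx
  obtain ⟨s, hs, hpos, hle⟩ := AA_tau_of_one hπx hI
  let N := Module.finrank ℝ E
  let Φ : E ≃L[ℝ] (Fin N → ℝ) := ContinuousLinearEquiv.ofFinrankEq (by simp [N])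
  have hco : ∀ i : Fin N, AnalyticAt ℝ (fun z => Φ z i) 0 := fun i =>
    ((ContinuousLinearMap.proj (R := ℝ) (φ := fun _ : Fin N => ℝ) i).comp (Φ : E →L[ℝ] (Fin N → ℝ))).analyticAt 0
  obtain ⟨e, he, hmem⟩ := AA_common hs hpos (fun i : Fin N => ev U x (fun z => Φ z i)) (by
    intro i
    obtain ⟨P, hPm, hP⟩ := isIntegral_of_fin π x hfin (ev_mem U x (hco i))
    refine puiseux hs hpos _ _ 1 one_pos (P.map (Subring.inclusion hle)) (hPm.map _) rfl ?_
    rw [Polynomial.eval₂_map]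
    exact hP)
  choose g hg hge using hmem
  have hτ := tau_tendsto hs hpos he
  let X : ℝ → E := fun t => Φ.symm (fun i => g i t)
  have hX : AnalyticAt ℝ X 0 := by
    have h1 : AnalyticAt ℝ (fun t => (fun i => g i t : Fin N → ℝ)) 0 := analyticAt_pi_iff.2 hg
    exact AnalyticAt.comp_of_eq (((Φ.symm : (Fin N → ℝ) →L[ℝ] E)).analyticAt _) h1 rfl
  have hxX : ∀ᶠ k in (U : Filter ℕ), x k = X (tau s e k) := by
    have h1 : ∀ᶠ k in (U : Filter ℕ), ∀ i, g i (tau s e k) = Φ (x k) i :=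
      eventually_all.2 fun i => (gm_eq U).1 (hge i)
    filter_upwards [h1] with k hk
    rw [Φ.eq_symm_apply]
    ext i; exact (hk i).symm
  refine ⟨tau s e, X, hτ, tau_pos hs hpos he, hX, ?_, hxX⟩
  have h2 : Tendsto (fun k => X (tau s e k)) U (𝓝 (X 0)) := hX.continuousAt.tendsto.comp hτ
  exact tendsto_nhds_unique (h2.congr' (hxX.mono fun k hk => hk.symm)) hx

theorem loj_curve (f : E → ℝ) (hf : AnalyticAt ℝ f 0) (hf0 : f 0 = 0) (x : ℕ → E)
    (τ : ℕ → ℝ) (X : ℝ → E) (hτ : Tendsto τ U (𝓝 0)) (hpos : ∀ᶠ k in (U : Filter ℕ), 0 < τ k)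
    (hX : AnalyticAt ℝ X 0) (hX0 : X 0 = 0) (hxX : ∀ᶠ k in (U : Filter ℕ), x k = X (τ k))
    (hfx : ∀ᶠ k in (U : Filter ℕ), 0 < f (x k)) :
    ∃ (θ C : ℝ), 0 ≤ θ ∧ θ < 1 ∧ 0 < C ∧
      ∀ᶠ k in (U : Filter ℕ), f (x k) ^ θ ≤ C * ‖fderiv ℝ f (x k)‖ := by
  have hφ : AnalyticAt ℝ (fun t => f (X t)) 0 := AnalyticAt.comp_of_eq hf hX hX0
  have hne : ¬ ∀ᶠ t in 𝓝 (0:ℝ), f (X t) = 0 := by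
    intro h
    obtain ⟨k, h1, h2, h3⟩ := ((hτ.eventually h).and (hxX.and hfx)).exists
    rw [h2, h1] at h3
    exact lt_irrefl _ h3
  obtain ⟨a, u, hu, hu0, hfu⟩ := hφ.exists_eventuallyEq_pow_smul_nonzero_iff.2 hne
  simp only [sub_zero, smul_eq_mul] at hfu
  have ha : 0 < a := by
    rcases Nat.eq_zero_or_pos a with h | h
    · exfalso
      have := hfu.self_of_nhds
      rw [h, hX0, hf0] at this
      simp at this
      exact hu0 this.symm
    · exact h
  obtain ⟨n, rfl⟩ : ∃ n, a = n + 1 := ⟨a - 1, by omega⟩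
  -- derivative bound
  have hder : ∀ᶠ t in 𝓝 (0:ℝ), fderiv ℝ f (X t) (deriv X t) = t ^ n * ((n+1) * u t + t * deriv u t) := by
    have hfX : ∀ᶠ t in 𝓝 (0:ℝ), AnalyticAt ℝ f (X t) := by
      have : Tendsto X (𝓝 0) (𝓝 0) := by simpa [hX0] using hX.continuousAt.tendsto
      exact this.eventually hf.eventually_analyticAt
    filter_upwards [hfu.eventually_nhds, hX.eventually_analyticAt, hu.eventually_analyticAt, hfX]
      with t h1 h2 h3 h4
    have e1 : HasDerivAt (fun t => f (X t)) (fderiv ℝ f (X t) (deriv X t)) t :=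
      h4.differentiableAt.hasFDerivAt.comp_hasDerivAt t h2.differentiableAt.hasDerivAt
    have e2 := ((hasDerivAt_pow (n+1) t).mul h3.differentiableAt.hasDerivAt).congr_of_eventuallyEq h1
    rw [e1.unique e2]
    simp only [Nat.add_sub_cancel]
    push_cast
    ring
  set v : ℝ → ℝ := fun t => (n+1) * u t + t * deriv u t with hv
  have hvc : ContinuousAt v 0 := by
    have h1 : ContinuousAt (deriv u) 0 := hu.deriv.continuousAt
    exact (continuousAt_const.mul hu.continuousAt).add (continuousAt_id.mul h1)
  have hv0 : v 0 ≠ 0 := by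
    simp only [hv, zero_mul, add_zero]
    exact mul_ne_zero (by positivity) hu0
  have hv1 : ∀ᶠ t in 𝓝 (0:ℝ), |v 0| / 2 < |v t| :=
    hvc.abs.eventually (lt_mem_nhds (by have := abs_pos.2 hv0; linarith))
  have hu1 : ∀ᶠ t in 𝓝 (0:ℝ), |u t| < |u 0| + 1 :=
    hu.continuousAt.abs.eventually (gt_mem_nhds (lt_add_one _))
  have hX1 : ∀ᶠ t in 𝓝 (0:ℝ), ‖deriv X t‖ < ‖deriv X 0‖ + 1 :=
    hX.deriv.continuousAt.norm.eventually (gt_mem_nhds (lt_add_one _))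
  set θ : ℝ := n / (n+1) with hθ
  have hn : (0:ℝ) ≤ n := Nat.cast_nonneg n
  have hθ0 : 0 ≤ θ := by positivity
  have hvp := abs_pos.2 hv0
  refine ⟨θ, (|u 0| + 1) ^ θ * ((‖deriv X 0‖ + 1) * (2 / |v 0|)), hθ0, ?_, by positivity, ?_⟩
  · rw [hθ, div_lt_one (by positivity)]; linarith
  · filter_upwards [hτ.eventually hder, hτ.eventually hv1, hτ.eventually hu1, hτ.eventually hX1, hτ.eventually hfu, hpos, hxX, hfx]
      with k h1 h2 h3 h4 h5 h6 h7 h8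
    rw [h7] at h8 ⊢
    have e1 : f (X (τ k)) ≤ τ k ^ (n+1) * (|u 0| + 1) := by
      rw [h5]
      exact mul_le_mul_of_nonneg_left ((le_abs_self _).trans h3.le) (by positivity)
    have e2 : f (X (τ k)) ^ θ ≤ τ k ^ n * (|u 0| + 1) ^ θ := by
      refine (Real.rpow_le_rpow h8.le e1 hθ0).trans ?_
      rw [Real.mul_rpow (by positivity) (by positivity)]
      refine mul_le_mul_of_nonneg_right (le_of_eq ?_) (by positivity)
      rw [← Real.rpow_natCast, ← Real.rpow_mul h6.le, ← Real.rpow_natCast]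
      congr 1
      rw [hθ]; push_cast; field_simp
    have e3 : τ k ^ n * (|v 0| / 2) ≤ ‖fderiv ℝ f (X (τ k))‖ * (‖deriv X 0‖ + 1) := by
      calc τ k ^ n * (|v 0| / 2) ≤ τ k ^ n * |v (τ k)| := by gcongr
        _ = |fderiv ℝ f (X (τ k)) (deriv X (τ k))| := by
          rw [h1, abs_mul, abs_of_nonneg (by positivity : 0 ≤ τ k ^ n)]
        _ ≤ ‖fderiv ℝ f (X (τ k))‖ * ‖deriv X (τ k)‖ := by rw [← Real.norm_eq_abs]; exact ContinuousLinearMap.le_opNorm _ _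
        _ ≤ _ := by gcongr
    have e4 : τ k ^ n ≤ ‖fderiv ℝ f (X (τ k))‖ * (‖deriv X 0‖ + 1) * (2 / |v 0|) := by
      calc τ k ^ n = τ k ^ n * (|v 0| / 2) * (2 / |v 0|) := by field_simp
        _ ≤ _ := by gcongr
    calc f (X (τ k)) ^ θ ≤ τ k ^ n * (|u 0| + 1) ^ θ := e2
      _ ≤ (‖fderiv ℝ f (X (τ k))‖ * (‖deriv X 0‖ + 1) * (2 / |v 0|)) * (|u 0| + 1) ^ θ := by gcongr
      _ = _ := by ring
end
end GFL

namespace GFL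
open Topology Set
set_option linter.deprecated false
set_option linter.unusedSimpArgs false
set_option linter.unusedVariables false
set_option linter.unusedSectionVars false

section
variable {E : Type} [NormedAddCommGroup E] [InnerProductSpace ℝ E] [FiniteDimensional ℝ E]
  [MeasurableSpace E] [BorelSpace E]

open MeasureTheory in
lemma sard (O : Set E) (A V : E → E) (f : E → ℝ) (hA : ∀ x ∈ O, DifferentiableAt ℝ A x)
    (hV : ∀ x ∈ O, DifferentiableAt ℝ V x) (hf : ∀ x ∈ O, DifferentiableAt ℝ f x) :
    ∃ c : E, ∀ᵐ s : ℝ, ∀ x ∈ O, ∀ l : ℝ, l • A x - V x = c → f x = s →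
      ∀ (u : E) (m : ℝ), m • A x + l • fderiv ℝ A x u - fderiv ℝ V x u = 0 → fderiv ℝ f x u = 0 →
        u = 0 ∨ A x = 0 := by
  let Ψ : E × ℝ → E × ℝ := fun z => (z.2 • A z.1 - V z.1, f z.1)
  let D : E × ℝ → (E × ℝ →L[ℝ] E × ℝ) := fun z =>
    ((z.2 • (fderiv ℝ A z.1).comp (ContinuousLinearMap.fst ℝ E ℝ) + (ContinuousLinearMap.snd ℝ E ℝ).smulRight (A z.1))
      - (fderiv ℝ V z.1).comp (ContinuousLinearMap.fst ℝ E ℝ)).prod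
      ((fderiv ℝ f z.1).comp (ContinuousLinearMap.fst ℝ E ℝ))
  let S : Set (E × ℝ) := {z | z.1 ∈ O ∧ (D z).det = 0}
  have hD : ∀ z ∈ S, HasFDerivWithinAt Ψ (D z) S z := by
    intro z hz
    apply HasFDerivAt.hasFDerivWithinAt
    have h1 : HasFDerivAt (fun z : E × ℝ => A z.1) ((fderiv ℝ A z.1).comp (ContinuousLinearMap.fst ℝ E ℝ)) z :=
      (hA z.1 hz.1).hasFDerivAt.comp z hasFDerivAt_fst
    have h2 : HasFDerivAt (fun z : E × ℝ => V z.1) ((fderiv ℝ V z.1).comp (ContinuousLinearMap.fst ℝ E ℝ)) z :=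
      (hV z.1 hz.1).hasFDerivAt.comp z hasFDerivAt_fst
    have h3 : HasFDerivAt (fun z : E × ℝ => f z.1) ((fderiv ℝ f z.1).comp (ContinuousLinearMap.fst ℝ E ℝ)) z :=
      (hf z.1 hz.1).hasFDerivAt.comp z hasFDerivAt_fst
    exact ((hasFDerivAt_snd.smul h1).sub h2).prodMk h3
  have h0 := addHaar_image_eq_zero_of_det_fderivWithin_eq_zero ((volume : Measure E).prod (volume : Measure ℝ)) hD (fun z hz => hz.2)
  have h1 : ∀ᵐ w ∂((volume : Measure E).prod (volume : Measure ℝ)), w ∉ Ψ '' S := measure_eq_zero_iff_ae_notMem.1 h0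
  have h2 := Measure.ae_ae_of_ae_prod (μ := (volume : Measure E)) (ν := (volume : Measure ℝ)) h1
  obtain ⟨c, hc⟩ := h2.exists
  refine ⟨c, ?_⟩
  filter_upwards [hc] with s hs x hx l hl hfx u m hu hfu
  by_cases hA0 : A x = 0
  · right; exact hA0
  left
  have hdet : (D (x, l)).det ≠ 0 := by
    intro h
    apply hs
    exact ⟨(x, l), ⟨hx, h⟩, by simp [Ψ, hl, hfx]⟩
  have hker : D (x, l) (u, m) = 0 := by
    simp only [D, ContinuousLinearMap.prod_apply]
    ext1
    · simp
      rw [← hu]; abel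
    · simpa using hfu
  have hinj : (u, m) = 0 := by
    have h3 : IsUnit (LinearMap.det ((D (x, l)) : (E × ℝ) →ₗ[ℝ] E × ℝ)) := isUnit_iff_ne_zero.2 hdet
    have h4 := (LinearMap.equivOfDetNeZero ((D (x, l)) : (E × ℝ) →ₗ[ℝ] E × ℝ) hdet).injective
    apply h4
    rw [map_zero]
    exact hker
  exact (Prod.ext_iff.1 hinj).1

end

variable {U : Ultrafilter ℕ}
lemma tan_vec {E F : Type*} [NormedAddCommGroup E] [NormedSpace ℝ E] [NormedAddCommGroup F] [NormedSpace ℝ F]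
    [FiniteDimensional ℝ F] {x u : ℕ → E} (hx : Tendsto x U (𝓝 0)) (hu : Tan U x u) (G : E → F)
    (hG : AnalyticAt ℝ G 0) (h : ∀ᶠ k in (U : Filter ℕ), G (x k) = 0) :
    ∀ᶠ k in (U : Filter ℕ), fderiv ℝ G (x k) (u k) = 0 := by
  let N := Module.finrank ℝ F
  let Φ : F ≃L[ℝ] (Fin N → ℝ) := ContinuousLinearEquiv.ofFinrankEq (by simp [N])
  let L : Fin N → F →L[ℝ] ℝ := fun i =>
    (ContinuousLinearMap.proj (R := ℝ) (φ := fun _ : Fin N => ℝ) i).comp (Φ : F →L[ℝ] (Fin N → ℝ))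
  have h1 : ∀ i, ∀ᶠ k in (U : Filter ℕ), L i (fderiv ℝ G (x k) (u k)) = 0 := by
    intro i
    have h2 := hu (fun z => L i (G z)) (((L i).analyticAt _).comp_of_eq hG rfl)
      ((gm_eq_zero U).2 (h.mono fun k hk => by simp [hk]))
    filter_upwards [(gm_eq_zero U).1 h2, hx.eventually hG.eventually_analyticAt] with k hk hk2
    have := ((L i).hasFDerivAt.comp (x k) hk2.differentiableAt.hasFDerivAt).fderiv
    change fderiv ℝ (⇑(L i) ∘ G) (x k) (u k) = 0 at hk
    rw [this] at hk
    exact hk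
  filter_upwards [eventually_all.2 h1] with k hk
  apply Φ.injective
  ext i
  exact (hk i).trans (by simp)

end GFL

namespace GFL
open Topology Set
set_option linter.deprecated false
set_option linter.unusedSimpArgs false
set_option linter.unusedVariables false
set_option linter.unusedSectionVars false

variable {U : Ultrafilter ℕ}
section
variable {E : Type} [NormedAddCommGroup E] [NormedSpace ℝ E] [FiniteDimensional ℝ E]

lemma crit_seq (f : E → ℝ) (hf : AnalyticAt ℝ f 0) (hf0 : f 0 = 0) (x : ℕ → E) (hx : Tendsto x U (𝓝 0))
    (h : ∀ᶠ k in (U : Filter ℕ), fderiv ℝ f (x k) = 0) : ∀ᶠ k in (U : Filter ℕ), f (x k) = 0 := by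
  obtain ⟨d, π, hI, hfin, hlift⟩ := thmD (U := U) (Module.finrank ℝ E) E rfl x hx
  have := const_lemma π x hx hI hfin f hf hf0 (fun j => by
    obtain ⟨u, hu, hu2⟩ := hlift (fun _ => Pi.single j 1)
    refine ⟨u, hu, hu2, (gm_eq_zero U).2 (h.mono fun k hk => by simp [hk])⟩)
  exact (gm_eq_zero U).1 this

lemma tan_comb {x u v : ℕ → E} (hu : Tan U x u) (hv : Tan U x v) (a b : ℕ → ℝ) :
    Tan U x (fun k => a k • u k - b k • v k) := by
  intro g hg h
  have h1 := (gm_eq_zero U).1 (hu g hg h)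
  have h2 := (gm_eq_zero U).1 (hv g hg h)
  refine (gm_eq_zero U).2 ?_
  filter_upwards [h1, h2] with k hk1 hk2
  rw [map_sub, map_smul, map_smul, hk1, hk2]; simp

lemma main_dim (f : E → ℝ) (hf : AnalyticAt ℝ f 0) (hf0 : f 0 = 0) (x : ℕ → E) (hx : Tendsto x U (𝓝 0))
    (hfx : ∀ᶠ k in (U : Filter ℕ), 0 < f (x k))
    (hreg : ∀ u, Tan U x u → (∀ᶠ k in (U : Filter ℕ), fderiv ℝ f (x k) (u k) = 0) →
      ∀ᶠ k in (U : Filter ℕ), u k = 0) :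
    ∃ (θ C : ℝ), 0 ≤ θ ∧ θ < 1 ∧ 0 < C ∧
      ∀ᶠ k in (U : Filter ℕ), f (x k) ^ θ ≤ C * ‖fderiv ℝ f (x k)‖ := by
  obtain ⟨d, π, hI, hfin, hlift⟩ := thmD (U := U) (Module.finrank ℝ E) E rfl x hx
  match d, π, hI, hfin, hlift with
  | 0, π, hI, hfin, hlift =>
    have := const_lemma π x hx hI hfin f hf hf0 (fun j => j.elim0)
    obtain ⟨k, h1, h2⟩ := (((gm_eq_zero U).1 this).and hfx).exists
    exact absurd h1 h2.ne'
  | 1, π, hI, hfin, hlift =>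
    obtain ⟨τ, X, h1, h2, h3, h4, h5⟩ := curve π x hx hI hfin
    exact loj_curve f hf hf0 x τ X h1 h2 h3 h4 h5 hfx
  | d + 2, π, hI, hfin, hlift =>
    exfalso
    obtain ⟨u, hu, hu2⟩ := hlift (fun _ => Pi.single 0 1)
    obtain ⟨v, hv, hv2⟩ := hlift (fun _ => Pi.single 1 1)
    have h1 := hreg _ (tan_comb hu hv (fun k => fderiv ℝ f (x k) (v k)) (fun k => fderiv ℝ f (x k) (u k)))
      (Eventually.of_forall fun k => by
        simp only [map_sub, map_smul, smul_eq_mul]; ring)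
    have h2 : ∀ᶠ k in (U : Filter ℕ), fderiv ℝ f (x k) (u k) = 0 := by
      filter_upwards [h1] with k hk
      have h3 := congrArg (fun w => π w 1) hk
      simpa [hu2, hv2] using h3
    obtain ⟨k, hk⟩ := (hreg u hu h2).exists
    have h4 := congrArg (fun w => π w 0) hk
    simp [hu2] at h4

lemma crit_lemma (f : E → ℝ) (p : E) (hf : AnalyticAt ℝ f p) (hfp : f p = 0) :
    ∃ ρ > 0, ∀ x ∈ Metric.closedBall p ρ, f x ≠ 0 → fderiv ℝ f x ≠ 0 := by
  by_contra! hcon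
  have : ∀ k : ℕ, ∃ x ∈ Metric.closedBall p (1 / ((k : ℝ) + 1)), f x ≠ 0 ∧ fderiv ℝ f x = 0 :=
    fun k => hcon _ (by positivity)
  choose x hx hx1 hx2 using this
  have hlim : Tendsto (fun k => x k - p) atTop (𝓝 0) := by
    rw [tendsto_zero_iff_norm_tendsto_zero]
    refine squeeze_zero (fun _ => norm_nonneg _) (fun k => ?_) tendsto_one_div_add_atTop_nhds_zero_nat
    simpa [dist_eq_norm] using hx k
  have hU : ((hyperfilter ℕ : Ultrafilter ℕ) : Filter ℕ) ≤ atTop := by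
    rw [← Nat.cofinite_eq_atTop]; exact hyperfilter_le_cofinite
  have hadd : AnalyticAt ℝ (fun z : E => z + p) 0 := analyticAt_id.add analyticAt_const
  have h1 := crit_seq (U := hyperfilter ℕ) (fun z => f (z + p))
    (AnalyticAt.comp_of_eq hf hadd (by simp)) (by simpa using hfp) (fun k => x k - p) (hlim.mono_left hU)
    (Eventually.of_forall fun k => by rw [fderiv_comp_add_right]; simpa using hx2 k)
  obtain ⟨k, hk⟩ := h1.exists
  exact hx1 k (by simpa using hk)

end
end GFL

namespace GFL
open Topology Set
set_option linter.deprecated false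
set_option linter.unusedSimpArgs false
set_option linter.unusedVariables false
set_option linter.unusedSectionVars false

section
variable {E : Type} [NormedAddCommGroup E] [InnerProductSpace ℝ E] [FiniteDimensional ℝ E]

variable (E) in
noncomputable def Jd : (E →L[ℝ] ℝ) →L[ℝ] E :=
  LinearMap.toContinuousLinearMap
    { toFun := fun l => (InnerProductSpace.toDual ℝ E).symm l
      map_add' := fun a b => map_add _ a b
      map_smul' := fun a b => by simp }

lemma Jd_apply (l : E →L[ℝ] ℝ) : Jd E l = (InnerProductSpace.toDual ℝ E).symm l := rfl
lemma Jd_norm (l : E →L[ℝ] ℝ) : ‖Jd E l‖ = ‖l‖ := by rw [Jd_apply]; simp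
lemma Jd_inner (l : E →L[ℝ] ℝ) (u : E) : inner ℝ (Jd E l) u = l u :=
  InnerProductSpace.toDual_symm_apply
lemma Jd_self (l : E →L[ℝ] ℝ) : l (Jd E l) = ‖l‖ ^ 2 := by
  rw [← Jd_inner, real_inner_self_eq_norm_sq, Jd_norm]
lemma Jd_innerSL (c : E) : Jd E (innerSL ℝ c) = c := by
  apply ext_inner_right ℝ
  intro v; rw [Jd_inner]; simp

noncomputable def qf (f : E → ℝ) (x : E) : ℝ := fderiv ℝ f x (Jd E (fderiv ℝ f x))
noncomputable def bf (p : E) (ρ : ℝ) (x : E) : ℝ := ρ ^ 2 - innerSL ℝ (x - p) (x - p)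
noncomputable def Vf (f : E → ℝ) (p : E) (ρ : ℝ) (x : E) : E :=
  Jd E ((qf f x)⁻¹ • fderiv ℝ (qf f) x - (bf p ρ x)⁻¹ • fderiv ℝ (bf p ρ) x)
noncomputable def Zf (f : E → ℝ) (p : E) (ρ : ℝ) (c : E) (x : E) : E :=
  (qf f x * bf p ρ x) • c + Jd E (bf p ρ x • fderiv ℝ (qf f) x - qf f x • fderiv ℝ (bf p ρ) x)
noncomputable def Gf (f : E → ℝ) (p : E) (ρ : ℝ) (c : E) (x : E) : E :=
  (fderiv ℝ f x (Zf f p ρ c x)) • Jd E (fderiv ℝ f x) - qf f x • Zf f p ρ c x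
noncomputable def lamf (f : E → ℝ) (p : E) (ρ : ℝ) (c : E) (x : E) : ℝ :=
  fderiv ℝ f x (c + Vf f p ρ x) * (qf f x)⁻¹

lemma qf_eq (f : E → ℝ) (x : E) : qf f x = ‖fderiv ℝ f x‖ ^ 2 := Jd_self _
lemma bf_eq (p : E) (ρ : ℝ) (x : E) : bf p ρ x = ρ ^ 2 - ‖x - p‖ ^ 2 := by
  simp only [bf, innerSL_apply_apply, real_inner_self_eq_norm_sq]

lemma Jd_an {F : E → (E →L[ℝ] ℝ)} {x : E} (hF : AnalyticAt ℝ F x) : AnalyticAt ℝ (fun x => Jd E (F x)) x :=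
  ((Jd E).analyticAt _).comp_of_eq hF rfl
lemma Af_an {f : E → ℝ} {x : E} (hf : AnalyticAt ℝ f x) : AnalyticAt ℝ (fun x => Jd E (fderiv ℝ f x)) x :=
  Jd_an hf.fderiv
lemma qf_an {f : E → ℝ} {x : E} (hf : AnalyticAt ℝ f x) : AnalyticAt ℝ (qf f) x :=
  analyticAt_clm_apply hf.fderiv (Af_an hf)
lemma bf_an (p : E) (ρ : ℝ) (x : E) : AnalyticAt ℝ (bf p ρ) x := by
  have h1 : AnalyticAt ℝ (fun x : E => x - p) x := analyticAt_id.sub analyticAt_const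
  exact analyticAt_const.sub (analyticAt_clm_apply (((innerSL ℝ).analyticAt _).comp_of_eq h1 rfl) h1)
lemma Vf_an {f : E → ℝ} {x : E} (hf : AnalyticAt ℝ f x) (p : E) (ρ : ℝ) (hq : qf f x ≠ 0)
    (hb : bf p ρ x ≠ 0) : AnalyticAt ℝ (Vf f p ρ) x :=
  Jd_an ((((qf_an hf).inv hq).smul (qf_an hf).fderiv).sub (((bf_an p ρ x).inv hb).smul (bf_an p ρ x).fderiv))
lemma Zf_an {f : E → ℝ} {x : E} (hf : AnalyticAt ℝ f x) (p : E) (ρ : ℝ) (c : E) :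
    AnalyticAt ℝ (Zf f p ρ c) x :=
  (((qf_an hf).mul (bf_an p ρ x)).smul analyticAt_const).add
    (Jd_an (((bf_an p ρ x).smul (qf_an hf).fderiv).sub ((qf_an hf).smul (bf_an p ρ x).fderiv)))
lemma Gf_an {f : E → ℝ} {x : E} (hf : AnalyticAt ℝ f x) (p : E) (ρ : ℝ) (c : E) :
    AnalyticAt ℝ (Gf f p ρ c) x :=
  ((analyticAt_clm_apply hf.fderiv (Zf_an hf p ρ c)).smul (Af_an hf)).sub ((qf_an hf).smul (Zf_an hf p ρ c))
lemma lamf_an {f : E → ℝ} {x : E} (hf : AnalyticAt ℝ f x) (p : E) (ρ : ℝ) (c : E) (hq : qf f x ≠ 0)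
    (hb : bf p ρ x ≠ 0) : AnalyticAt ℝ (lamf f p ρ c) x :=
  (analyticAt_clm_apply hf.fderiv (analyticAt_const.add (Vf_an hf p ρ hq hb))).mul ((qf_an hf).inv hq)

lemma Zf_eq (f : E → ℝ) (p : E) (ρ : ℝ) (c x : E) (hq : qf f x ≠ 0) (hb : bf p ρ x ≠ 0) :
    Zf f p ρ c x = (qf f x * bf p ρ x) • (c + Vf f p ρ x) := by
  simp only [Zf, Vf, smul_add, ← map_smul, smul_sub, smul_smul]
  congr 4
  · field_simp
  · field_simp

lemma Gf_eq (f : E → ℝ) (p : E) (ρ : ℝ) (c x : E) (hq : qf f x ≠ 0) (hb : bf p ρ x ≠ 0) :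
    Gf f p ρ c x = (qf f x ^ 2 * bf p ρ x) •
      (lamf f p ρ c x • Jd E (fderiv ℝ f x) - Vf f p ρ x - c) := by
  rw [Gf, Zf_eq f p ρ c x hq hb, lamf]
  simp only [map_smul, smul_sub, smul_smul, smul_eq_mul]
  rw [sub_sub, ← smul_add, add_comm (Vf f p ρ x) c]
  congr 2 <;> field_simp

lemma reg_step {x₀ : E} {A V Γ : E → E} {lam w : E → ℝ} {c : E} (hA : DifferentiableAt ℝ A x₀)
    (hV : DifferentiableAt ℝ V x₀) (hl : DifferentiableAt ℝ lam x₀) (hw : DifferentiableAt ℝ w x₀)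
    (hΓ : Γ =ᶠ[𝓝 x₀] fun x => w x • (lam x • A x - V x - c)) (h0 : lam x₀ • A x₀ - V x₀ = c)
    (hw0 : w x₀ ≠ 0) (u : E) (hu : fderiv ℝ Γ x₀ u = 0) :
    (fderiv ℝ lam x₀ u) • A x₀ + lam x₀ • fderiv ℝ A x₀ u - fderiv ℝ V x₀ u = 0 := by
  have h1 := hw.hasFDerivAt.smul (((hl.hasFDerivAt.smul hA.hasFDerivAt).sub hV.hasFDerivAt).sub
    (hasFDerivAt_const c x₀))
  have h2 := (h1.congr_of_eventuallyEq hΓ).fderiv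
  rw [h2] at hu
  simp [h0] at hu
  rcases hu with hu | hu
  · exact absurd hu hw0
  · rw [← hu]; abel

lemma lagr {f : E → ℝ} {y p c : E} {ρ : ℝ} (hf : AnalyticAt ℝ f y) (hq : 0 < qf f y) (hb : 0 < bf p ρ y)
    (hmax : ∀ᶠ x in 𝓝 y, f x = f y → bf p ρ x * Real.exp (- inner ℝ c x) * (qf f x)⁻¹ ≤
      bf p ρ y * Real.exp (- inner ℝ c y) * (qf f y)⁻¹) :
    lamf f p ρ c y • Jd E (fderiv ℝ f y) - Vf f p ρ y = c := by
  have hq' := (qf_an hf).hasStrictFDerivAt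
  have hb' := (bf_an p ρ y).hasStrictFDerivAt
  have hf' := hf.hasStrictFDerivAt
  have hφ := ((hq'.log hq.ne').sub (hb'.log hb.ne')).add (innerSL ℝ c).hasStrictFDerivAt
  have hext : IsLocalExtrOn (fun x => Real.log (qf f x) - Real.log (bf p ρ x) + innerSL ℝ c x)
      {x | f x = f y} y := by
    left
    refine eventually_nhdsWithin_iff.2 ?_
    filter_upwards [hmax, (qf_an hf).continuousAt.eventually (lt_mem_nhds hq),
      (bf_an p ρ y).continuousAt.eventually (lt_mem_nhds hb)] with x hx hqx hbx hfx
    have h1 := Real.log_le_log (by positivity) (hx hfx)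
    have h2 : ∀ z, 0 < qf f z → 0 < bf p ρ z →
        Real.log (bf p ρ z * Real.exp (- inner ℝ c z) * (qf f z)⁻¹) =
        Real.log (bf p ρ z) - inner ℝ c z - Real.log (qf f z) := by
      intro z h3 h4
      rw [Real.log_mul (by positivity) (by positivity), Real.log_mul (by positivity) (by positivity),
        Real.log_inv, Real.log_exp]; ring
    rw [h2 x hqx hbx, h2 y hq hb] at h1
    simp only [innerSL_apply_apply]
    linarith
  obtain ⟨a, b, hab, h⟩ := hext.exists_multipliers_of_hasStrictFDerivAt_1d hf' hφ
  have hb0 : b ≠ 0 := by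
    rintro rfl
    have ha : a ≠ 0 := by rintro rfl; simp at hab
    simp only [zero_smul, add_zero, smul_eq_zero, ha, false_or] at h
    rw [qf_eq, h] at hq
    simp at hq
  have h1 : (Vf f p ρ y) + c = (-(a / b)) • Jd E (fderiv ℝ f y) := by
    have h2 := congrArg (fun l => b⁻¹ • Jd E l) h
    simp only [map_add, map_smul, Jd_innerSL, map_zero, smul_zero, smul_add, smul_smul,
      inv_mul_cancel₀ hb0, one_smul] at h2
    rw [Vf, eq_comm, neg_smul, neg_eq_iff_add_eq_zero, ← h2, div_eq_inv_mul]
  have h2 : lamf f p ρ c y = -(a / b) := by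
    rw [lamf, add_comm c, h1, map_smul, smul_eq_mul]
    change -(a/b) * qf f y * _ = _
    field_simp
  rw [h2, ← h1]; abel

end
end GFL

namespace GFL
open Topology Set
set_option linter.deprecated false
set_option linter.unusedSimpArgs false
set_option linter.unusedVariables false
set_option linter.unusedSectionVars false

section
variable {E : Type} [NormedAddCommGroup E] [InnerProductSpace ℝ E] [FiniteDimensional ℝ E]

/-- maximum of the weight on a level set -/
lemma max_point {f : E → ℝ} (hf : ∀ x, AnalyticAt ℝ f x) {p c : E} {ρ : ℝ} (hρ : 0 < ρ)
    (hcrit : ∀ x ∈ Metric.closedBall p ρ, f x ≠ 0 → fderiv ℝ f x ≠ 0) {z : E}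
    (hz : z ∈ Metric.ball p (ρ / 2)) (hfz : 0 < f z) :
    ∃ y ∈ Metric.ball p ρ, f y = f z ∧ lamf f p ρ c y • Jd E (fderiv ℝ f y) - Vf f p ρ y = c ∧
      ‖fderiv ℝ f y‖ ≤ (2 * Real.exp (2 * ρ * ‖c‖)) * ‖fderiv ℝ f z‖ := by
  have hfc : Continuous f := continuous_iff_continuousAt.2 fun x => (hf x).continuousAt
  have hqc : Continuous (qf f) := continuous_iff_continuousAt.2 fun x => (qf_an (hf x)).continuousAt
  have hbc : Continuous (bf p ρ) := continuous_iff_continuousAt.2 fun x => (bf_an p ρ x).continuousAt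
  let K := Metric.closedBall p ρ ∩ {x | f x = f z}
  have hK : IsCompact K := (isCompact_closedBall p ρ).inter_right (isClosed_eq hfc continuous_const)
  have hqK : ∀ x ∈ K, 0 < qf f x := by
    intro x hx
    rw [qf_eq]
    have := hcrit x hx.1 (by rw [hx.2]; exact hfz.ne')
    positivity
  have hzK : z ∈ K := ⟨Metric.ball_subset_closedBall (Metric.ball_subset_ball (by linarith) hz), rfl⟩
  have hM : ContinuousOn (fun x => bf p ρ x * Real.exp (- inner ℝ c x) * (qf f x)⁻¹) K := by
    refine ContinuousOn.mul (Continuous.continuousOn (hbc.mul (by fun_prop))) ?_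
    exact hqc.continuousOn.inv₀ fun x hx => (hqK x hx).ne'
  obtain ⟨y, hyK, hy⟩ := hK.exists_isMaxOn ⟨z, hzK⟩ hM
  have hbz : 3 / 4 * ρ ^ 2 ≤ bf p ρ z := by
    rw [bf_eq]
    have h1 : ‖z - p‖ < ρ / 2 := by simpa [dist_eq_norm] using hz
    nlinarith [norm_nonneg (z - p)]
  have hyz := hy hzK
  simp only [mem_setOf_eq] at hyz
  have hqz := hqK z hzK
  have hqy := hqK y hyK
  have hby : 0 < bf p ρ y := by
    by_contra hcon
    have h1 : bf p ρ y * Real.exp (- inner ℝ c y) * (qf f y)⁻¹ ≤ 0 := by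
      have : 0 ≤ Real.exp (- inner ℝ c y) * (qf f y)⁻¹ := by positivity
      rw [mul_assoc]
      exact mul_nonpos_of_nonpos_of_nonneg (not_lt.1 hcon) this
    have h2 : 0 < bf p ρ z * Real.exp (- inner ℝ c z) * (qf f z)⁻¹ := by
      have : 0 < bf p ρ z := by nlinarith
      positivity
    linarith
  have hyb : y ∈ Metric.ball p ρ := by
    rw [bf_eq] at hby
    rw [Metric.mem_ball, dist_eq_norm]
    nlinarith [norm_nonneg (y - p)]
  refine ⟨y, hyb, hyK.2, ?_, ?_⟩
  · refine lagr (hf y) hqy hby ?_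
    filter_upwards [Metric.isOpen_ball.mem_nhds hyb] with x hx hxy
    exact hy ⟨Metric.ball_subset_closedBall hx, hxy.trans hyK.2⟩
  · have hexp : Real.exp (- inner ℝ c y) ≤ Real.exp (2 * ρ * ‖c‖) * Real.exp (- inner ℝ c z) := by
      rw [← Real.exp_add, Real.exp_le_exp]
      have h1 : inner ℝ c (z - y) ≤ ‖c‖ * ‖z - y‖ := real_inner_le_norm _ _
      have h2 : ‖z - y‖ ≤ 2 * ρ := by
        have h3 : ‖z - p‖ < ρ / 2 := by simpa [dist_eq_norm] using hz
        have h4 : ‖y - p‖ < ρ := by simpa [dist_eq_norm] using hyb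
        have : z - y = (z - p) - (y - p) := by abel
        rw [this]
        linarith [norm_sub_le (z - p) (y - p)]
      rw [inner_sub_right] at h1
      nlinarith [norm_nonneg c]
    have hby2 : bf p ρ y ≤ ρ ^ 2 := by rw [bf_eq]; nlinarith [norm_nonneg (y - p)]
    have h1 : bf p ρ z * Real.exp (- inner ℝ c z) * qf f y ≤ bf p ρ y * Real.exp (- inner ℝ c y) * qf f z := by
      rw [← div_eq_mul_inv, ← div_eq_mul_inv, div_le_div_iff₀ hqz hqy] at hyz
      exact hyz
    have e1 := Real.exp_pos (- inner ℝ c z)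
    have e2 := Real.exp_pos (2 * ρ * ‖c‖)
    have e3 : 1 ≤ Real.exp (2 * ρ * ‖c‖) := Real.one_le_exp (by positivity)
    have h2 : bf p ρ y * Real.exp (- inner ℝ c y) ≤ ρ ^ 2 * (Real.exp (2 * ρ * ‖c‖) * Real.exp (- inner ℝ c z)) :=
      mul_le_mul hby2 hexp (Real.exp_pos _).le (by positivity)
    have h3 : 3 / 4 * ρ ^ 2 * Real.exp (- inner ℝ c z) * qf f y ≤
        ρ ^ 2 * (Real.exp (2 * ρ * ‖c‖) * Real.exp (- inner ℝ c z)) * qf f z := by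
      calc _ ≤ bf p ρ z * Real.exp (- inner ℝ c z) * qf f y := by gcongr
        _ ≤ _ := h1
        _ ≤ _ := by gcongr
    have h4 : qf f y ≤ 4 / 3 * Real.exp (2 * ρ * ‖c‖) * qf f z := by
      have : 0 < ρ ^ 2 * Real.exp (- inner ℝ c z) := by positivity
      refine le_of_mul_le_mul_left ?_ this
      nlinarith
    rw [qf_eq, qf_eq] at h4
    refine abs_le_of_sq_le_sq' ?_ (by positivity) |>.2
    rw [mul_pow]
    refine h4.trans ?_
    gcongr
    nlinarith

lemma bad_point {f : E → ℝ} (hf : ∀ x, AnalyticAt ℝ f x) {p : E} {r θ C : ℝ} {S : Set ℝ} (hS : Dense S)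
    (hcrit : ∀ x ∈ Metric.ball p r, f x ≠ 0 → fderiv ℝ f x ≠ 0)
    (hbad : ∃ x ∈ Metric.ball p r, 0 < f x ∧ C * ‖fderiv ℝ f x‖ < f x ^ θ) :
    ∃ x ∈ Metric.ball p r, 0 < f x ∧ C * ‖fderiv ℝ f x‖ < f x ^ θ ∧ f x ∈ S := by
  obtain ⟨x, hx, hfx, hb⟩ := hbad
  have hmap := (hf x).hasStrictFDerivAt.map_nhds_eq_of_surj
    (LinearMap.range_eq_top.2 (LinearMap.surjective (f := (fderiv ℝ f x : E →ₗ[ℝ] ℝ)) (by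
      intro h
      apply hcrit x hx hfx.ne'
      ext v
      exact LinearMap.congr_fun h v)))
  have hW : ∀ᶠ x' in 𝓝 x, x' ∈ Metric.ball p r ∧ 0 < f x' ∧ C * ‖fderiv ℝ f x'‖ < f x' ^ θ := by
    refine Filter.Eventually.and (Metric.isOpen_ball.mem_nhds hx) (((hf x).continuousAt.eventually (lt_mem_nhds hfx)).and ?_)
    have c1 : ContinuousAt (fun x' => C * ‖fderiv ℝ f x'‖) x :=
      continuousAt_const.mul (hf x).fderiv.continuousAt.norm
    have c2 : ContinuousAt (fun x' => f x' ^ θ) x := (hf x).continuousAt.rpow_const (Or.inl hfx.ne')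
    exact c1.eventually_lt c2 hb
  have h1 : f '' {x' | x' ∈ Metric.ball p r ∧ 0 < f x' ∧ C * ‖fderiv ℝ f x'‖ < f x' ^ θ} ∈ 𝓝 (f x) := by
    rw [← hmap]; exact image_mem_map hW
  obtain ⟨s, hs, x', hx', rfl⟩ := hS.inter_nhds_nonempty h1
  exact ⟨x', hx'.1, hx'.2.1, hx'.2.2, hs⟩

theorem lojasiewicz (f : E → ℝ) (hf : ∀ x, AnalyticAt ℝ f x) (p : E) (hfp : f p = 0) :
    ∃ r C θ : ℝ, 0 < r ∧ 0 < C ∧ 0 ≤ θ ∧ θ < 1 ∧ ∀ x ∈ Metric.ball p r, 0 < f x →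
      f x ^ θ ≤ C * ‖fderiv ℝ f x‖ := by
  by_contra! hcon
  obtain ⟨ρ, hρ, hcrit⟩ := crit_lemma f p (hf p) hfp
  let _ : MeasurableSpace E := borel E
  have _ : BorelSpace E := ⟨rfl⟩
  have hfc : Continuous f := continuous_iff_continuousAt.2 fun x => (hf x).continuousAt
  let O : Set E := {x | x ∈ Metric.ball p ρ ∧ 0 < f x}
  have hO : IsOpen O := Metric.isOpen_ball.inter (isOpen_lt continuous_const hfc)
  have hqO : ∀ x ∈ O, qf f x ≠ 0 := by
    intro x hx
    rw [qf_eq]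
    have := hcrit x (Metric.ball_subset_closedBall hx.1) hx.2.ne'
    positivity
  have hbO : ∀ x ∈ O, bf p ρ x ≠ 0 := by
    intro x hx
    rw [bf_eq]
    have h1 : ‖x - p‖ < ρ := by simpa [dist_eq_norm] using hx.1
    have := norm_nonneg (x - p)
    nlinarith
  obtain ⟨c, hc⟩ := sard O (fun x => Jd E (fderiv ℝ f x)) (Vf f p ρ) f
    (fun x _ => (Af_an (hf x)).differentiableAt)
    (fun x hx => (Vf_an (hf x) p ρ (hqO x hx) (hbO x hx)).differentiableAt)
    (fun x _ => (hf x).differentiableAt)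
  have hdense := MeasureTheory.Measure.dense_of_ae hc
  have hz : ∀ k : ℕ, _ := fun k => bad_point hf (p := p) (r := min (ρ / 2) (1 / ((k : ℝ) + 1)))
    (θ := 1 - 1 / ((k : ℝ) + 2)) (C := (k : ℝ) + 1) hdense
    (fun x hx => hcrit x (Metric.ball_subset_closedBall (Metric.ball_subset_ball
      ((min_le_left _ _).trans (by linarith)) hx)))
    (hcon _ _ _ (by positivity) (by positivity) (by
      rw [sub_nonneg, div_le_one (by positivity)]; linarith [(Nat.cast_nonneg k : (0:ℝ) ≤ k)])
      (by simp; positivity))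
  choose z hzb hz0 hzbad hzreg using hz
  have hy : ∀ k : ℕ, _ := fun k => max_point hf (c := c) hρ hcrit (Metric.ball_subset_ball (min_le_left _ _) (hzb k))
    (hz0 k)
  choose y hyb hyf hyl hyn using hy
  let U : Ultrafilter ℕ := hyperfilter ℕ
  have hU : (U : Filter ℕ) ≤ atTop := by
    rw [← Nat.cofinite_eq_atTop]; exact hyperfilter_le_cofinite
  have hzlim : Tendsto z atTop (𝓝 p) := by
    rw [tendsto_iff_dist_tendsto_zero]
    refine squeeze_zero (fun _ => dist_nonneg) (fun k => ?_) tendsto_one_div_add_atTop_nhds_zero_nat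
    exact (Metric.mem_ball.1 (hzb k)).le.trans (min_le_right _ _)
  have hflim : Tendsto (fun k => f (z k)) atTop (𝓝 0) := by
    have := (hfc.tendsto p).comp hzlim
    rw [hfp] at this; exact this
  obtain ⟨p', hp'K, hp'⟩ := (isCompact_closedBall p ρ).ultrafilter_le_nhds (U.map y)
    (le_principal_iff.2 (by
      change ∀ᶠ k in (U : Filter ℕ), y k ∈ Metric.closedBall p ρ
      exact Eventually.of_forall fun k => Metric.ball_subset_closedBall (hyb k)))
  have hyp : Tendsto y U (𝓝 p') := hp'
  have hfp' : f p' = 0 := by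
    refine tendsto_nhds_unique ((hfc.tendsto p').comp hyp) ?_
    refine (hflim.mono_left hU).congr fun k => (hyf k).symm
  have hadd : AnalyticAt ℝ (fun z : E => z + p') 0 := analyticAt_id.add analyticAt_const
  have hx0 : Tendsto (fun k => y k - p') U (𝓝 0) := by
    simpa using hyp.sub_const p'
  have hyO : ∀ k, y k ∈ O := fun k => ⟨hyb k, by rw [hyf]; exact hz0 k⟩
  obtain ⟨θ, C, hθ0, hθ1, hC, hloj⟩ := main_dim (U := U) (fun z => f (z + p'))
    (AnalyticAt.comp_of_eq (hf p') hadd (by simp)) (by simpa using hfp') (fun k => y k - p') hx0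
    (Eventually.of_forall fun k => by simpa using (hyO k).2) (by
      intro u hu hdu
      have hΓ := tan_vec hx0 hu (fun z => Gf f p ρ c (z + p'))
        (AnalyticAt.comp_of_eq (Gf_an (hf p') p ρ c) hadd (by simp))
        (Eventually.of_forall fun k => by
          have := Gf_eq f p ρ c (y k) (hqO _ (hyO k)) (hbO _ (hyO k))
          rw [hyl k, sub_self, smul_zero] at this
          simpa using this)
      filter_upwards [hdu, hΓ] with k hk1 hk2
      rw [fderiv_comp_add_right, sub_add_cancel] at hk1 hk2
      have hyk := hyO k
      have h1 := reg_step (A := fun x => Jd E (fderiv ℝ f x)) (V := Vf f p ρ) (Γ := Gf f p ρ c)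
        (lam := lamf f p ρ c) (w := fun x => qf f x ^ 2 * bf p ρ x) (c := c)
        (Af_an (hf (y k))).differentiableAt (Vf_an (hf _) p ρ (hqO _ hyk) (hbO _ hyk)).differentiableAt
        (lamf_an (hf _) p ρ c (hqO _ hyk) (hbO _ hyk)).differentiableAt
        (((qf_an (hf _)).pow 2).mul (bf_an p ρ _)).differentiableAt
        (by
          filter_upwards [hO.mem_nhds hyk] with x hx
          exact Gf_eq f p ρ c x (hqO x hx) (hbO x hx))
        (hyl k) (mul_ne_zero (pow_ne_zero 2 (hqO _ hyk)) (hbO _ hyk)) (u k) hk2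
      rcases hzreg k (y k) hyk (lamf f p ρ c (y k)) (hyl k) (hyf k) (u k) _ h1 hk1 with h | h
      · exact h
      · exfalso
        apply hqO _ hyk
        rw [qf, h, map_zero])
  have hinv : Tendsto (fun k : ℕ => 1 / ((k : ℝ) + 1)) atTop (𝓝 0) := tendsto_one_div_add_atTop_nhds_zero_nat
  set C₁ := 2 * Real.exp (2 * ρ * ‖c‖) with hC₁
  have hC₁pos : 0 < C₁ := by positivity
  have hbig : ∀ᶠ k : ℕ in atTop, C * C₁ ≤ (k : ℝ) + 1 :=
    (tendsto_atTop_add_const_right _ 1 tendsto_natCast_atTop_atTop).eventually_ge_atTop _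
  obtain ⟨k, h1, h2, h3, h4⟩ := (hloj.and ((hbig.filter_mono hU).and
    (((hinv.eventually (gt_mem_nhds (sub_pos.2 hθ1))).filter_mono hU).and
      ((hflim.eventually (gt_mem_nhds one_pos)).filter_mono hU)))).exists
  rw [fderiv_comp_add_right] at h1
  simp only [sub_add_cancel] at h1
  rw [hyf k] at h1
  have h5 : f (z k) ^ (1 - 1 / ((k : ℝ) + 2)) ≤ f (z k) ^ θ := by
    apply Real.rpow_le_rpow_of_exponent_ge (hz0 k) h4.le
    have : 1 / ((k : ℝ) + 2) ≤ 1 / ((k : ℝ) + 1) := by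
      apply one_div_le_one_div_of_le <;> [positivity; linarith]
    linarith
  have h6 := hzbad k
  have h7 := hyn k
  have h8 : C * ‖fderiv ℝ f (y k)‖ ≤ C * (C₁ * ‖fderiv ℝ f (z k)‖) := by gcongr
  have h9 : C * C₁ * ‖fderiv ℝ f (z k)‖ ≤ ((k : ℝ) + 1) * ‖fderiv ℝ f (z k)‖ := by gcongr
  nlinarith

end
end GFL

namespace GFL
open Topology Set
set_option linter.deprecated false
set_option linter.unusedSimpArgs false
set_option linter.unusedVariables false
set_option linter.unusedSectionVars false

section
variable {E : Type} [NormedAddCommGroup E] [InnerProductSpace ℝ E] [FiniteDimensional ℝ E]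

lemma exists_sol {X : E → E} {K L : NNReal} (hX : LipschitzWith K X) (hL : ∀ x, ‖X x‖ ≤ L) (x : E) :
    ∃ γ : ℝ → E, γ 0 = x ∧ ∀ t, HasDerivAt γ (X (γ t)) t := by
  have h : ∀ N : ℕ, ∃ γ : ℝ → E, γ 0 = x ∧ ∀ t ∈ Ioo (-((N : ℝ) + 1)) ((N : ℝ) + 1), HasDerivAt γ (X (γ t)) t := by
    intro N
    have hN : (0 : ℝ) < (N : ℝ) + 1 := by positivity
    have hpl : IsPicardLindelof (fun _ : ℝ => X) (tmin := -((N : ℝ) + 1)) (tmax := (N : ℝ) + 1)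
        ⟨0, by constructor <;> linarith⟩ x (L * ((N : NNReal) + 1)) 0 L K :=
      { lipschitzOnWith := fun t _ => hX.lipschitzOnWith
        continuousOn := fun _ _ => continuousOn_const
        norm_le := fun _ _ x _ => hL x
        mul_max_le := by simp }
    obtain ⟨α, h0, hα⟩ := hpl.exists_eq_forall_mem_Icc_hasDerivWithinAt₀
    exact ⟨α, h0, fun t ht => (hα t ⟨ht.1.le, ht.2.le⟩).hasDerivAt (Icc_mem_nhds ht.1 ht.2)⟩
  choose g hg0 hg using h
  have huniq : ∀ N M : ℕ, N ≤ M → EqOn (g N) (g M) (Ioo (-((N : ℝ) + 1)) ((N : ℝ) + 1)) := by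
    intro N M hNM
    have hNM' : (N : ℝ) ≤ M := by exact_mod_cast hNM
    have hN : (0 : ℝ) < (N : ℝ) + 1 := by positivity
    refine ODE_solution_unique_of_mem_Ioo (v := fun _ => X) (s := fun _ => univ) (K := K) (t₀ := 0)
      (fun t _ => hX.lipschitzOnWith) ⟨by linarith, by linarith⟩ (fun t ht => ⟨hg N t ht, mem_univ _⟩)
      (fun t ht => ⟨hg M t ⟨by linarith [ht.1], by linarith [ht.2]⟩, mem_univ _⟩) (by rw [hg0, hg0])
  have key : ∀ (N : ℕ) (t : ℝ), t ∈ Ioo (-((N : ℝ) + 1)) ((N : ℝ) + 1) → g ⌈|t|⌉₊ t = g N t := by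
    intro N t ht
    have h1 : t ∈ Ioo (-((⌈|t|⌉₊ : ℝ) + 1)) ((⌈|t|⌉₊ : ℝ) + 1) := by
      have := Nat.le_ceil |t|
      exact abs_lt.1 (by linarith)
    rcases le_total ⌈|t|⌉₊ N with h | h
    · exact huniq _ _ h h1
    · exact (huniq _ _ h ht).symm
  refine ⟨fun t => g ⌈|t|⌉₊ t, hg0 _, fun t => ?_⟩
  have h1 : t ∈ Ioo (-((⌈|t|⌉₊ : ℝ) + 1)) ((⌈|t|⌉₊ : ℝ) + 1) := by
    have := Nat.le_ceil |t|
    exact abs_lt.1 (by linarith)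
  refine (hg ⌈|t|⌉₊ t h1).congr_of_eventuallyEq ?_
  filter_upwards [Ioo_mem_nhds h1.1 h1.2] with s hs
  exact key _ s hs

lemma sol_dist {X : E → E} {K : NNReal} (hX : LipschitzWith K X) {γ η : ℝ → E}
    (hγ : ∀ t, HasDerivAt γ (X (γ t)) t) (hη : ∀ t, HasDerivAt η (X (η t)) t) {t : ℝ} (ht : 0 ≤ t) :
    dist (γ t) (η t) ≤ dist (γ 0) (η 0) * Real.exp (K * t) := by
  have := dist_le_of_trajectories_ODE (v := fun _ => X) (fun _ => hX) (a := 0) (b := t)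
    (fun s _ => (hγ s).continuousAt.continuousWithinAt) (fun s _ => (hγ s).hasDerivWithinAt)
    (fun s _ => (hη s).continuousAt.continuousWithinAt) (fun s _ => (hη s).hasDerivWithinAt) le_rfl t ⟨ht, le_rfl⟩
  simpa using this

lemma decay {g g' : ℝ → ℝ} {a b δ : ℝ} (hab : a ≤ b) (hg : ∀ t ∈ Icc a b, HasDerivAt g (g' t) t)
    (hδ : ∀ t ∈ Icc a b, g' t ≤ -δ) : g b ≤ g a - δ * (b - a) := by
  have h : AntitoneOn (fun t => g t + δ * t) (Icc a b) := by
    have hd : ∀ t ∈ Icc a b, HasDerivAt (fun t => g t + δ * t) (g' t + δ * 1) t := fun t ht =>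
      (hg t ht).add ((hasDerivAt_id t).const_mul δ)
    refine antitoneOn_of_deriv_nonpos (convex_Icc a b) (fun t ht => (hd t ht).continuousAt.continuousWithinAt)
      (fun t ht => (hd t (interior_subset ht)).differentiableAt.differentiableWithinAt) (fun t ht => ?_)
    rw [(hd t (interior_subset ht)).deriv]
    linarith [hδ t (interior_subset ht)]
  have := h ⟨le_rfl, hab⟩ ⟨hab, le_rfl⟩ hab
  simp only at this
  linarith

lemma f_deriv {f : E → ℝ} (hf : ∀ x, AnalyticAt ℝ f x) {γ : ℝ → E} {t : ℝ}
    (hγ : HasDerivAt γ (-(Jd E (fderiv ℝ f (γ t)))) t) :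
    HasDerivAt (fun t => f (γ t)) (-‖fderiv ℝ f (γ t)‖ ^ 2) t := by
  have := (hf (γ t)).differentiableAt.hasFDerivAt.comp_hasDerivAt t hγ
  rw [map_neg, Jd_self] at this
  exact this

/-- length estimate -/
lemma length_bound {f : E → ℝ} (hf : ∀ x, AnalyticAt ℝ f x) {γ : ℝ → E} {a b C θ : ℝ} (hab : a ≤ b)
    (hC : 0 < C) (hθ1 : θ < 1)
    (hγ : ∀ t ∈ Icc a b, HasDerivAt γ (-(Jd E (fderiv ℝ f (γ t)))) t) (hb : 0 < f (γ b))
    (hloj : ∀ t ∈ Icc a b, 0 < f (γ t) → f (γ t) ^ θ ≤ C * ‖fderiv ℝ f (γ t)‖) :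
    ‖γ b - γ a‖ ≤ C / (1 - θ) * f (γ a) ^ (1 - θ) := by
  have hpos : ∀ t ∈ Icc a b, 0 < f (γ t) := by
    intro t ht
    have := decay (δ := 0) ht.2 (fun s hs => f_deriv hf (hγ s ⟨ht.1.trans hs.1, hs.2⟩))
      (fun s hs => by simp)
    linarith
  have h1 : 0 < 1 - θ := by linarith
  have hB : ∀ t ∈ Icc a b, HasDerivAt (fun t => C / (1 - θ) * (f (γ a) ^ (1 - θ) - f (γ t) ^ (1 - θ)))
      (C / (1 - θ) * (0 - (-‖fderiv ℝ f (γ t)‖ ^ 2) * (1 - θ) * f (γ t) ^ (1 - θ - 1))) t := by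
    intro t ht
    have h2 := (f_deriv hf (hγ t ht)).rpow_const (p := 1 - θ) (Or.inl (hpos t ht).ne')
    exact ((hasDerivAt_const t _).sub h2).const_mul _
  have := image_norm_le_of_norm_deriv_right_le_deriv_boundary' (f := fun t => γ t - γ a) (a := a) (b := b)
    (fun t ht => ((hγ t ht).sub_const (γ a)).continuousAt.continuousWithinAt)
    (fun t ht => ((hγ t ⟨ht.1, ht.2.le⟩).sub_const (γ a)).hasDerivWithinAt)
    (by simp) (fun t ht => (hB t ht).continuousAt.continuousWithinAt)
    (fun t ht => (hB t ⟨ht.1, ht.2.le⟩).hasDerivWithinAt) (by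
      intro t ht
      have ht' : t ∈ Icc a b := ⟨ht.1, ht.2.le⟩
      have hp := hpos t ht'
      have hl := hloj t ht' hp
      rw [norm_neg, Jd_norm]
      have e1 : (1 - θ - 1) = -θ := by ring
      rw [e1, Real.rpow_neg hp.le]
      have hpp : 0 < f (γ t) ^ θ := Real.rpow_pos_of_pos hp θ
      have e2 : C / (1 - θ) * (0 - (-‖fderiv ℝ f (γ t)‖ ^ 2) * (1 - θ) * (f (γ t) ^ θ)⁻¹) =
        ‖fderiv ℝ f (γ t)‖ * ((C * ‖fderiv ℝ f (γ t)‖) / f (γ t) ^ θ) := by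
        field_simp
        ring
      rw [e2]
      exact le_mul_of_one_le_right (norm_nonneg _) ((one_le_div hpp).2 hl))
    (right_mem_Icc.2 hab)
  refine this.trans ?_
  have : 0 ≤ f (γ b) ^ (1 - θ) := (Real.rpow_pos_of_pos hb _).le
  gcongr
  linarith

/-- exit of the backward trajectory -/
lemma exit_time {f : E → ℝ} (hf : ∀ x, AnalyticAt ℝ f x) {p : E} {R C θ : ℝ} (hC : 0 < C) (hθ0 : 0 ≤ θ)
    (hloj : ∀ x ∈ Metric.closedBall p R, 0 < f x → f x ^ θ ≤ C * ‖fderiv ℝ f x‖)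
    {η : ℝ → E} (hc : Continuous η)
    (hη : ∀ t, η t ∈ Metric.closedBall p R → HasDerivAt η (-(Jd E (fderiv ℝ f (η t)))) t)
    (h0 : η 0 ∈ Metric.ball p R) (hf0 : 0 < f (η 0)) :
    ∃ T, 0 ≤ T ∧ dist (η (-T)) p = R ∧ ∀ t ∈ Icc (-T) 0, η t ∈ Metric.closedBall p R := by
  have hdc : Continuous fun t => dist (η (-t)) p := by fun_prop
  have hne : ∃ t, 0 ≤ t ∧ R ≤ dist (η (-t)) p := by
    by_contra! hcon
    have hin : ∀ t ≤ 0, η t ∈ Metric.closedBall p R := fun t ht => by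
      have := hcon (-t) (by linarith)
      rw [neg_neg] at this
      exact Metric.mem_closedBall.2 this.le
    have hfc : Continuous f := continuous_iff_continuousAt.2 fun x => (hf x).continuousAt
    obtain ⟨M, hM⟩ := (isCompact_closedBall p R).bddAbove_image hfc.continuousOn
    have hM' : ∀ t ≤ 0, f (η t) ≤ M := fun t ht => hM ⟨_, hin t ht, rfl⟩
    have hmono : ∀ t ≤ 0, f (η 0) ≤ f (η t) := by
      intro t ht
      have := decay (δ := 0) ht (fun s hs => f_deriv hf (hη s (hin s hs.2))) (fun s hs => by simp)
      linarith
    set d := f (η 0) ^ θ / C with hd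
    have hdpos : 0 < d := div_pos (Real.rpow_pos_of_pos hf0 θ) hC
    have hlow : ∀ t ≤ 0, d ≤ ‖fderiv ℝ f (η t)‖ := by
      intro t ht
      have h1 := hmono t ht
      have h2 := hloj _ (hin t ht) (hf0.trans_le h1)
      rw [hd, div_le_iff₀ hC, mul_comm _ C]
      exact (Real.rpow_le_rpow hf0.le h1 hθ0).trans h2
    have hMpos : 0 < M := hf0.trans_le (hM' 0 le_rfl)
    have hT : -(M / d ^ 2) ≤ 0 := by rw [neg_nonpos]; positivity
    have := decay (δ := d ^ 2) hT (fun s hs => f_deriv hf (hη s (hin s hs.2)))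
      (fun s hs => by
        have := hlow s hs.2
        have : d ^ 2 ≤ ‖fderiv ℝ f (η s)‖ ^ 2 := by gcongr
        linarith)
    have e : d ^ 2 * (0 - -(M / d ^ 2)) = M := by field_simp; ring
    rw [e] at this
    linarith [hM' _ hT]
  let S : Set ℝ := {t | 0 ≤ t ∧ R ≤ dist (η (-t)) p}
  have hS : IsClosed S := (isClosed_le continuous_const continuous_id).inter (isClosed_le continuous_const hdc)
  have hSb : BddBelow S := ⟨0, fun t ht => ht.1⟩
  have hTS : sInf S ∈ S := hS.csInf_mem hne hSb
  set T := sInf S with hT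
  have hlt : ∀ t, 0 ≤ t → t < T → dist (η (-t)) p < R := by
    intro t h1 h2
    by_contra hcon
    exact absurd (csInf_le hSb (show t ∈ S from ⟨h1, not_lt.1 hcon⟩)) (not_le.2 h2)
  have hTR : dist (η (-T)) p = R := by
    apply le_antisymm _ hTS.2
    by_contra hcon
    push Not at hcon
    have := intermediate_value_Icc hTS.1 hdc.continuousOn
    obtain ⟨t, ht, htR⟩ := this ⟨by simpa using (Metric.mem_ball.1 h0).le, hcon.le⟩
    simp only at htR
    rcases ht.2.lt_or_eq with h | h
    · exact absurd htR (hlt t ht.1 h).ne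
    · rw [h] at htR; exact absurd htR hcon.ne'
  refine ⟨T, hTS.1, hTR, fun t ht => ?_⟩
  rw [Metric.mem_closedBall]
  rcases ht.1.lt_or_eq with h | h
  · have := hlt (-t) (by linarith [ht.2]) (by linarith)
    rw [neg_neg] at this
    exact this.le
  · rw [← h]; exact hTR.le

end
end GFL

namespace GFL
open Topology Set
set_option linter.deprecated false
set_option linter.unusedSimpArgs false
set_option linter.unusedVariables false
set_option linter.unusedSectionVars false

section
variable {E : Type} [NormedAddCommGroup E] [InnerProductSpace ℝ E] [FiniteDimensional ℝ E]

lemma exists_field {f : E → ℝ} (hf : ∀ x, AnalyticAt ℝ f x) (p : E) {R : ℝ} (hR : 0 < R) :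
    ∃ (X : E → E) (K L : NNReal), LipschitzWith K X ∧ (∀ x, ‖X x‖ ≤ L) ∧
      ∀ x ∈ Metric.closedBall p R, X x = -(Jd E (fderiv ℝ f x)) := by
  let χ : ContDiffBump p := ⟨R, 2 * R, hR, by linarith⟩
  let X : E → E := fun x => χ x • (-(Jd E (fderiv ℝ f x)))
  have hXs : HasCompactSupport X := χ.hasCompactSupport.smul_right
  have hXd : ContDiff ℝ 1 X := by
    refine ContDiff.smul χ.contDiff (ContDiff.neg ?_)
    rw [contDiff_iff_contDiffAt]
    intro x
    exact (Af_an (hf x)).contDiffAt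
  obtain ⟨K, hK⟩ := ContDiff.lipschitzWith_of_hasCompactSupport hXs hXd one_ne_zero
  obtain ⟨L, hL⟩ := hXs.exists_bound_of_continuous hXd.continuous
  refine ⟨X, K, ⟨max L 0, le_max_right _ _⟩, hK, fun x => (hL x).trans (le_max_left _ _), fun x hx => ?_⟩
  simp only [X]
  rw [χ.one_of_mem_closedBall hx, one_smul]

theorem main_flow (f : E → ℝ) (hf : ∀ x, AnalyticAt ℝ f x) (hnonneg : ∀ x, 0 ≤ f x)
    (hint : interior (f ⁻¹' {0}) = ∅) (p : E) (hfp : f p = 0) :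
    ∃ γ : ℝ → E, (∀ t : ℝ, 0 ≤ t → HasDerivAt γ (-(Jd E (fderiv ℝ f (γ t)))) t) ∧
        (∃ t₁ t₂ : ℝ, 0 ≤ t₁ ∧ 0 ≤ t₂ ∧ γ t₁ ≠ γ t₂) ∧ Tendsto γ atTop (𝓝 p) := by
  obtain ⟨r, C, θ, hr, hC, hθ0, hθ1, hloj'⟩ := lojasiewicz f hf p hfp
  have hfc : Continuous f := continuous_iff_continuousAt.2 fun x => (hf x).continuousAt
  set R := r / 2 with hRdef
  have hR : 0 < R := by positivity
  have hloj : ∀ x ∈ Metric.closedBall p R, 0 < f x → f x ^ θ ≤ C * ‖fderiv ℝ f x‖ := fun x hx =>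
    hloj' x (Metric.closedBall_subset_ball (by linarith) hx)
  obtain ⟨X, K, L, hK, hL, hX⟩ := exists_field hf p hR
  -- initial points
  have hx : ∀ k : ℕ, ∃ x ∈ Metric.ball p (min R (1 / ((k : ℝ) + 1))), 0 < f x := by
    intro k
    by_contra! hcon
    have h1 : Metric.ball p (min R (1 / ((k : ℝ) + 1))) ⊆ interior (f ⁻¹' {0}) :=
      interior_maximal (fun x hx => le_antisymm (hcon x hx) (hnonneg x)) Metric.isOpen_ball
    rw [hint] at h1
    exact h1 (Metric.mem_ball_self (by positivity))
  choose x hxb hxf using hx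
  have hxlim : Tendsto x atTop (𝓝 p) := by
    rw [tendsto_iff_dist_tendsto_zero]
    refine squeeze_zero (fun _ => dist_nonneg) (fun k => ?_) tendsto_one_div_add_atTop_nhds_zero_nat
    exact (Metric.mem_ball.1 (hxb k)).le.trans (min_le_right _ _)
  choose η hη0 hη using fun k => exists_sol hK hL (x k)
  have hηc : ∀ k, Continuous (η k) := fun k => continuous_iff_continuousAt.2 fun t => (hη k t).continuousAt
  have hT : ∀ k, ∃ T, 0 ≤ T ∧ dist (η k (-T)) p = R ∧ ∀ t ∈ Icc (-T) 0, η k t ∈ Metric.closedBall p R := by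
    intro k
    refine exit_time hf hC hθ0 hloj (hηc k) (fun t ht => ?_) ?_ ?_
    · rw [← hX _ ht]; exact hη k t
    · rw [hη0]; exact Metric.ball_subset_ball (min_le_left _ _) (hxb k)
    · rw [hη0]; exact hxf k
  choose T hT0 hTR hTin using hT
  let U : Ultrafilter ℕ := hyperfilter ℕ
  have hU : (U : Filter ℕ) ≤ atTop := by
    rw [← Nat.cofinite_eq_atTop]; exact hyperfilter_le_cofinite
  obtain ⟨y, hyK, hy'⟩ := (isCompact_sphere p R).ultrafilter_le_nhds (U.map fun k => η k (-T k))
    (le_principal_iff.2 (by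
      change ∀ᶠ k in (U : Filter ℕ), η k (-T k) ∈ Metric.sphere p R
      exact Eventually.of_forall fun k => hTR k))
  have hy : Tendsto (fun k => η k (-T k)) U (𝓝 y) := hy'
  obtain ⟨γ, hγ0, hγ⟩ := exists_sol hK hL y
  -- shifted curves
  let g : ℕ → ℝ → E := fun k t => η k (t + -T k)
  have hg : ∀ k t, HasDerivAt (g k) (X (g k t)) t := fun k t => (hη k (t + -T k)).comp_add_const t (-T k)
  have hglim : ∀ t, 0 ≤ t → Tendsto (fun k => g k t) U (𝓝 (γ t)) := by
    intro t ht
    rw [tendsto_iff_dist_tendsto_zero]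
    refine squeeze_zero (fun _ => dist_nonneg) (fun k => sol_dist hK (hg k) hγ ht) ?_
    have h1 : Tendsto (fun k => dist (g k 0) (γ 0)) U (𝓝 0) := by
      have := tendsto_iff_dist_tendsto_zero.1 hy
      simpa [g, hγ0] using this
    simpa using h1.mul_const (Real.exp (K * t))
  -- the critical point
  have hXp : X p = 0 := by
    rw [hX p (Metric.mem_closedBall_self hR.le)]
    have : IsLocalMin f p := Eventually.of_forall fun z => by rw [hfp]; exact hnonneg z
    rw [this.fderiv_eq_zero]; simp
  -- times go to infinity
  have hTinf : ∀ t : ℝ, ∀ᶠ k in (U : Filter ℕ), t ≤ T k := by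
    intro t
    have h1 : ∀ᶠ k in (U : Filter ℕ), dist (x k) p * Real.exp (K * t) < R := by
      have h2 := (tendsto_iff_dist_tendsto_zero.1 (hxlim.mono_left hU)).mul_const (Real.exp (K * t))
      rw [zero_mul] at h2
      exact h2.eventually (gt_mem_nhds hR)
    filter_upwards [h1] with k hk
    by_contra hcon
    push Not at hcon
    have h3 : LipschitzWith K (fun z => - X z) := hK.neg
    have h4 := sol_dist h3 (γ := fun s => η k (-s)) (η := fun _ => p)
      (fun s => by
        have := (hη k (-s)).scomp s (hasDerivAt_neg s)
        simpa [Function.comp_def] using this)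
      (fun s => by rw [hXp, neg_zero]; exact hasDerivAt_const s p) (hT0 k)
    simp only [neg_zero, hη0, hTR] at h4
    have h5 : Real.exp (K * T k) ≤ Real.exp (K * t) := by gcongr
    have h6 : dist (x k) p * Real.exp (K * T k) ≤ dist (x k) p * Real.exp (K * t) := by gcongr
    linarith
  have hgin : ∀ t, 0 ≤ t → ∀ᶠ k in (U : Filter ℕ), g k t ∈ Metric.closedBall p R ∧
      ‖x k - g k t‖ ≤ C / (1 - θ) * f (g k t) ^ (1 - θ) := by
    intro t ht
    filter_upwards [hTinf t] with k hk
    have hin : ∀ s ∈ Icc t (T k), g k s ∈ Metric.closedBall p R := fun s hs =>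
      hTin k _ ⟨by linarith [hs.1], by linarith [hs.2]⟩
    refine ⟨hin t ⟨le_rfl, hk⟩, ?_⟩
    have hxk : g k (T k) = x k := by simp [g, hη0]
    have := length_bound hf (γ := g k) hk hC hθ1 (fun s hs => by rw [← hX _ (hin s hs)]; exact hg k s)
      (by rw [hxk]; exact hxf k) (fun s hs => hloj _ (hin s hs))
    rwa [hxk] at this
  have h1θ : 0 < 1 - θ := by linarith
  have hγin : ∀ t, 0 ≤ t → γ t ∈ Metric.closedBall p R := fun t ht =>
    Metric.isClosed_closedBall.mem_of_tendsto (hglim t ht) ((hgin t ht).mono fun k hk => hk.1)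
  have hγb : ∀ t, 0 ≤ t → ‖p - γ t‖ ≤ C / (1 - θ) * f (γ t) ^ (1 - θ) := by
    intro t ht
    refine le_of_tendsto_of_tendsto ((hxlim.mono_left hU).sub (hglim t ht)).norm ?_
      ((hgin t ht).mono fun k hk => hk.2)
    exact ((((hfc.tendsto _).comp (hglim t ht)).rpow_const (Or.inr h1θ.le))).const_mul _
  have hγd : ∀ t, 0 ≤ t → HasDerivAt γ (-(Jd E (fderiv ℝ f (γ t)))) t := fun t ht => by
    rw [← hX _ (hγin t ht)]; exact hγ t
  have hanti : ∀ s t, 0 ≤ s → s ≤ t → f (γ t) ≤ f (γ s) := by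
    intro s t hs hst
    have := decay (δ := 0) hst (fun w hw => f_deriv hf (hγd w (hs.trans hw.1))) (fun w _ => by simp)
    linarith
  have hflim : Tendsto (fun t => f (γ t)) atTop (𝓝 0) := by
    rw [Metric.tendsto_atTop]
    intro ε hε
    have hex : ∃ t, 0 ≤ t ∧ f (γ t) < ε := by
      by_contra! hcon
      set d := ε ^ θ / C with hd
      have hdpos : 0 < d := div_pos (Real.rpow_pos_of_pos hε θ) hC
      have hlow : ∀ t, 0 ≤ t → d ≤ ‖fderiv ℝ f (γ t)‖ := by
        intro t ht
        have h1 := hcon t ht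
        have h2 := hloj _ (hγin t ht) (hε.trans_le h1)
        rw [hd, div_le_iff₀ hC, mul_comm _ C]
        exact (Real.rpow_le_rpow hε.le h1 hθ0).trans h2
      have hTT : 0 ≤ f (γ 0) / d ^ 2 := div_nonneg (hnonneg _) (by positivity)
      have := decay (δ := d ^ 2) hTT (fun w hw => f_deriv hf (hγd w hw.1)) (fun s hs => by
        have := hlow s hs.1
        have : d ^ 2 ≤ ‖fderiv ℝ f (γ s)‖ ^ 2 := by gcongr
        linarith)
      have e : d ^ 2 * (f (γ 0) / d ^ 2 - 0) = f (γ 0) := by field_simp; ring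
      rw [e] at this
      linarith [hcon _ hTT]
    obtain ⟨t₀, ht₀, hlt⟩ := hex
    refine ⟨t₀, fun t ht => ?_⟩
    rw [Real.dist_eq, sub_zero, abs_of_nonneg (hnonneg _)]
    exact (hanti t₀ t ht₀ ht).trans_lt hlt
  have hlim : Tendsto γ atTop (𝓝 p) := by
    rw [tendsto_iff_dist_tendsto_zero]
    have h0 : Tendsto (fun t => C / (1 - θ) * f (γ t) ^ (1 - θ)) atTop (𝓝 0) := by
      have := (hflim.rpow_const (p := 1 - θ) (Or.inr h1θ.le)).const_mul (C / (1 - θ))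
      rwa [Real.zero_rpow h1θ.ne', mul_zero] at this
    refine squeeze_zero' (Eventually.of_forall fun _ => dist_nonneg) ?_ h0
    filter_upwards [eventually_ge_atTop 0] with t ht
    rw [dist_comm, dist_eq_norm]
    exact hγb t ht
  refine ⟨γ, hγd, ?_, hlim⟩
  have hne : p ≠ γ 0 := by
    rw [hγ0]
    rintro rfl
    have : dist p p = R := hyK
    rw [dist_self] at this
    exact hR.ne this
  obtain ⟨t, h1, h2⟩ := ((hlim.eventually_ne hne).and (eventually_ge_atTop 0)).exists
  exact ⟨t, 0, h2, le_rfl, h1⟩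

end
end GFL

/-- For a nonnegative analytic `f` whose zero set `N = f⁻¹(0)` is
nonempty with empty interior, every point of `N` is the limit of a nonconstant
gradient flow. -/
theorem every_zero_is_limit_of_nonconstant_gradient_flow
    (n : ℕ)
    (f : EuclideanSpace ℝ (Fin n) → ℝ)
    (hf : ∀ x, AnalyticAt ℝ f x)
    (hnonneg : ∀ x, 0 ≤ f x)
    (hne : (f ⁻¹' {0}).Nonempty)
    (hint : interior (f ⁻¹' {0}) = ∅) :
    ∀ p ∈ f ⁻¹' {0},
      ∃ γ : ℝ → EuclideanSpace ℝ (Fin n),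
        (∀ t : ℝ, 0 ≤ t → HasDerivAt γ (-(gradient f (γ t))) t) ∧
        (∃ t₁ t₂ : ℝ, 0 ≤ t₁ ∧ 0 ≤ t₂ ∧ γ t₁ ≠ γ t₂) ∧
        Tendsto γ atTop (nhds p) := by
  intro p hp
  exact GFL.main_flow f hf hnonneg hint p hp
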